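/- Fix d ≥ 2. There exists a constant C₁₀ > 0 such that for every n ≥ 1 and every nonempty set S ⊆ B[n], the event { for all real a ≥ 1, A_{⌊(a−1)|S|⌋}(S) ⊆ B[n a^{1/d}(1 + C₁₀ n^{−1/(5d)})] } occurs with probability superpolynomially large in |S|: for every k > 0 there is a constant C_k with P(failure) ≤ C_k |S|^{−k}, uniformly in n and S ⊆ B[n]. -/

import Mathlib

open MeasureTheory Filter
open scoped ENNReal

noncomputable section

/-- The `k`-th binary digit of `x ∈ [0,1)` (after the binary point). -/
def bit (x : ℝ) (k : ℕ) : Bool := ⌊x * 2 ^ (k + 1)⌋ % 2 == 1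

/-- From one uniform sample on `[0,1]`, extract countably many independent uniform
samples on `[0,1]`, using disjoint subsequences of binary digits. -/
def uSlice (x : ℝ) (i : ℕ) : ℝ :=
  ∑' j : ℕ, if bit x (Nat.pair i j) then ((2 : ℝ) ^ (-(j : ℤ) - 1)) else 0

/-- The base probability space: Lebesgue measure restricted to `[0,1]`. -/
def μ0 : Measure ℝ := volume.restrict (Set.Icc 0 1)

/-- The vertex set of the lattice `ℤ^d`. -/
abbrev V (d : ℕ) := Fin d → ℤ

instance (d : ℕ) : MeasurableSpace (Finset (V d)) := ⊤

open Classical in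
/-- `B[r]`: the Euclidean ball of radius `r` in `ℤ^d`, as a `Finset`. -/
def ball (d : ℕ) (r : ℝ) : Finset (V d) :=
  (Finset.Icc (fun _ => -⌈r⌉) (fun _ => ⌈r⌉)).filter
    (fun y => Real.sqrt (∑ i, ((y i : ℝ)) ^ 2) ≤ r)

/-- `b_n`: the number of lattice points in the Euclidean ball of radius `n`. -/
def bn (d n : ℕ) : ℕ := (ball d n).card

/-- The `2d` unit vectors of `ℤ^d` (the possible steps of the simple random walk). -/
def unitVecs (d : ℕ) : Finset (V d) :=
  Finset.image
    (fun p : Fin d × Bool => fun j => if j = p.1 then (if p.2 then 1 else -1) else 0)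
    Finset.univ

/-- Given `u` uniform on `[0,1]`, `pick S u` is a uniformly chosen element of `S`. -/
def pick {d : ℕ} (S : Finset (V d)) (u : ℝ) : V d :=
  if h : S.Nonempty then
    (S.equivFin.symm ⟨(⌊u * S.card⌋).toNat % S.card,
      Nat.mod_lt _ (Finset.card_pos.mpr h)⟩).val
  else 0

/-- Position at time `t` of the simple random walk started at `x`, driven by the
random seed `ω`: the steps `pick (unitVecs d) (uSlice ω i)` are i.i.d. uniform on
the `2d` unit vectors when `ω` is uniform on `[0,1]`. -/
def walk {d : ℕ} (x : V d) (ω : ℝ) (t : ℕ) : V d :=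
  x + ∑ i ∈ Finset.range t, pick (unitVecs d) (uSlice ω i)

/-- `t_S`: the first time the walk started at `x` is outside `S`. -/
def exitT {d : ℕ} (S : Finset (V d)) (x : V d) (ω : ℝ) : ℕ :=
  sInf {t | walk x ω t ∉ S}

/-- The position `ξ(t_S)` at which the walk started at `x` first exits `S`. -/
def hitPt {d : ℕ} (S : Finset (V d)) (x : V d) (ω : ℝ) : V d :=
  walk x ω (exitT S x ω)

/-- `Add[ξ,S]`: add to `S` the exit point of a random walk started at `x`. -/
def addPt {d : ℕ} (S : Finset (V d)) (x : V d) (ω : ℝ) : Finset (V d) :=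
  insert (hitPt S x ω) S

/-- `P_x(ξ(τ_A) = y)`: the probability that the walk started at `x` exits `A` at `y`. -/
def hitProb {d : ℕ} (A : Finset (V d)) (x y : V d) : ℝ≥0∞ :=
  μ0 {ω | hitPt A x ω = y}

/-- The outer boundary `∂A`: vertices outside `A` with a neighbour in `A`. -/
def outb {d : ℕ} (A : Finset (V d)) : Finset (V d) :=
  (A.biUnion fun x => (unitVecs d).image (fun e => x + e)) \ A

/-- `DA_X(S)`: the IDLA aggregate obtained from `S` by launching one particle from each
point of the list `xs` in turn (driven by independent slices of the seed `ω`). -/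
def daFrom {d : ℕ} : Finset (V d) → List (V d) → ℝ → Finset (V d)
  | S, [], _ => S
  | S, x :: xs, ω => daFrom (addPt S x (uSlice ω 0)) xs (uSlice ω 1)

/-- The law of the IDLA aggregate `DA_X(S)`. -/
def daLaw {d : ℕ} (S : Finset (V d)) (xs : List (V d)) : Measure (Finset (V d)) :=
  μ0.map (fun ω => daFrom S xs ω)

/-- One uIDLA step: launch a particle from a uniformly chosen point of `S`. -/
def uStep {d : ℕ} (S : Finset (V d)) (ω : ℝ) : Finset (V d) :=
  addPt S (pick S (uSlice ω 0)) (uSlice ω 1)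

/-- `A_k(S)`: the uIDLA aggregate obtained by adding `k` particles to `S`,
each started at a uniform point of the current aggregate. -/
def uAggFrom {d : ℕ} (S : Finset (V d)) (ω : ℝ) : ℕ → Finset (V d)
  | 0 => S
  | k + 1 => uStep (uAggFrom S ω k) (uSlice ω k)

/-- The law of the uIDLA aggregate `A_k(S)`. -/
def uLaw {d : ℕ} (S : Finset (V d)) (k : ℕ) : Measure (Finset (V d)) :=
  μ0.map (fun ω => uAggFrom S ω k)

/-- One step of the subset uIDLA `A_·(E;m)`: at step `k`, perform a uIDLA step
with probability `|E|/(m+k)` and otherwise do nothing. -/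
def subStep {d : ℕ} (m k : ℕ) (E : Finset (V d)) (ω : ℝ) : Finset (V d) :=
  if uSlice ω 0 * ((m : ℝ) + k) ≤ E.card then uStep E (uSlice ω 1) else E

/-- The subset uIDLA `A_n(E;m)`. -/
def subAggFrom {d : ℕ} (E : Finset (V d)) (m : ℕ) (ω : ℝ) : ℕ → Finset (V d)
  | 0 => E
  | k + 1 => subStep m k (subAggFrom E m ω k) (uSlice ω k)

/-- The law of the subset uIDLA `A_n(E;m)`. -/
def subLaw {d : ℕ} (E : Finset (V d)) (m k : ℕ) : Measure (Finset (V d)) :=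
  μ0.map (fun ω => subAggFrom E m ω k)

/-- Stochastic domination of random finite subsets of `ℤ^d`: `μ` dominates `ν` if
there is a coupling under which the sample of `ν` is a.s. contained in that of `μ`. -/
def StochDom {d : ℕ} (μ ν : Measure (Finset (V d))) : Prop :=
  ∃ π : Measure (Finset (V d) × Finset (V d)), IsProbabilityMeasure π ∧
    π.map Prod.fst = μ ∧ π.map Prod.snd = ν ∧ π {p | p.2 ⊆ p.1} = 1

/-- A `Geometric(1/2)` sample (taking value `j ≥ 0` with probability `2^{-(j+1)}`)
produced from a uniform sample `u` on `[0,1]` by inverting the CDF. -/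
def geom (u : ℝ) : ℕ := sInf {j : ℕ | u ≤ 1 - (2 : ℝ) ^ (-(j : ℤ) - 1)}

/-- The parent of vertex `j ≥ 1` in the uniform random recursive tree (vertex `0` is
the root): uniform on `{0, …, j-1}` when the seed is uniform on `[0,1]`. -/
def parent (ω : ℝ) (j : ℕ) : ℕ := (⌊uSlice ω (Nat.pair 0 j) * j⌋).toNat % j

/-- The reaching time of vertex `j` in a uniform random recursive tree whose edges
carry i.i.d. `Geometric(1/2)` weights: the sum of the weights on the path from the
root to `j`. (The `min` is a.s. inoperative, since a.s. `parent ω (j+1) ≤ j`.) -/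
def reach (ω : ℝ) : ℕ → ℕ
  | 0 => 0
  | j + 1 => reach ω (min (parent ω (j + 1)) j) + geom (uSlice ω (Nat.pair 1 (j + 1)))
termination_by j => j
decreasing_by exact Nat.lt_succ_of_le (min_le_right _ _)

end

namespace UI
noncomputable section

/-- squared Euclidean norm -/
def nsq {d : ℕ} (x : V d) : ℝ := ∑ i, ((x i : ℝ)) ^ 2

/-- discrete Laplacian -/
def Lap {d : ℕ} (h : V d → ℝ) (x : V d) : ℝ := (∑ e ∈ unitVecs d, h (x + e)) / (2 * d) - h x

lemma unit_inj {d : ℕ} : Function.Injective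
    (fun p : Fin d × Bool => (fun j => if j = p.1 then (if p.2 then 1 else -1) else 0 : V d)) := by
  rintro ⟨i, a⟩ ⟨j, b⟩ h
  have h1 := congrFun h i
  by_cases hij : i = j
  · subst hij
    cases a <;> cases b <;> simp at h1 ⊢
  · simp [hij] at h1
    cases a <;> simp at h1

lemma card_unitVecs (d : ℕ) : (unitVecs d).card = 2 * d := by
  unfold unitVecs
  rw [Finset.card_image_of_injective _ unit_inj]
  simp [mul_comm]

lemma sum_unitVecs {d : ℕ} {M : Type*} [AddCommMonoid M] (F : V d → M) :
    ∑ e ∈ unitVecs d, F e = ∑ i, (F (Pi.single i 1) + F (Pi.single i (-1))) := by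
  unfold unitVecs
  rw [Finset.sum_image (fun a _ b _ h => unit_inj h), Fintype.sum_prod_type]
  refine Finset.sum_congr rfl fun i _ => ?_
  rw [Fintype.sum_bool]
  congr 2 <;> ext j <;> by_cases hj : j = i <;> simp [hj]

lemma mem_unitVecs {d : ℕ} {e : V d} :
    e ∈ unitVecs d ↔ ∃ i, e = Pi.single i 1 ∨ e = Pi.single i (-1) := by
  unfold unitVecs
  simp only [Finset.mem_image, Finset.mem_univ, true_and, Prod.exists, Bool.exists_bool]
  refine exists_congr fun i => ?_
  have h1 : (fun j => if j = i then (if true = true then 1 else -1) else 0 : V d) = Pi.single i 1 := by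
    ext j; by_cases hj : j = i <;> simp [hj]
  have h2 : (fun j => if j = i then (if false = true then 1 else -1) else 0 : V d) = Pi.single i (-1) := by
    ext j; by_cases hj : j = i <;> simp [hj]
  simp only [if_true, Bool.false_eq_true, if_false] at h1 h2 ⊢
  rw [h1, h2]
  constructor
  · rintro (h | h)
    · exact Or.inr h.symm
    · exact Or.inl h.symm
  · rintro (h | h)
    · exact Or.inr h.symm
    · exact Or.inl h.symm

lemma neg_mem_unitVecs {d : ℕ} {e : V d} (h : e ∈ unitVecs d) : -e ∈ unitVecs d := by
  rw [mem_unitVecs] at *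
  obtain ⟨i, h | h⟩ := h
  · exact ⟨i, Or.inr (by rw [h, ← Pi.single_neg])⟩
  · exact ⟨i, Or.inl (by rw [h, ← Pi.single_neg]; simp)⟩

lemma nsq_nonneg {d : ℕ} (x : V d) : 0 ≤ nsq x := Finset.sum_nonneg fun i _ => sq_nonneg _

lemma nsq_add_single {d : ℕ} (x : V d) (i : Fin d) (a : ℤ) :
    nsq (x + Pi.single i a) = nsq x + 2 * a * x i + (a : ℝ) ^ 2 := by
  unfold nsq
  have : ∀ j, (((x + Pi.single i a : V d) j : ℤ) : ℝ) ^ 2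
      = ((x j : ℝ)) ^ 2 + (if j = i then 2 * a * (x i : ℝ) + (a : ℝ) ^ 2 else 0) := by
    intro j
    by_cases hj : j = i
    · subst hj; simp; ring
    · simp [hj]
  rw [Finset.sum_congr rfl fun j _ => this j, Finset.sum_add_distrib]
  simp
  ring

lemma Lap_eq {d : ℕ} (h : V d → ℝ) (x : V d) :
    Lap h x = (∑ i, (h (x + Pi.single i 1) + h (x + Pi.single i (-1)))) / (2 * d) - h x := by
  unfold Lap
  rw [sum_unitVecs (fun e => h (x + e))]

/-- average form of the Laplacian -/
lemma Lap_eq' {d : ℕ} (hd : 0 < d) (h : V d → ℝ) (x : V d) :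
    Lap h x = (∑ i, (h (x + Pi.single i 1) + h (x + Pi.single i (-1)) - 2 * h x)) / (2 * d) := by
  rw [Lap_eq, Finset.sum_sub_distrib]
  have : (d : ℝ) ≠ 0 := by positivity
  simp
  field_simp

lemma Lap_nsq {d : ℕ} (hd : 0 < d) (x : V d) : Lap nsq x = 1 := by
  rw [Lap_eq' hd]
  have : ∀ i, nsq (x + Pi.single i 1) + nsq (x + Pi.single i (-1)) - 2 * nsq x = 2 := by
    intro i
    rw [nsq_add_single, nsq_add_single]; push_cast; ring
  rw [Finset.sum_congr rfl fun i _ => this i]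
  have : (d : ℝ) ≠ 0 := by positivity
  simp; field_simp

lemma Lap_add {d : ℕ} (f g : V d → ℝ) (x : V d) : Lap (fun y => f y + g y) x = Lap f x + Lap g x := by
  unfold Lap; rw [Finset.sum_add_distrib]; ring

lemma Lap_sub {d : ℕ} (f g : V d → ℝ) (x : V d) : Lap (fun y => f y - g y) x = Lap f x - Lap g x := by
  unfold Lap; rw [Finset.sum_sub_distrib]; ring

lemma Lap_smul {d : ℕ} (c : ℝ) (f : V d → ℝ) (x : V d) : Lap (fun y => c * f y) x = c * Lap f x := by
  unfold Lap; rw [← Finset.mul_sum]; ring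

lemma Lap_neg {d : ℕ} (f : V d → ℝ) (x : V d) : Lap (fun y => - f y) x = - Lap f x := by
  unfold Lap; rw [Finset.sum_neg_distrib]; ring

lemma Lap_const {d : ℕ} (hd : 0 < d) (c : ℝ) (x : V d) : Lap (fun _ => c) x = 0 := by
  unfold Lap
  have : (d : ℝ) ≠ 0 := by positivity
  simp [card_unitVecs]; field_simp; simp

lemma Lap_sum {d : ℕ} {ι : Type*} (T : Finset ι) (f : ι → V d → ℝ) (x : V d) :
    Lap (fun y => ∑ i ∈ T, f i y) x = ∑ i ∈ T, Lap (f i) x := by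
  unfold Lap
  rw [Finset.sum_comm, Finset.sum_div, ← Finset.sum_sub_distrib]

lemma Lap_translate {d : ℕ} (h : V d → ℝ) (z x : V d) : Lap (fun y => h (y - z)) x = Lap h (x - z) := by
  unfold Lap
  congr 2
  refine Finset.sum_congr rfl fun e _ => ?_
  rw [sub_add_eq_add_sub]

/-- comparison of Laplacians when touching at `x` -/
lemma Lap_le_of_touch {d : ℕ} (f g : V d → ℝ) (x : V d) (h : ∀ e ∈ unitVecs d, f (x + e) ≤ g (x + e))
    (hx : f x = g x) : Lap f x ≤ Lap g x := by
  unfold Lap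
  rw [hx]
  gcongr with e he
  exact h e he

lemma Lap_congr {d : ℕ} (f g : V d → ℝ) (x : V d) (h : ∀ e ∈ unitVecs d, f (x + e) = g (x + e))
    (hx : f x = g x) : Lap f x = Lap g x := by
  unfold Lap
  rw [hx, Finset.sum_congr rfl h]

/-- maximum principle -/
lemma maxP {d : ℕ} (hd : 0 < d) (A : Finset (V d)) (h : V d → ℝ) (c : ℝ)
    (hL : ∀ x ∈ A, 0 ≤ Lap h x)
    (hb : ∀ x ∈ A, ∀ e ∈ unitVecs d, x + e ∉ A → h (x + e) ≤ c) : ∀ x ∈ A, h x ≤ c := by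
  classical
  by_contra hcon
  push Not at hcon
  obtain ⟨x1, hx1, hc1⟩ := hcon
  obtain ⟨x2, hx2, hmax⟩ := A.exists_max_image h ⟨x1, hx1⟩
  have hM : c < h x2 := lt_of_lt_of_le hc1 (hmax x1 hx1)
  obtain ⟨x0, hx0, hmax0⟩ := (A.filter (fun x => h x = h x2)).exists_max_image nsq
    ⟨x2, by simp [hx2]⟩
  rw [Finset.mem_filter] at hx0
  have hd' : (0 : ℝ) < d := by exact_mod_cast hd
  have hle : ∀ e ∈ unitVecs d, h (x0 + e) ≤ h x2 := by
    intro e he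
    by_cases hA : x0 + e ∈ A
    · exact hmax _ hA
    · exact (hb x0 hx0.1 e he hA).trans hM.le
  have hsum : ∑ e ∈ unitVecs d, (h x2 - h (x0 + e)) ≤ 0 := by
    have h1 := hL x0 hx0.1
    unfold Lap at h1
    rw [hx0.2] at h1
    rw [Finset.sum_sub_distrib]
    simp only [Finset.sum_const, card_unitVecs, nsmul_eq_mul]
    push_cast
    have h2 : h x2 ≤ (∑ e ∈ unitVecs d, h (x0 + e)) / (2 * d) := by linarith
    rw [le_div_iff₀ (by positivity)] at h2
    linarith
  have hall : ∀ e ∈ unitVecs d, h x2 - h (x0 + e) = 0 := by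
    refine (Finset.sum_eq_zero_iff_of_nonneg ?_).1 (le_antisymm hsum ?_)
    · intro e he; linarith [hle e he]
    · exact Finset.sum_nonneg fun e he => by linarith [hle e he]
  have hmem : ∀ e ∈ unitVecs d, nsq (x0 + e) ≤ nsq x0 := by
    intro e he
    apply hmax0
    rw [Finset.mem_filter]
    refine ⟨?_, by linarith [hall e he]⟩
    by_contra hA
    linarith [hb x0 hx0.1 e he hA, hall e he]
  have i : Fin d := ⟨0, hd⟩
  have a1 := hmem _ (mem_unitVecs.2 ⟨i, Or.inl rfl⟩)
  have a2 := hmem _ (mem_unitVecs.2 ⟨i, Or.inr rfl⟩)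
  rw [nsq_add_single] at a1 a2
  push_cast at a1 a2
  linarith

/-- comparison principle -/
lemma cmpP {d : ℕ} (hd : 0 < d) (A : Finset (V d)) (f g : V d → ℝ)
    (hL : ∀ x ∈ A, Lap g x ≤ Lap f x)
    (hb : ∀ x ∈ A, ∀ e ∈ unitVecs d, x + e ∉ A → f (x + e) ≤ g (x + e)) : ∀ x ∈ A, f x ≤ g x := by
  intro x hx
  have := maxP hd A (fun y => f y - g y) 0 (fun x hx => by rw [Lap_sub]; linarith [hL x hx])
    (fun x hx e he hA => by linarith [hb x hx e he hA]) x hx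
  linarith

/-- Solvability of the Dirichlet problem -/
lemma dirichlet {d : ℕ} (hd : 0 < d) (A : Finset (V d)) (f ψ : V d → ℝ) :
    ∃ h : V d → ℝ, (∀ x ∈ A, Lap h x = f x) ∧ ∀ x ∉ A, h x = ψ x := by
  classical
  let ext : (A → ℝ) → V d → ℝ := fun g x => if hx : x ∈ A then g ⟨x, hx⟩ else 0
  have ext_out : ∀ g x, x ∉ A → ext g x = 0 := fun g x hx => by simp [ext, hx]
  let T : (A → ℝ) →ₗ[ℝ] (A → ℝ) :=
    { toFun := fun g x => Lap (ext g) x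
      map_add' := by
        intro g g'
        ext x
        rw [Pi.add_apply, ← Lap_add]
        congr 1
        ext y; by_cases hy : y ∈ A <;> simp [ext, hy]
      map_smul' := by
        intro c g
        ext x
        simp only [Pi.smul_apply, smul_eq_mul, RingHom.id_apply]
        rw [← Lap_smul]
        congr 1
        ext y; by_cases hy : y ∈ A <;> simp [ext, hy] }
  have hinj : Function.Injective T := by
    rw [← LinearMap.ker_eq_bot, LinearMap.ker_eq_bot']
    intro g hg
    have hz : ∀ x ∈ A, Lap (ext g) x = 0 := fun x hx => congrFun hg ⟨x, hx⟩
    have h1 := maxP hd A (ext g) 0 (fun x hx => (hz x hx).ge)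
      (fun x _ e _ hA => (ext_out g _ hA).le)
    have h2 := maxP hd A (fun y => - ext g y) 0 (fun x hx => by rw [Lap_neg, hz x hx]; simp)
      (fun x _ e _ hA => by rw [ext_out g _ hA]; simp)
    ext ⟨x, hx⟩
    have a1 := h1 x hx
    have a2 := h2 x hx
    simp only [ext, hx, dif_pos] at a1 a2
    simp only [Pi.zero_apply]
    linarith
  have hsurj : Function.Surjective T := LinearMap.injective_iff_surjective.1 hinj
  let ψ0 : V d → ℝ := fun x => if x ∈ A then 0 else ψ x
  obtain ⟨g, hg⟩ := hsurj (fun x => f x - Lap ψ0 x)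
  refine ⟨fun y => ext g y + ψ0 y, fun x hx => ?_, fun x hx => ?_⟩
  · rw [Lap_add]
    have := congrFun hg ⟨x, hx⟩
    simp only [T, LinearMap.coe_mk, AddHom.coe_mk] at this
    rw [this]; ring
  · simp [ext_out g x hx, ψ0, hx]

/-- summation by parts -/
lemma byParts {d : ℕ} (A : Finset (V d)) (u k : V d → ℝ) (hu : ∀ x ∉ A, u x = 0)
    (hk : ∀ x ∉ A, k x = 0) : ∑ x ∈ A, u x * Lap k x = ∑ x ∈ A, k x * Lap u x := by
  have key : ∀ e : V d, ∑ x ∈ A, u x * k (x + e) = ∑ x ∈ A, k x * u (x + -e) := by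
    intro e
    have h1 : ∑ x ∈ A, u x * k (x + e) = ∑' x, u x * k (x + e) :=
      (tsum_eq_sum fun x hx => by rw [hu x hx]; simp).symm
    have h2 : ∑ x ∈ A, k x * u (x + -e) = ∑' x, k x * u (x + -e) :=
      (tsum_eq_sum fun x hx => by rw [hk x hx]; simp).symm
    rw [h1, h2, ← (Equiv.addRight e).tsum_eq (fun x => k x * u (x + -e))]
    refine tsum_congr fun x => ?_
    simp [mul_comm]
  have hneg : ∀ F : V d → ℝ, ∑ e ∈ unitVecs d, F (-e) = ∑ e ∈ unitVecs d, F e := by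
    intro F
    refine Finset.sum_nbij' (fun e => -e) (fun e => -e) ?_ ?_ ?_ ?_ ?_
    · intro e he; exact neg_mem_unitVecs he
    · intro e he; exact neg_mem_unitVecs he
    · intro e _; simp
    · intro e _; simp
    · intro e _; rfl
  have hL : ∀ u k : V d → ℝ, ∑ x ∈ A, u x * Lap k x
      = (∑ e ∈ unitVecs d, ∑ x ∈ A, u x * k (x + e)) / (2 * d) - ∑ x ∈ A, u x * k x := by
    intro u k
    rw [Finset.sum_comm, Finset.sum_div, ← Finset.sum_sub_distrib]
    refine Finset.sum_congr rfl fun x _ => ?_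
    unfold Lap
    rw [mul_sub, ← Finset.mul_sum]; ring
  rw [hL, hL, Finset.sum_congr rfl fun e _ => key e,
    hneg (fun e => ∑ x ∈ A, k x * u (x + e))]
  congr 1
  exact Finset.sum_congr rfl fun x _ => mul_comm _ _

section
open Classical

/-- solution of the Dirichlet problem -/
def dir {d : ℕ} (A : Finset (V d)) (f ψ : V d → ℝ) : V d → ℝ :=
  if h : ∃ h : V d → ℝ, (∀ x ∈ A, Lap h x = f x) ∧ ∀ x ∉ A, h x = ψ x then h.choose else 0

lemma dir_spec {d : ℕ} (hd : 0 < d) (A : Finset (V d)) (f ψ : V d → ℝ) :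
    (∀ x ∈ A, Lap (dir A f ψ) x = f x) ∧ ∀ x ∉ A, dir A f ψ x = ψ x := by
  unfold dir
  rw [dif_pos (dirichlet hd A f ψ)]
  exact (dirichlet hd A f ψ).choose_spec

lemma dir_unique {d : ℕ} (hd : 0 < d) (A : Finset (V d)) (f ψ h : V d → ℝ)
    (h1 : ∀ x ∈ A, Lap h x = f x) (h2 : ∀ x ∉ A, h x = ψ x) : h = dir A f ψ := by
  obtain ⟨a1, a2⟩ := dir_spec hd A f ψ
  ext x
  by_cases hx : x ∈ A
  · apply le_antisymm
    · refine cmpP hd A _ _ (fun y hy => by rw [h1 y hy, a1 y hy]) (fun y hy e he hA => ?_) x hx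
      rw [h2 _ hA, a2 _ hA]
    · refine cmpP hd A _ _ (fun y hy => by rw [h1 y hy, a1 y hy]) (fun y hy e he hA => ?_) x hx
      rw [h2 _ hA, a2 _ hA]
  · rw [h2 x hx, a2 x hx]

/-- harmonic extension into `A` -/
def harm {d : ℕ} (A : Finset (V d)) (h : V d → ℝ) : V d → ℝ := dir A (fun _ => 0) h

/-- expected exit value from a uniform starting point -/
def EA {d : ℕ} (A : Finset (V d)) (h : V d → ℝ) : ℝ := (∑ x ∈ A, harm A h x) / A.card

/-- normalized occupation measure -/
def vA {d : ℕ} (A : Finset (V d)) : V d → ℝ := dir A (fun _ => - 1 / (A.card : ℝ)) (fun _ => 0)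

lemma harm_in {d : ℕ} (hd : 0 < d) (A : Finset (V d)) (h : V d → ℝ) {x : V d} (hx : x ∈ A) :
    Lap (harm A h) x = 0 := (dir_spec hd A _ _).1 x hx
lemma harm_out {d : ℕ} (hd : 0 < d) (A : Finset (V d)) (h : V d → ℝ) {x : V d} (hx : x ∉ A) :
    harm A h x = h x := (dir_spec hd A _ _).2 x hx
lemma vA_in {d : ℕ} (hd : 0 < d) (A : Finset (V d)) {x : V d} (hx : x ∈ A) :
    Lap (vA A) x = - 1 / (A.card : ℝ) := (dir_spec hd A _ _).1 x hx
lemma vA_out {d : ℕ} (hd : 0 < d) (A : Finset (V d)) {x : V d} (hx : x ∉ A) :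
    vA A x = 0 := (dir_spec hd A _ _).2 x hx

lemma vA_nonneg {d : ℕ} (hd : 0 < d) (A : Finset (V d)) (x : V d) : 0 ≤ vA A x := by
  by_cases hx : x ∈ A
  · refine cmpP hd A (fun _ => 0) (vA A) (fun y hy => ?_) (fun y hy e he hA => ?_) x hx
    · rw [vA_in hd A hy, Lap_const hd, neg_div]
      simp
    · rw [vA_out hd A hA]
  · rw [vA_out hd A hx]

lemma harm_mono {d : ℕ} (hd : 0 < d) (A : Finset (V d)) (h h' : V d → ℝ)
    (hh : ∀ x ∉ A, h x ≤ h' x) (x : V d) : harm A h x ≤ harm A h' x := by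
  by_cases hx : x ∈ A
  · refine cmpP hd A _ _ (fun y hy => ?_) (fun y hy e he hA => ?_) x hx
    · rw [harm_in hd A _ hy, harm_in hd A _ hy]
    · rw [harm_out hd A _ hA, harm_out hd A _ hA]; exact hh _ hA
  · rw [harm_out hd A _ hx, harm_out hd A _ hx]; exact hh _ hx

lemma harm_add {d : ℕ} (hd : 0 < d) (A : Finset (V d)) (h h' : V d → ℝ) :
    harm A (fun x => h x + h' x) = fun x => harm A h x + harm A h' x := by
  symm
  apply dir_unique hd
  · intro x hx; rw [Lap_add, harm_in hd A _ hx, harm_in hd A _ hx]; simp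
  · intro x hx; rw [harm_out hd A _ hx, harm_out hd A _ hx]

lemma harm_smul {d : ℕ} (hd : 0 < d) (A : Finset (V d)) (c : ℝ) (h : V d → ℝ) :
    harm A (fun x => c * h x) = fun x => c * harm A h x := by
  symm
  apply dir_unique hd
  · intro x hx; rw [Lap_smul, harm_in hd A _ hx]; simp
  · intro x hx; rw [harm_out hd A _ hx]

lemma harm_const {d : ℕ} (hd : 0 < d) (A : Finset (V d)) (c : ℝ) :
    harm A (fun _ => c) = fun _ => c := by
  symm
  apply dir_unique hd
  · intro x hx; rw [Lap_const hd]
  · intro x hx; rfl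

lemma EA_mono {d : ℕ} (hd : 0 < d) (A : Finset (V d)) (h h' : V d → ℝ)
    (hh : ∀ x ∉ A, h x ≤ h' x) : EA A h ≤ EA A h' := by
  unfold EA
  gcongr with x
  exact harm_mono hd A h h' hh x

lemma EA_add {d : ℕ} (hd : 0 < d) (A : Finset (V d)) (h h' : V d → ℝ) :
    EA A (fun x => h x + h' x) = EA A h + EA A h' := by
  unfold EA
  rw [harm_add hd, Finset.sum_add_distrib, add_div]

lemma EA_smul {d : ℕ} (hd : 0 < d) (A : Finset (V d)) (c : ℝ) (h : V d → ℝ) :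
    EA A (fun x => c * h x) = c * EA A h := by
  unfold EA
  rw [harm_smul hd, ← Finset.mul_sum, mul_div_assoc]

lemma EA_const {d : ℕ} (hd : 0 < d) (A : Finset (V d)) (hA : A.Nonempty) (c : ℝ) :
    EA A (fun _ => c) = c := by
  unfold EA
  rw [harm_const hd]
  have : (A.card : ℝ) ≠ 0 := by
    have := hA.card_pos
    positivity
  simp; field_simp

lemma EA_nonneg {d : ℕ} (hd : 0 < d) (A : Finset (V d)) (h : V d → ℝ)
    (hh : ∀ x, 0 ≤ h x) : 0 ≤ EA A h := by
  have := EA_mono hd A (fun _ => 0) h (fun x _ => hh x)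
  unfold EA at this
  rw [harm_const hd] at this
  simpa [EA] using this

lemma EA_eq {d : ℕ} (hd : 0 < d) (A : Finset (V d)) (hA : A.Nonempty) (h : V d → ℝ) :
    EA A h = (∑ x ∈ A, h x) / A.card + ∑ x ∈ A, vA A x * Lap h x := by
  have hc : (A.card : ℝ) ≠ 0 := by
    have := hA.card_pos
    positivity
  have h1 := byParts A (vA A) (fun x => harm A h x - h x) (fun x hx => vA_out hd A hx)
    (fun x hx => by rw [harm_out hd A _ hx]; simp)
  have h2 : ∑ x ∈ A, vA A x * Lap (fun x => harm A h x - h x) x = - ∑ x ∈ A, vA A x * Lap h x := by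
    rw [← Finset.sum_neg_distrib]
    refine Finset.sum_congr rfl fun x hx => ?_
    rw [Lap_sub, harm_in hd A _ hx]; ring
  have h3 : ∑ x ∈ A, (harm A h x - h x) * Lap (vA A) x
      = (∑ x ∈ A, h x) / A.card - EA A h := by
    unfold EA
    rw [← sub_div, ← Finset.sum_sub_distrib, Finset.sum_div]
    refine Finset.sum_congr rfl fun x hx => ?_
    rw [vA_in hd A hx]; field_simp; ring
  rw [h2, h3] at h1
  linarith

end

end

end UI

namespace UI
noncomputable section

instance : IsProbabilityMeasure μ0 := ⟨by simp [μ0]⟩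

lemma μ0_eq : μ0 = volume.restrict (Set.Ico (0:ℝ) 1) := by
  unfold μ0
  exact (Measure.restrict_congr_set Ico_ae_eq_Icc).symm

lemma ae_Ico : ∀ᵐ ω ∂μ0, ω ∈ Set.Ico (0:ℝ) 1 := by
  rw [μ0_eq]
  exact ae_restrict_mem measurableSet_Ico

lemma μ0_split (S : Set ℝ) (hS : MeasurableSet S) :
    μ0 S = 2⁻¹ * μ0 {ω | ω / 2 ∈ S} + 2⁻¹ * μ0 {ω | (ω + 1) / 2 ∈ S} := by
  have m1 : MeasurableSet {ω : ℝ | ω / 2 ∈ S} := (measurable_id.div_const 2) hS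
  have m2 : MeasurableSet {ω : ℝ | (ω + 1) / 2 ∈ S} := ((measurable_id.add_const 1).div_const 2) hS
  rw [μ0_eq, Measure.restrict_apply hS, Measure.restrict_apply m1, Measure.restrict_apply m2]
  have h1 : ({ω : ℝ | ω / 2 ∈ S} ∩ Set.Ico 0 1) = (fun x => x * (2⁻¹ : ℝ)) ⁻¹' (S ∩ Set.Ico 0 (1/2)) := by
    ext x
    simp only [Set.mem_inter_iff, Set.mem_ofPred_eq, Set.mem_Ico, Set.mem_preimage, div_eq_mul_inv]
    refine and_congr_right fun _ => ?_
    constructor <;> rintro ⟨a, b⟩ <;> constructor <;> linarith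
  have h2 : ({ω : ℝ | (ω + 1) / 2 ∈ S} ∩ Set.Ico 0 1) =
      (fun x => x + 1) ⁻¹' ((fun x => x * (2⁻¹ : ℝ)) ⁻¹' (S ∩ Set.Ico (1/2) 1)) := by
    ext x
    simp only [Set.mem_inter_iff, Set.mem_ofPred_eq, Set.mem_Ico, Set.mem_preimage, div_eq_mul_inv]
    refine and_congr_right fun _ => ?_
    constructor <;> rintro ⟨a, b⟩ <;> constructor <;> linarith
  rw [h1, h2, measure_preimage_add_right, Real.volume_preimage_mul_right (by norm_num),
    Real.volume_preimage_mul_right (by norm_num), ← mul_assoc, ← mul_assoc]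
  have h3 : (2⁻¹ : ℝ≥0∞) * ENNReal.ofReal |(2⁻¹:ℝ)⁻¹| = 1 := by
    simp
    exact ENNReal.inv_mul_cancel (by simp) (by simp)
  rw [h3, one_mul, one_mul, ← measure_union]
  · rw [← Set.inter_union_distrib_left, Set.Ico_union_Ico_eq_Ico (by norm_num) (by norm_num)]
  · refine Set.disjoint_left.2 ?_
    rintro x ⟨_, _, h⟩ ⟨_, h', _⟩
    linarith
  · exact hS.inter measurableSet_Ico

lemma measurable_bit (k : ℕ) : Measurable (fun x => bit x k) := by
  unfold bit
  have : Measurable (fun x : ℝ => ⌊x * 2 ^ (k+1)⌋) := Int.measurable_floor.comp (by fun_prop)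
  exact (measurable_of_countable (fun z : ℤ => (z % 2 == 1))).comp this

lemma measurable_bits : Measurable (fun x => fun k => bit x k) :=
  measurable_pi_lambda _ measurable_bit

lemma bit_half_succ (ω : ℝ) (k : ℕ) : bit (ω / 2) (k+1) = bit ω k := by
  unfold bit
  congr 3
  rw [pow_succ _ (k+1)]; field_simp

lemma bit_half'_succ (ω : ℝ) (k : ℕ) : bit ((ω + 1) / 2) (k+1) = bit ω k := by
  unfold bit
  have : (ω + 1) / 2 * 2 ^ (k + 1 + 1) = ω * 2 ^ (k+1) + ((2 ^ (k + 1) : ℤ) : ℝ) := by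
    push_cast
    rw [pow_succ _ (k+1)]; field_simp
  rw [this, Int.floor_add_intCast, pow_succ (2:ℤ), Int.add_mul_emod_self_right]

lemma bit_half_zero (ω : ℝ) (h : ω ∈ Set.Ico (0:ℝ) 1) : bit (ω / 2) 0 = false := by
  unfold bit
  have : ⌊ω / 2 * 2 ^ (0+1)⌋ = 0 := by
    rw [Int.floor_eq_zero_iff]; norm_num; exact h
  rw [this]; rfl

lemma bit_half'_zero (ω : ℝ) (h : ω ∈ Set.Ico (0:ℝ) 1) : bit ((ω + 1) / 2) 0 = true := by
  unfold bit
  have : ⌊(ω + 1) / 2 * 2 ^ (0+1)⌋ = 1 := by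
    have : (ω + 1) / 2 * 2 ^ (0+1) = ω + 1 := by ring
    rw [this, Int.floor_add_one, Int.floor_eq_zero_iff.2 h]; rfl
  rw [this]; rfl

/-- law of the first bit -/
def coin : Measure Bool := μ0.map (fun ω => bit ω 0)

instance : IsProbabilityMeasure coin :=
  Measure.isProbabilityMeasure_map (measurable_bit 0).aemeasurable

open Classical in
lemma split_bits (t : ℕ → Set Bool) (N : ℕ) :
    μ0 {ω | ∀ i < N + 1, bit ω i ∈ t i} = ((2⁻¹ * if false ∈ t 0 then 1 else 0) +
      (2⁻¹ * if true ∈ t 0 then 1 else 0)) * μ0 {ω | ∀ i < N, bit ω i ∈ t (i+1)} := by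
  rw [μ0_split]
  · have h1 : μ0 {ω | ω / 2 ∈ {ω | ∀ i < N + 1, bit ω i ∈ t i}}
        = (if false ∈ t 0 then 1 else 0) * μ0 {ω | ∀ i < N, bit ω i ∈ t (i+1)} := by
      have : μ0 {ω | ω / 2 ∈ {ω | ∀ i < N + 1, bit ω i ∈ t i}} =
          μ0 {ω | false ∈ t 0 ∧ ∀ i < N, bit ω i ∈ t (i+1)} := by
        apply measure_congr
        filter_upwards [ae_Ico] with ω hω
        apply propext
        change (∀ i < N + 1, bit (ω/2) i ∈ t i) ↔ (false ∈ t 0 ∧ ∀ i < N, bit ω i ∈ t (i+1))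
        rw [← bit_half_zero ω hω]
        constructor
        · intro h
          exact ⟨h 0 (by omega), fun i hi => bit_half_succ ω i ▸ h (i+1) (by omega)⟩
        · rintro ⟨h, h'⟩ i hi
          cases i with
          | zero => exact h
          | succ i => rw [bit_half_succ]; exact h' i (by omega)
      rw [this]
      by_cases hf : false ∈ t 0 <;> simp [hf]
    have h2 : μ0 {ω | (ω + 1) / 2 ∈ {ω | ∀ i < N + 1, bit ω i ∈ t i}}
        = (if true ∈ t 0 then 1 else 0) * μ0 {ω | ∀ i < N, bit ω i ∈ t (i+1)} := by
      have : μ0 {ω | (ω + 1) / 2 ∈ {ω | ∀ i < N + 1, bit ω i ∈ t i}} =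
          μ0 {ω | true ∈ t 0 ∧ ∀ i < N, bit ω i ∈ t (i+1)} := by
        apply measure_congr
        filter_upwards [ae_Ico] with ω hω
        apply propext
        change (∀ i < N + 1, bit ((ω+1)/2) i ∈ t i) ↔ (true ∈ t 0 ∧ ∀ i < N, bit ω i ∈ t (i+1))
        rw [← bit_half'_zero ω hω]
        constructor
        · intro h
          exact ⟨h 0 (by omega), fun i hi => bit_half'_succ ω i ▸ h (i+1) (by omega)⟩
        · rintro ⟨h, h'⟩ i hi
          cases i with
          | zero => exact h
          | succ i => rw [bit_half'_succ]; exact h' i (by omega)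
      rw [this]
      by_cases hf : true ∈ t 0 <;> simp [hf]
    rw [h1, h2]; ring
  · have : {ω : ℝ | ∀ i < N + 1, bit ω i ∈ t i} = ⋂ i ∈ Finset.range (N+1), (fun x => bit x i) ⁻¹' (t i) := by
      ext; simp
    rw [this]
    exact Finset.measurableSet_biInter _ fun i _ => measurable_bit i (MeasurableSet.of_discrete)

lemma cyl_bits (N : ℕ) : ∀ t : ℕ → Set Bool,
    μ0 {ω | ∀ i < N, bit ω i ∈ t i} = ∏ i ∈ Finset.range N, coin (t i) := by
  induction N with
  | zero => intro t; simp
  | succ N ih =>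
    intro t
    rw [split_bits, ih, Finset.prod_range_succ', mul_comm]
    congr 1
    have := split_bits t 0
    simp only [zero_add, Nat.not_lt_zero, false_imp_iff, implies_true, Set.ofPred_true, measure_univ,
      mul_one, Nat.lt_one_iff, forall_eq] at this ⊢
    rw [coin, Measure.map_apply (measurable_bit 0) MeasurableSet.of_discrete]
    exact this.symm

lemma map_bits : μ0.map (fun x k => bit x k) = Measure.infinitePi (fun _ : ℕ => coin) := by
  classical
  apply Measure.eq_infinitePi
  intro s t ht
  obtain ⟨N, hN⟩ : ∃ N, s ⊆ Finset.range N := s.exists_nat_subset_range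
  rw [Measure.map_apply measurable_bits (MeasurableSet.pi s.countable_toSet fun i _ => ht i)]
  have h := cyl_bits N (fun i => if i ∈ s then t i else Set.univ)
  have h1 : {ω : ℝ | ∀ i < N, bit ω i ∈ (if i ∈ s then t i else Set.univ)} =
      (fun x k => bit x k) ⁻¹' (Set.pi s t) := by
    ext ω
    simp only [Set.mem_ofPred_eq, Set.mem_preimage, Set.mem_pi, Finset.mem_coe]
    constructor
    · intro h i hi
      have := h i (Finset.mem_range.1 (hN hi))
      simpa [hi] using this
    · intro h i _
      by_cases hi : i ∈ s
      · simpa [hi] using h i hi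
      · simp [hi]
  rw [h1] at h
  rw [h, ← Finset.prod_subset hN]
  · exact Finset.prod_congr rfl fun i hi => by simp [hi]
  · intro i _ hi; rw [if_neg hi]; exact measure_univ

/-- binary expansion -/
def rb (b : ℕ → Bool) : ℝ := ∑' j : ℕ, if b j then ((2 : ℝ) ^ (-(j : ℤ) - 1)) else 0

lemma measurable_rb : Measurable rb := by
  unfold rb
  refine Measurable.tsum fun j => ?_
  exact (measurable_of_countable (fun b : Bool => if b then ((2 : ℝ) ^ (-(j : ℤ) - 1)) else 0)).comp
    (measurable_pi_apply j)

lemma rb_bits (ω : ℝ) (h : ω ∈ Set.Ico (0:ℝ) 1) : rb (fun k => bit ω k) = ω := by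
  have hps : ∀ N, ∑ j ∈ Finset.range N, (if bit ω j then ((2 : ℝ) ^ (-(j : ℤ) - 1)) else 0)
      = (⌊ω * 2 ^ N⌋ : ℝ) / 2 ^ N := by
    intro N
    induction N with
    | zero => simp; rw [Int.floor_eq_zero_iff.2 h]; simp
    | succ N ih =>
      rw [Finset.sum_range_succ, ih]
      have h2 : (2:ℝ) ^ (-(N:ℤ) - 1) = 1 / 2 ^ (N+1) := by
        rw [← neg_add', zpow_neg, one_div]
        congr 1
      have h3 : ⌊ω * 2 ^ N⌋ = ⌊ω * 2 ^ (N+1)⌋ / 2 := by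
        have := Int.floor_div_natCast (ω * 2 ^ (N+1)) 2
        push_cast at this
        rw [← this]
        congr 1; rw [pow_succ]; ring
      have h4 := Int.emod_add_mul_ediv ⌊ω * 2 ^ (N+1)⌋ 2
      have h5 := Int.emod_two_eq_zero_or_one ⌊ω * 2 ^ (N+1)⌋
      rw [h2]
      unfold bit
      rw [h3]
      rcases h5 with h5 | h5
      · rw [h5] at h4 ⊢
        have h6 : (⌊ω * 2 ^ (N+1)⌋ : ℝ) = 2 * ((⌊ω * 2 ^ (N+1)⌋ / 2 : ℤ) : ℝ) := by
          exact_mod_cast (by omega : ⌊ω * 2 ^ (N+1)⌋ = 2 * (⌊ω * 2 ^ (N+1)⌋ / 2))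
        simp
        rw [h6, pow_succ]; field_simp
      · rw [h5] at h4 ⊢
        have h6 : (⌊ω * 2 ^ (N+1)⌋ : ℝ) = 1 + 2 * ((⌊ω * 2 ^ (N+1)⌋ / 2 : ℤ) : ℝ) := by
          exact_mod_cast (by omega : ⌊ω * 2 ^ (N+1)⌋ = 1 + 2 * (⌊ω * 2 ^ (N+1)⌋ / 2))
        simp only [beq_self_eq_true, if_true]
        generalize ((⌊ω * 2 ^ (N+1)⌋ / 2 : ℤ) : ℝ) = z at *
        rw [h6, pow_succ]; field_simp
        ring
  have hs : HasSum (fun j : ℕ => if bit ω j then ((2 : ℝ) ^ (-(j : ℤ) - 1)) else 0) ω := by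
    rw [hasSum_iff_tendsto_nat_of_nonneg]
    · simp_rw [hps]
      have h0 : Tendsto (fun N : ℕ => ω - (1/2 : ℝ) ^ N) atTop (nhds ω) := by
        have := (tendsto_pow_atTop_nhds_zero_of_lt_one (r := (1/2:ℝ)) (by norm_num) (by norm_num)).const_sub ω
        simpa using this
      refine tendsto_of_tendsto_of_tendsto_of_le_of_le h0 tendsto_const_nhds ?_ ?_
      · intro N
        simp only
        have := Int.lt_floor_add_one (ω * 2 ^ N)
        rw [le_div_iff₀ (by positivity), sub_mul, ← mul_pow]
        norm_num
        linarith
      · intro N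
        simp only
        rw [div_le_iff₀ (by positivity)]
        exact Int.floor_le _
    · intro j; split_ifs <;> positivity
  exact hs.tsum_eq

lemma coin_map_rb : (Measure.infinitePi (fun _ : ℕ => coin)).map rb = μ0 := by
  rw [← map_bits, Measure.map_map measurable_rb measurable_bits]
  have : (rb ∘ fun x k => bit x k) =ᵐ[μ0] id := by
    filter_upwards [ae_Ico] with ω hω
    exact rb_bits ω hω
  rw [Measure.map_congr this, Measure.map_id]

/-- the law of an iid sequence of uniforms -/
def P : Measure (ℕ → ℝ) := Measure.infinitePi (fun _ : ℕ => μ0)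

instance : IsProbabilityMeasure P := by unfold P; infer_instance

lemma measurable_slices : Measurable (fun ω : ℝ => fun i => uSlice ω i) := by
  refine measurable_pi_lambda _ fun i => ?_
  have : (fun ω => uSlice ω i) = fun ω => rb (fun j => bit ω (Nat.pair i j)) := rfl
  rw [this]
  exact measurable_rb.comp (measurable_pi_lambda _ fun j => measurable_bit _)

lemma map_slices : μ0.map (fun ω i => uSlice ω i) = P := by
  have h1 : (fun (ω:ℝ) (i:ℕ) => uSlice ω i) = (fun (b : ℕ → ℕ → Bool) i => rb (b i)) ∘
      (MeasurableEquiv.curry ℕ ℕ Bool) ∘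
      (MeasurableEquiv.piCongrLeft (fun _ : ℕ × ℕ => Bool) Nat.pairEquiv.symm) ∘
      (fun x k => bit x k) := by
    ext ω i
    simp only [Function.comp]
    unfold uSlice rb
    refine tsum_congr fun j => ?_
    have : (MeasurableEquiv.curry ℕ ℕ Bool) ((MeasurableEquiv.piCongrLeft (fun _ : ℕ × ℕ => Bool) Nat.pairEquiv.symm)
      (fun k => bit ω k)) i j = bit ω (Nat.pair i j) := by
      rw [MeasurableEquiv.coe_curry]
      simp only [Function.curry, MeasurableEquiv.coe_piCongrLeft]
      have h2 : (i, j) = Nat.pairEquiv.symm (Nat.pair i j) := (Nat.unpair_pair i j).symm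
      rw [h2, Equiv.piCongrLeft_apply_apply]
    rw [this]
  have mr : Measurable (fun (b : ℕ → ℕ → Bool) i => rb (b i)) :=
    measurable_pi_lambda _ fun i => measurable_rb.comp (measurable_pi_apply i)
  have m1 := (MeasurableEquiv.curry ℕ ℕ Bool).measurable
  have m2 := (MeasurableEquiv.piCongrLeft (fun _ : ℕ × ℕ => Bool) Nat.pairEquiv.symm).measurable
  rw [h1, ← Measure.map_map mr (m1.comp (m2.comp measurable_bits)),
    ← Measure.map_map m1 (m2.comp measurable_bits), ← Measure.map_map m2 measurable_bits, map_bits]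
  have e1 := Measure.infinitePi_map_piCongrLeft (X := fun _ : ℕ × ℕ => Bool) (fun _ => coin) Nat.pairEquiv.symm
  have e2 := Measure.infinitePi_map_curry (ι := ℕ) (κ := ℕ) (X := Bool) (fun _ _ => coin)
  rw [e1, e2]
  rw [Measure.infinitePi_map_pi (fun _ : ℕ => Measure.infinitePi fun _ : ℕ => coin) (fun _ => measurable_rb)]
  unfold P
  congr 1
  ext i : 1
  exact coin_map_rb

/-- prepend -/
def cons (u : ℝ) (s : ℕ → ℝ) : ℕ → ℝ
  | 0 => u
  | k + 1 => s k

lemma measurable_cons : Measurable (fun p : ℝ × (ℕ → ℝ) => cons p.1 p.2) := by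
  refine measurable_pi_lambda _ fun i => ?_
  cases i with
  | zero => exact measurable_fst
  | succ k => exact (measurable_pi_apply k).comp measurable_snd

lemma map_cons : (μ0.prod P).map (fun p => cons p.1 p.2) = P := by
  unfold P
  apply Measure.eq_infinitePi
  intro s t ht
  classical
  obtain ⟨N, hN⟩ : ∃ N, s ⊆ Finset.range (N+1) := by
    obtain ⟨N, hN⟩ := s.exists_nat_subset_range
    exact ⟨N, hN.trans (Finset.range_mono (by omega))⟩
  rw [Measure.map_apply measurable_cons (MeasurableSet.pi s.countable_toSet fun i _ => ht i)]
  let t' : ℕ → Set ℝ := fun i => if i ∈ s then t i else Set.univ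
  have ht' : ∀ i, MeasurableSet (t' i) := fun i => by
    by_cases hi : i ∈ s <;> simp [t', hi, ht]
  have h1 : (fun p : ℝ × (ℕ → ℝ) => cons p.1 p.2) ⁻¹' (Set.pi s t)
      = (t' 0) ×ˢ (Set.pi (Finset.range N) (fun i => t' (i+1))) := by
    ext ⟨u, v⟩
    simp only [Set.mem_preimage, Set.mem_pi, Set.mem_prod, Finset.mem_coe]
    constructor
    · intro h
      refine ⟨?_, fun i hi => ?_⟩
      · by_cases h0 : 0 ∈ s
        · simpa [t', h0, cons] using h 0 h0
        · simp [t', h0, cons]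
      · by_cases h0 : i+1 ∈ s
        · simpa [t', h0, cons] using h (i+1) h0
        · simp [t', h0, cons]
    · rintro ⟨h, h'⟩ i hi
      cases i with
      | zero => simpa [t', hi, cons] using h
      | succ i =>
        have h2 := hN hi
        have := h' i (by simp at h2 ⊢; omega)
        simpa [t', hi, cons] using this
  rw [h1, Measure.prod_prod, Measure.infinitePi_pi _ (fun i _ => ht' _)]
  have : ∏ i ∈ s, μ0 (t i) = ∏ i ∈ Finset.range (N+1), μ0 (t' i) := by
    rw [← Finset.prod_subset hN]
    · exact Finset.prod_congr rfl fun i hi => by simp [t', hi]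
    · intro i _ hi; simp [t', hi]
  rw [this, Finset.prod_range_succ', mul_comm]

lemma lintegral_cons (F : (ℕ → ℝ) → ℝ≥0∞) (hF : Measurable F) :
    ∫⁻ s, F s ∂P = ∫⁻ u, ∫⁻ s, F (cons u s) ∂P ∂μ0 := by
  conv_lhs => rw [← map_cons]
  rw [lintegral_map hF measurable_cons]
  exact lintegral_prod (fun p : ℝ × (ℕ → ℝ) => F (cons p.1 p.2)) (hF.comp measurable_cons).aemeasurable

end

end UI

namespace UI
noncomputable section

instance finsetDiscrete (d : ℕ) : DiscreteMeasurableSpace (Finset (V d)) := ⟨fun _ => trivial⟩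

lemma pick_mem {d : ℕ} (S : Finset (V d)) (hS : S.Nonempty) (u : ℝ) : pick S u ∈ S := by
  unfold pick
  rw [dif_pos hS]
  exact Finset.coe_mem _

lemma measurable_pick {d : ℕ} (S : Finset (V d)) : Measurable (pick S) := by
  by_cases h : S.Nonempty
  · have : pick S = (fun z : ℤ => (S.equivFin.symm ⟨z.toNat % S.card,
      Nat.mod_lt _ (Finset.card_pos.mpr h)⟩).val) ∘ (fun u : ℝ => ⌊u * S.card⌋) := by
      ext u : 1
      simp [pick, h]
    rw [this]
    exact (measurable_of_countable _).comp (Int.measurable_floor.comp (by fun_prop))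
  · have : pick S = fun _ => 0 := by ext u : 1; simp [pick, h]
    rw [this]; exact measurable_const

lemma pick_prob {d : ℕ} (S : Finset (V d)) (x : V d) (hx : x ∈ S) :
    μ0 {u | pick S u = x} = (S.card : ℝ≥0∞)⁻¹ := by
  have hS : S.Nonempty := ⟨x, hx⟩
  have hc : 0 < S.card := hS.card_pos
  have hc' : (0:ℝ) < S.card := by exact_mod_cast hc
  have hm : MeasurableSet {u | pick S u = x} := measurable_pick S (measurableSet_singleton x)
  rw [μ0_eq, Measure.restrict_apply hm]
  set i : Fin S.card := S.equivFin ⟨x, hx⟩ with hi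
  have : {u | pick S u = x} ∩ Set.Ico 0 1 = Set.Ico ((i:ℝ) / S.card) (((i:ℝ) + 1) / S.card) := by
    ext u
    simp only [Set.mem_inter_iff, Set.mem_ofPred_eq, Set.mem_Ico]
    rw [div_le_iff₀ hc', lt_div_iff₀ hc']
    have hiff : ∀ (h0 : 0 ≤ u) (h1 : u < 1), (pick S u = x ↔ ⌊u * S.card⌋ = (i : ℤ)) := by
      intro h0 h1
      have hf0 : 0 ≤ ⌊u * S.card⌋ := Int.floor_nonneg.2 (by positivity)
      have hf1 : ⌊u * S.card⌋ < S.card := by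
        rw [Int.floor_lt]; push_cast; nlinarith
      unfold pick
      rw [dif_pos hS]
      have e1 : ∀ j : Fin S.card, ((S.equivFin.symm j).val = x ↔ j = i) := by
        intro j
        rw [hi, ← Equiv.symm_apply_eq, Subtype.ext_iff]
      rw [e1, Fin.ext_iff]
      simp only
      rw [Nat.mod_eq_of_lt (by omega)]
      omega
    constructor
    · rintro ⟨h, h0, h1⟩
      rw [hiff h0 h1, Int.floor_eq_iff] at h
      exact_mod_cast h
    · rintro ⟨h, h'⟩
      have h0 : 0 ≤ u := by
        by_contra hu
        push Not at hu
        have := mul_neg_of_neg_of_pos hu hc'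
        have : (0:ℝ) ≤ i := by positivity
        linarith
      have h1 : u < 1 := by
        have : ((i:ℕ):ℝ) + 1 ≤ S.card := by exact_mod_cast i.2
        by_contra hu
        push Not at hu
        nlinarith
      refine ⟨?_, h0, h1⟩
      rw [hiff h0 h1, Int.floor_eq_iff]
      constructor
      · exact_mod_cast h
      · exact_mod_cast h'
  rw [this, Real.volume_Ico, ← sub_div, add_sub_cancel_left, one_div,
    ENNReal.ofReal_inv_of_pos hc', ENNReal.ofReal_natCast]

lemma lintegral_pick {d : ℕ} (S : Finset (V d)) (hS : S.Nonempty) (F : V d → ℝ≥0∞) :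
    ∫⁻ u, F (pick S u) ∂μ0 = (S.card : ℝ≥0∞)⁻¹ * ∑ x ∈ S, F x := by
  classical
  have h1 : ∀ u, F (pick S u) = ∑ x ∈ S, F x * (Set.indicator {u | pick S u = x} 1 u) := by
    intro u
    rw [Finset.sum_eq_single (pick S u)]
    · simp
    · intro b _ hb
      simp [Set.indicator, hb.symm]
    · intro h; exact absurd (pick_mem S hS u) h
  have hm : ∀ x, MeasurableSet {u | pick S u = x} := fun x => measurable_pick S (measurableSet_singleton x)
  simp_rw [h1]
  rw [lintegral_finsetSum]
  · rw [Finset.mul_sum]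
    refine Finset.sum_congr rfl fun x hx => ?_
    rw [lintegral_const_mul _ (measurable_one.indicator (hm x)), lintegral_indicator_one (hm x),
      pick_prob S x hx, mul_comm]
  · intro x _
    exact (measurable_one.indicator (hm x)).const_mul _

/-- walk driven by a sequence -/
def walkS {d : ℕ} (x : V d) (s : ℕ → ℝ) (t : ℕ) : V d :=
  x + ∑ i ∈ Finset.range t, pick (unitVecs d) (s i)

/-- exit time -/
def exitS {d : ℕ} (A : Finset (V d)) (x : V d) (s : ℕ → ℝ) : ℕ := sInf {t | walkS x s t ∉ A}

/-- exit point -/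
def hitS {d : ℕ} (A : Finset (V d)) (x : V d) (s : ℕ → ℝ) : V d := walkS x s (exitS A x s)

lemma hitPt_eq {d : ℕ} (A : Finset (V d)) (x : V d) (ω : ℝ) :
    hitPt A x ω = hitS A x (fun i => uSlice ω i) := rfl

lemma walkS_cons {d : ℕ} (x : V d) (u : ℝ) (s : ℕ → ℝ) (t : ℕ) :
    walkS x (cons u s) (t+1) = walkS (x + pick (unitVecs d) u) s t := by
  unfold walkS
  rw [Finset.sum_range_succ', add_comm (∑ _ ∈ _, _), ← add_assoc]
  rfl

lemma walkS_zero {d : ℕ} (x : V d) (s : ℕ → ℝ) : walkS x s 0 = x := by simp [walkS]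

lemma measurable_walkS {d : ℕ} (x : V d) (t : ℕ) : Measurable (fun s => walkS x s t) := by
  unfold walkS
  refine Measurable.const_add ?_ x
  exact Finset.measurable_sum _ fun i _ => (measurable_pick _).comp (measurable_pi_apply i)

/-- the truncated functional -/
def qT {d : ℕ} (A : Finset (V d)) (h : V d → ℝ) : ℕ → V d → (ℕ → ℝ) → ℝ≥0∞
  | 0, x, _ => if x ∈ A then 0 else ENNReal.ofReal (h x)
  | T + 1, x, s => if x ∈ A then qT A h T (walkS x s 1) (fun i => s (i+1)) else ENNReal.ofReal (h x)

lemma measurable_qT {d : ℕ} (A : Finset (V d)) (h : V d → ℝ) (T : ℕ) :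
    ∀ x, Measurable (qT A h T x) := by
  induction T with
  | zero =>
    intro x
    have : qT A h 0 x = fun _ => if x ∈ A then 0 else ENNReal.ofReal (h x) := rfl
    rw [this]; exact measurable_const
  | succ T ih =>
    intro x
    have e : qT A h (T+1) x = fun s => if x ∈ A then qT A h T (walkS x s 1) (fun i => s (i+1)) else ENNReal.ofReal (h x) := rfl
    rw [e]
    by_cases hx : x ∈ A
    · simp only [hx, if_true]
      have h1 : Measurable (fun p : V d × (ℕ → ℝ) => qT A h T p.1 p.2) :=
        measurable_from_prod_countable_right ih
      exact h1.comp ((measurable_walkS x 1).prodMk (measurable_pi_lambda _ fun i => measurable_pi_apply _))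
    · simp only [hx, if_false]; exact measurable_const

lemma unitVecs_nonempty {d : ℕ} (hd : 0 < d) : (unitVecs d).Nonempty := by
  rw [← Finset.card_pos, card_unitVecs]; omega

lemma harm_nonneg {d : ℕ} (hd : 0 < d) (A : Finset (V d)) (h : V d → ℝ) (hh : ∀ x, 0 ≤ h x) (x : V d) :
    0 ≤ harm A h x := by
  have := harm_mono hd A (fun _ => 0) h (fun x _ => hh x) x
  rwa [harm_const hd] at this

lemma avg_ofReal {d : ℕ} (hd : 0 < d) (f : V d → ℝ) (hf : ∀ x, 0 ≤ f x) (x : V d) :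
    ((unitVecs d).card : ℝ≥0∞)⁻¹ * ∑ e ∈ unitVecs d, ENNReal.ofReal (f (x + e))
      = ENNReal.ofReal (Lap f x + f x) := by
  rw [← ENNReal.ofReal_sum_of_nonneg (fun e _ => hf _), ← ENNReal.ofReal_natCast,
    ← ENNReal.ofReal_inv_of_pos (by rw [card_unitVecs]; positivity), ← ENNReal.ofReal_mul (by positivity)]
  congr 1
  unfold Lap
  rw [card_unitVecs]; push_cast; ring

lemma qT_le {d : ℕ} (hd : 0 < d) (A : Finset (V d)) (h : V d → ℝ) (hh : ∀ x, 0 ≤ h x) (T : ℕ) :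
    ∀ x, ∫⁻ s, qT A h T x s ∂P ≤ ENNReal.ofReal (harm A h x) := by
  induction T with
  | zero =>
    intro x
    unfold qT
    by_cases hx : x ∈ A
    · simp [hx]
    · simp [hx, harm_out hd A h hx]
  | succ T ih =>
    intro x
    by_cases hx : x ∈ A
    · rw [lintegral_cons _ (measurable_qT A h _ x)]
      have h1 : ∀ u s, qT A h (T+1) x (cons u s) = qT A h T (x + pick (unitVecs d) u) s := by
        intro u s
        conv_lhs => unfold qT
        rw [if_pos hx, walkS_cons, walkS_zero]
        rfl
      simp_rw [h1]
      calc ∫⁻ u, ∫⁻ s, qT A h T (x + pick (unitVecs d) u) s ∂P ∂μ0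
          ≤ ∫⁻ u, ENNReal.ofReal (harm A h (x + pick (unitVecs d) u)) ∂μ0 :=
            lintegral_mono fun u => ih _
        _ = _ := by
            rw [lintegral_pick _ (unitVecs_nonempty hd) (fun e => ENNReal.ofReal (harm A h (x + e))),
              avg_ofReal hd _ (harm_nonneg hd A h hh), harm_in hd A h hx, zero_add]
    · have h1 : ∀ s, qT A h (T+1) x s = ENNReal.ofReal (h x) := by
        intro s; unfold qT; rw [if_neg hx]
      simp [h1, harm_out hd A h hx]

lemma walkS_shift {d : ℕ} (x : V d) (s : ℕ → ℝ) (t : ℕ) :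
    walkS x s (t+1) = walkS (walkS x s 1) (fun i => s (i+1)) t := by
  have : s = cons (s 0) (fun i => s (i+1)) := by
    ext i; cases i <;> rfl
  conv_lhs => rw [this]
  rw [walkS_cons]
  congr 1
  simp [walkS]

lemma exists_qT {d : ℕ} (A : Finset (V d)) (h : V d → ℝ) (t : ℕ) : ∀ (x : V d) (s : ℕ → ℝ),
    walkS x s t ∉ A → (∀ j < t, walkS x s j ∈ A) → ∀ T, t ≤ T → qT A h T x s = ENNReal.ofReal (h (walkS x s t)) := by
  induction t with
  | zero =>
    intro x s h1 _ T _
    rw [walkS_zero] at h1 ⊢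
    cases T <;> simp [qT, h1]
  | succ t ih =>
    intro x s h1 h2 T hT
    obtain ⟨T, rfl⟩ : ∃ T', T = T' + 1 := ⟨T - 1, by omega⟩
    have hx : x ∈ A := by have := h2 0 (by omega); rwa [walkS_zero] at this
    unfold qT
    rw [if_pos hx, walkS_shift x s t]
    refine ih _ _ ?_ ?_ T (by omega)
    · rwa [← walkS_shift]
    · intro j hj
      rw [← walkS_shift]; exact h2 _ (by omega)

/-- probability of never exiting is zero -/
lemma never_exit {d : ℕ} (hd : 0 < d) (A : Finset (V d)) (x : V d) :
    P {s | ∀ t, walkS x s t ∈ A} = 0 := by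
  have hm : ∀ x : V d, MeasurableSet {s : ℕ → ℝ | ∀ t, walkS x s t ∈ A} := by
    intro x
    have : {s : ℕ → ℝ | ∀ t, walkS x s t ∈ A} = ⋂ t, (fun s => walkS x s t) ⁻¹' A := by
      ext s; simp
    rw [this]
    exact MeasurableSet.iInter fun t => measurable_walkS x t A.measurableSet
  let f : V d → ℝ := fun x => (P {s | ∀ t, walkS x s t ∈ A}).toReal
  have hf : ∀ x, ENNReal.ofReal (f x) = P {s | ∀ t, walkS x s t ∈ A} := fun x =>
    ENNReal.ofReal_toReal (measure_ne_top _ _)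
  have hout : ∀ x ∉ A, f x = 0 := by
    intro x hx
    have : {s : ℕ → ℝ | ∀ t, walkS x s t ∈ A} = ∅ := by
      ext s
      simp only [Set.mem_ofPred_eq, Set.mem_empty_iff_false, iff_false]
      intro h
      exact hx (by simpa [walkS_zero] using h 0)
    simp [f, this]
  have hin : ∀ x ∈ A, Lap f x = 0 := by
    intro x hx
    have h1 := avg_ofReal hd f (fun _ => ENNReal.toReal_nonneg) x
    have h2 : ENNReal.ofReal (f x) = ∫⁻ s, Set.indicator {s | ∀ t, walkS x s t ∈ A} 1 s ∂P := by
      rw [hf, lintegral_indicator_one (hm x)]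
    have h3 : ∀ u s, Set.indicator {s | ∀ t, walkS x s t ∈ A} (1 : (ℕ → ℝ) → ℝ≥0∞) (cons u s) =
        Set.indicator {s | ∀ t, walkS (x + pick (unitVecs d) u) s t ∈ A} 1 s := by
      intro u s
      unfold Set.indicator
      congr 1
      simp only [Set.mem_ofPred_eq, eq_iff_iff]
      constructor
      · intro h t; have := h (t+1); rwa [walkS_cons] at this
      · intro h t
        cases t with
        | zero => rwa [walkS_zero]
        | succ t => rw [walkS_cons]; exact h t
    rw [lintegral_cons _ (measurable_one.indicator (hm x))] at h2
    simp_rw [h3] at h2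
    simp_rw [lintegral_indicator_one (hm _), ← hf] at h2
    rw [lintegral_pick _ (unitVecs_nonempty hd) (fun e => ENNReal.ofReal (f (x + e))), h1] at h2
    have h4 : 0 ≤ Lap f x + f x := by
      unfold Lap
      have : 0 ≤ ∑ e ∈ unitVecs d, f (x + e) := Finset.sum_nonneg fun _ _ => ENNReal.toReal_nonneg
      have : 0 ≤ (∑ e ∈ unitVecs d, f (x + e)) / (2 * d) := by positivity
      linarith
    rw [ENNReal.ofReal_eq_ofReal_iff ENNReal.toReal_nonneg h4] at h2
    linarith
  by_cases hx : x ∈ A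
  · have := maxP hd A f 0 (fun x hx => (hin x hx).ge) (fun x _ e _ hA => (hout _ hA).le) x hx
    rw [← hf, ENNReal.ofReal_eq_zero]; exact this
  · rw [← hf, hout x hx]; simp

lemma exit_spec {d : ℕ} (A : Finset (V d)) (x : V d) (s : ℕ → ℝ) (h : ¬ ∀ t, walkS x s t ∈ A) :
    walkS x s (exitS A x s) ∉ A ∧ ∀ j < exitS A x s, walkS x s j ∈ A := by
  push Not at h
  have hne : {t | walkS x s t ∉ A}.Nonempty := h
  refine ⟨Nat.sInf_mem hne, fun j hj => ?_⟩
  by_contra hcon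
  exact absurd (Nat.sInf_le (s := {t | walkS x s t ∉ A}) hcon) (not_le.2 hj)

lemma lintegral_hitS {d : ℕ} (hd : 0 < d) (A : Finset (V d)) (h : V d → ℝ) (hh : ∀ x, 0 ≤ h x) (x : V d) :
    ∫⁻ s, ENNReal.ofReal (h (hitS A x s)) ∂P ≤ ENNReal.ofReal (harm A h x) := by
  have h1 : ∀ᵐ s ∂P, ENNReal.ofReal (h (hitS A x s)) ≤ liminf (fun T => qT A h T x s) atTop := by
    have h0 : ∀ᵐ s ∂P, ¬ ∀ t, walkS x s t ∈ A := by
      rw [ae_iff]; simpa using never_exit hd A x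
    filter_upwards [h0] with s hs
    obtain ⟨a1, a2⟩ := exit_spec A x s hs
    refine le_liminf_of_le (by isBoundedDefault) ?_
    filter_upwards [eventually_ge_atTop (exitS A x s)] with T hT
    rw [exists_qT A h _ x s a1 a2 T hT]
    rfl
  calc _ ≤ ∫⁻ s, liminf (fun T => qT A h T x s) atTop ∂P := lintegral_mono_ae h1
    _ ≤ liminf (fun T => ∫⁻ s, qT A h T x s ∂P) atTop := lintegral_liminf_le fun T => measurable_qT A h T x
    _ ≤ ENNReal.ofReal (harm A h x) := by
      refine liminf_le_of_le (by isBoundedDefault) ?_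
      intro b hb
      obtain ⟨T, hT⟩ := hb.exists
      exact hT.trans (qT_le hd A h hh T x)

lemma measurable_exitS {d : ℕ} (A : Finset (V d)) (x : V d) : Measurable (exitS A x) := by
  refine measurable_to_countable' fun t => ?_
  have hA : ∀ t, MeasurableSet {s : ℕ → ℝ | walkS x s t ∈ A} := fun t => measurable_walkS x t A.measurableSet
  have : exitS A x ⁻¹' {t} = ({s | walkS x s t ∉ A} ∩ ⋂ j ∈ Finset.range t, {s | walkS x s j ∈ A}) ∪
      (if t = 0 then ⋂ j, {s | walkS x s j ∈ A} else ∅) := by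
    ext s
    by_cases hs : ∀ t, walkS x s t ∈ A
    · have h0 : exitS A x s = 0 := by
        unfold exitS
        have : {t | walkS x s t ∉ A} = ∅ := by ext t; simp [hs t]
        rw [this]; simp
      simp only [Set.mem_preimage, Set.mem_singleton_iff, h0, Set.mem_union, Set.mem_inter_iff, Set.mem_ofPred_eq, hs]
      by_cases ht : t = 0 <;> simp [ht, hs]
      omega
    · obtain ⟨a1, a2⟩ := exit_spec A x s hs
      have h2 : s ∉ (if t = 0 then ⋂ j, {s | walkS x s j ∈ A} else ∅ : Set (ℕ → ℝ)) := by
        split_ifs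
        · simpa using hs
        · simp
      simp only [Set.mem_preimage, Set.mem_singleton_iff, Set.mem_union, h2, or_false, Set.mem_inter_iff,
        Set.mem_ofPred_eq, Set.mem_iInter, Finset.mem_range]
      constructor
      · rintro rfl; exact ⟨a1, a2⟩
      · rintro ⟨b1, b2⟩
        rcases lt_trichotomy (exitS A x s) t with h | h | h
        · exact absurd (b2 _ h) a1
        · exact h
        · exact absurd (a2 _ h) b1
  rw [this]
  refine MeasurableSet.union ((hA t).compl.inter (Finset.measurableSet_biInter _ fun j _ => hA j)) ?_
  split_ifs
  · exact MeasurableSet.iInter hA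
  · exact MeasurableSet.empty

lemma measurable_hitS {d : ℕ} (A : Finset (V d)) (x : V d) : Measurable (hitS A x) := by
  have h1 : Measurable (fun p : ℕ × (ℕ → ℝ) => walkS x p.2 p.1) :=
    measurable_from_prod_countable_right fun t => measurable_walkS x t
  have e : hitS A x = (fun p : ℕ × (ℕ → ℝ) => walkS x p.2 p.1) ∘ (fun s => (exitS A x s, s)) := by
    funext s; rfl
  rw [e]
  exact h1.comp ((measurable_exitS A x).prodMk measurable_id)

lemma measurable_hitPt {d : ℕ} (A : Finset (V d)) (x : V d) : Measurable (hitPt A x) := by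
  have e : hitPt A x = (hitS A x) ∘ (fun ω i => uSlice ω i) := by
    funext s; rfl
  rw [e]
  exact (measurable_hitS A x).comp measurable_slices

/-- the new point of one step -/
def newPt {d : ℕ} (A : Finset (V d)) (ω : ℝ) : V d := hitPt A (pick A (uSlice ω 0)) (uSlice ω 1)

lemma uStep_eq {d : ℕ} (A : Finset (V d)) (ω : ℝ) : uStep A ω = insert (newPt A ω) A := rfl

lemma measurable_uSlice (i : ℕ) : Measurable (fun ω => uSlice ω i) :=
  (measurable_pi_apply i).comp measurable_slices

lemma measurable_hitPt2 {d : ℕ} (A : Finset (V d)) :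
    Measurable (fun p : ℝ × ℝ => hitPt A (pick A p.1) p.2) := by
  have h1 : Measurable (fun p : V d × ℝ => hitPt A p.1 p.2) :=
    measurable_from_prod_countable_right fun x => measurable_hitPt A x
  exact h1.comp (((measurable_pick A).comp measurable_fst).prodMk measurable_snd)

lemma measurable_newPt {d : ℕ} (A : Finset (V d)) : Measurable (newPt A) := by
  have e : newPt A = (fun p : ℝ × ℝ => hitPt A (pick A p.1) p.2) ∘ (fun ω => (uSlice ω 0, uSlice ω 1)) := by
    funext s; rfl
  rw [e]
  exact (measurable_hitPt2 A).comp ((measurable_uSlice 0).prodMk (measurable_uSlice 1))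

/-- the kernel bound -/
lemma kern {d : ℕ} (hd : 0 < d) (A : Finset (V d)) (hA : A.Nonempty) (h : V d → ℝ) (hh : ∀ x, 0 ≤ h x) :
    ∫⁻ ω, ENNReal.ofReal (h (newPt A ω)) ∂μ0 ≤ ENNReal.ofReal (EA A h) := by
  have mh : Measurable (fun x : V d => ENNReal.ofReal (h x)) := measurable_of_countable _
  have mF : Measurable (fun s : ℕ → ℝ => ENNReal.ofReal (h (hitPt A (pick A (s 0)) (s 1)))) := by
    have e : (fun s : ℕ → ℝ => ENNReal.ofReal (h (hitPt A (pick A (s 0)) (s 1)))) =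
        (fun x : V d => ENNReal.ofReal (h x)) ∘ (fun p : ℝ × ℝ => hitPt A (pick A p.1) p.2) ∘
          (fun s : ℕ → ℝ => (s 0, s 1)) := by
      funext s; rfl
    rw [e]
    exact mh.comp ((measurable_hitPt2 A).comp ((measurable_pi_apply 0).prodMk (measurable_pi_apply 1)))
  have mG : ∀ x, Measurable (fun v => ENNReal.ofReal (h (hitPt A x v))) := fun x =>
    mh.comp (measurable_hitPt A x)
  have mH : ∀ x, Measurable (fun v => ENNReal.ofReal (h (hitS A x v))) := fun x =>
    mh.comp (measurable_hitS A x)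
  have h1 : ∫⁻ ω, ENNReal.ofReal (h (newPt A ω)) ∂μ0
      = ∫⁻ s, ENNReal.ofReal (h (hitPt A (pick A (s 0)) (s 1))) ∂P := by
    rw [← map_slices, lintegral_map mF measurable_slices]
    simp only [newPt]
  have h2 : ∀ x, ∫⁻ s : ℕ → ℝ, ENNReal.ofReal (h (hitPt A x (s 0))) ∂P
      = ∫⁻ v, ENNReal.ofReal (h (hitPt A x v)) ∂μ0 := by
    intro x
    have := Measure.infinitePi_map_eval (fun _ : ℕ => μ0) 0
    conv_rhs => rw [← this]
    rw [lintegral_map (mG x) (measurable_pi_apply 0), P]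
  have h3 : ∀ x, ∫⁻ v, ENNReal.ofReal (h (hitPt A x v)) ∂μ0 = ∫⁻ s, ENNReal.ofReal (h (hitS A x s)) ∂P := by
    intro x
    rw [← map_slices, lintegral_map (mH x) measurable_slices]
    simp only [hitPt_eq]
  rw [h1, lintegral_cons _ mF]
  simp only [cons]
  simp_rw [h2, h3]
  rw [lintegral_pick A hA (fun x => ∫⁻ s, ENNReal.ofReal (h (hitS A x s)) ∂P)]
  have hc : (0:ℝ) < A.card := by exact_mod_cast hA.card_pos
  calc _ ≤ (A.card : ℝ≥0∞)⁻¹ * ∑ x ∈ A, ENNReal.ofReal (harm A h x) := by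
        gcongr with x
        exact lintegral_hitS hd A h hh x
    _ = _ := by
        rw [← ENNReal.ofReal_sum_of_nonneg (fun e _ => harm_nonneg hd A h hh _), ← ENNReal.ofReal_natCast,
          ← ENNReal.ofReal_inv_of_pos hc, ← ENNReal.ofReal_mul (by positivity)]
        congr 1
        unfold EA
        field_simp

lemma newPt_ae {d : ℕ} (hd : 0 < d) (A : Finset (V d)) (hA : A.Nonempty) : ∀ᵐ ω ∂μ0, newPt A ω ∉ A := by
  classical
  have h1 := kern hd A hA (fun x => if x ∈ A then 1 else 0) (fun x => by positivity)
  have h2 : EA A (fun x => if x ∈ A then (1:ℝ) else 0) ≤ 0 := by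
    have := EA_mono hd A (fun x => if x ∈ A then (1:ℝ) else 0) (fun _ => 0) (fun x hx => by simp [hx])
    rwa [EA_const hd A hA] at this
  rw [ENNReal.ofReal_eq_zero.2 h2, nonpos_iff_eq_zero, lintegral_eq_zero_iff] at h1
  · filter_upwards [h1] with ω hω hcon
    simp [hcon] at hω
  · exact (measurable_of_countable (fun x => ENNReal.ofReal (if x ∈ A then (1:ℝ) else 0))).comp (measurable_newPt A)

/-- aggregate driven by a sequence -/
def agg {d : ℕ} (S : Finset (V d)) (s : ℕ → ℝ) : ℕ → Finset (V d)
  | 0 => S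
  | k + 1 => uStep (agg S s k) (s k)

lemma uAgg_eq {d : ℕ} (S : Finset (V d)) (ω : ℝ) (k : ℕ) : uAggFrom S ω k = agg S (fun i => uSlice ω i) k := by
  induction k with
  | zero => rfl
  | succ k ih => unfold uAggFrom agg; rw [ih]

lemma agg_cons {d : ℕ} (S : Finset (V d)) (u : ℝ) (s : ℕ → ℝ) (k : ℕ) :
    agg S (cons u s) (k+1) = agg (uStep S u) s k := by
  induction k with
  | zero => rfl
  | succ k ih => 
    rw [agg, ih]; rfl

lemma measurable_uStep {d : ℕ} (A : Finset (V d)) : Measurable (uStep A) := by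
  have : uStep A = (fun x => insert x A) ∘ newPt A := rfl
  rw [this]
  exact (measurable_of_countable _).comp (measurable_newPt A)

lemma measurable_agg {d : ℕ} (S : Finset (V d)) (k : ℕ) : Measurable (fun s => agg S s k) := by
  induction k with
  | zero => exact measurable_const
  | succ k ih =>
    have h1 : Measurable (fun p : Finset (V d) × ℝ => uStep p.1 p.2) :=
      measurable_from_prod_countable_right fun A => measurable_uStep A
    have e : (fun s => agg S s (k+1)) = (fun p : Finset (V d) × ℝ => uStep p.1 p.2) ∘
        (fun s => (agg S s k, s k)) := by
      funext s; rfl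
    rw [e]
    exact h1.comp (ih.prodMk (measurable_pi_apply k))

/-- the product weight -/
def wt {d : ℕ} (X : ℕ → Finset (V d) → Finset (V d) → ℝ≥0∞) (S : Finset (V d)) (k : ℕ) (s : ℕ → ℝ) : ℝ≥0∞ :=
  ∏ j ∈ Finset.range k, X j (agg S s j) (agg S s (j+1))

lemma measurable_wt {d : ℕ} (X : ℕ → Finset (V d) → Finset (V d) → ℝ≥0∞) (S : Finset (V d)) (k : ℕ) :
    Measurable (wt X S k) := by
  unfold wt
  refine Finset.measurable_prod _ fun j _ => ?_
  have h1 : Measurable (fun p : Finset (V d) × Finset (V d) => X j p.1 p.2) := measurable_of_countable _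
  exact h1.comp ((measurable_agg S j).prodMk (measurable_agg S (j+1)))

lemma uStep_nonempty {d : ℕ} (A : Finset (V d)) (u : ℝ) : (uStep A u).Nonempty := by
  rw [uStep_eq]; exact Finset.insert_nonempty _ _

lemma chain {d : ℕ} (k : ℕ) : ∀ (X : ℕ → Finset (V d) → Finset (V d) → ℝ≥0∞) (S : Finset (V d)),
    S.Nonempty → (∀ j, ∀ A : Finset (V d), A.Nonempty → ∫⁻ u, X j A (uStep A u) ∂μ0 ≤ 1) →
    ∫⁻ s, wt X S k s ∂P ≤ 1 := by
  induction k with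
  | zero => intro X S _ _; simp [wt]
  | succ k ih =>
    intro X S hS hX
    rw [lintegral_cons _ (measurable_wt X S (k+1))]
    have h1 : ∀ u s, wt X S (k+1) (cons u s)
        = X 0 S (uStep S u) * wt (fun j => X (j+1)) (uStep S u) k s := by
      intro u s
      unfold wt
      rw [Finset.prod_range_succ', mul_comm]
      congr 1
      refine Finset.prod_congr rfl fun j _ => ?_
      rw [agg_cons, agg_cons]
    simp_rw [h1]
    calc ∫⁻ u, ∫⁻ s, X 0 S (uStep S u) * wt (fun j => X (j+1)) (uStep S u) k s ∂P ∂μ0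
        ≤ ∫⁻ u, X 0 S (uStep S u) ∂μ0 := by
          refine lintegral_mono fun u => ?_
          dsimp only
          rw [lintegral_const_mul _ (measurable_wt _ _ _)]
          exact mul_le_of_le_one_right (by simp) (ih _ _ (uStep_nonempty S u) fun j => hX (j+1))
      _ ≤ 1 := hX 0 S hS

lemma agg_nonempty {d : ℕ} (S : Finset (V d)) (hS : S.Nonempty) (s : ℕ → ℝ) (k : ℕ) : (agg S s k).Nonempty := by
  cases k with
  | zero => exact hS
  | succ k => exact uStep_nonempty _ _

lemma agg_subset_succ {d : ℕ} (S : Finset (V d)) (s : ℕ → ℝ) (k : ℕ) : agg S s k ⊆ agg S s (k+1) := by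
  conv_rhs => unfold agg
  rw [uStep_eq]
  exact Finset.subset_insert _ _

lemma agg_mono {d : ℕ} (S : Finset (V d)) (s : ℕ → ℝ) : Monotone (agg S s) :=
  monotone_nat_of_le_succ (agg_subset_succ S s)

/-- Markov for the product weight -/
lemma wt_markov {d : ℕ} (X : ℕ → Finset (V d) → Finset (V d) → ℝ≥0∞) (S : Finset (V d)) (hS : S.Nonempty)
    (hX : ∀ j, ∀ A : Finset (V d), A.Nonempty → ∫⁻ u, X j A (uStep A u) ∂μ0 ≤ 1) (k : ℕ)
    (L : ℝ) (hL : 0 < L) : P {s | ENNReal.ofReal L ≤ wt X S k s} ≤ ENNReal.ofReal L⁻¹ := by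
  have h1 := mul_meas_ge_le_lintegral (μ := P) (measurable_wt X S k) (ENNReal.ofReal L)
  have h2 := h1.trans (chain k X S hS hX)
  rw [ENNReal.ofReal_inv_of_pos hL]
  rw [ENNReal.le_inv_iff_mul_le, mul_comm]
  exact h2

lemma newPt_chain_ae {d : ℕ} (hd : 0 < d) (S : Finset (V d)) (hS : S.Nonempty) :
    ∀ᵐ s ∂P, ∀ k, newPt (agg S s k) (s k) ∉ agg S s k := by
  classical
  rw [ae_all_iff]
  intro k
  let X : ℕ → Finset (V d) → Finset (V d) → ℝ≥0∞ := fun j A B =>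
    if j = k then (if B.card = A.card then ⊤ else 0) else 1
  have hX : ∀ j, ∀ A : Finset (V d), A.Nonempty → ∫⁻ u, X j A (uStep A u) ∂μ0 ≤ 1 := by
    intro j A hA
    by_cases hj : j = k
    · have : ∫⁻ u, X j A (uStep A u) ∂μ0 = ∫⁻ u, 0 ∂μ0 := by
        refine lintegral_congr_ae ?_
        filter_upwards [newPt_ae hd A hA] with u hu
        simp [X, hj, uStep_eq, Finset.card_insert_of_notMem hu]
      rw [this]; simp
    · simp [X, hj]
  have h1 := chain (k+1) X S hS hX
  have h2 := ae_lt_top (measurable_wt X S (k+1)) (ne_top_of_le_ne_top ENNReal.one_ne_top h1)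
  filter_upwards [h2] with s hs hcon
  have h3 : wt X S (k+1) s = ⊤ := by
    unfold wt
    rw [Finset.prod_range_succ]
    have h4 : ∏ j ∈ Finset.range k, X j (agg S s j) (agg S s (j+1)) = 1 := by
      refine Finset.prod_eq_one fun j hj => ?_
      simp at hj
      simp [X, hj.ne]
    rw [h4, one_mul]
    have : agg S s (k+1) = agg S s k := by
      conv_lhs => unfold agg
      rw [uStep_eq, Finset.insert_eq_of_mem hcon]
    simp [X, this]
  rw [h3] at hs
  exact lt_irrefl _ hs

end

end UI

namespace UI
noncomputable section

/-- antiderivative of `τ ^ (-p)` -/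
def Phi (p x : ℝ) : ℝ := ∫ t in (1:ℝ)..x, t ^ (-p)

lemma Phi_deriv (p x : ℝ) (hx : 0 < x) : HasDerivAt (Phi p) (x ^ (-p)) x := by
  unfold Phi
  have hcont : ContinuousOn (fun t : ℝ => t ^ (-p)) (Set.Ioi 0) := fun t ht =>
    (Real.continuousAt_rpow_const t (-p) (Or.inl (ne_of_gt ht))).continuousWithinAt
  apply intervalIntegral.integral_hasDerivAt_right
  · apply ContinuousOn.intervalIntegrable
    refine hcont.mono fun t ht => ?_
    rw [Set.mem_uIcc] at ht
    simp only [Set.mem_Ioi]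
    rcases ht with h | h <;> linarith [h.1]
  · exact hcont.stronglyMeasurableAtFilter isOpen_Ioi x hx
  · exact Real.continuousAt_rpow_const x (-p) (Or.inl hx.ne')

lemma nonneg_of_deriv {f f' : ℝ → ℝ} {a b : ℝ} (h : ∀ x ∈ Set.Icc a b, HasDerivAt f (f' x) x)
    (h' : ∀ x ∈ Set.Icc a b, 0 ≤ f' x) (h0 : 0 ≤ f a) : ∀ x ∈ Set.Icc a b, 0 ≤ f x := by
  intro x hx
  have hm : MonotoneOn f (Set.Icc a b) := by
    apply monotoneOn_of_deriv_nonneg (convex_Icc a b)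
    · exact fun y hy => (h y hy).continuousAt.continuousWithinAt
    · intro y hy
      exact (h y (interior_subset hy)).differentiableAt.differentiableWithinAt
    · intro y hy
      rw [(h y (interior_subset hy)).deriv]
      exact h' y (interior_subset hy)
  exact h0.trans (hm ⟨le_rfl, hx.1.trans hx.2⟩ hx hx.1)

/-- `Phi` lies below its tangents -/
lemma Phi_tangent {p : ℝ} (hp : 0 ≤ p) {a b : ℝ} (ha : 0 < a) (hb : 0 < b) :
    Phi p b - Phi p a ≤ a ^ (-p) * (b - a) := by
  rcases le_total a b with hab | hab
  · have := nonneg_of_deriv (f := fun x => a ^ (-p) * (x - a) - (Phi p x - Phi p a))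
      (f' := fun x => a ^ (-p) * 1 - x ^ (-p)) (a := a) (b := b) ?_ ?_ (by simp) b ⟨hab, le_rfl⟩
    · linarith
    · intro x hx
      exact (((hasDerivAt_id x).sub_const a).const_mul _).sub
        ((Phi_deriv p x (ha.trans_le hx.1)).sub_const _)
    · intro x hx
      have := Real.rpow_le_rpow_of_nonpos ha hx.1 (neg_nonpos.2 hp)
      linarith
  · have := nonneg_of_deriv (f := fun x => (Phi p x - Phi p b) - a ^ (-p) * (x - b))
      (f' := fun x => x ^ (-p) - a ^ (-p) * 1) (a := b) (b := a) ?_ ?_ (by simp) a ⟨hab, le_rfl⟩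
    · linarith
    · intro x hx
      exact ((Phi_deriv p x (hb.trans_le hx.1)).sub_const _).sub
        (((hasDerivAt_id x).sub_const b).const_mul _)
    · intro x hx
      have := Real.rpow_le_rpow_of_nonpos (hb.trans_le hx.1) hx.2 (neg_nonpos.2 hp)
      linarith

lemma Phi_mono {p : ℝ} {a b : ℝ} (ha : 0 < a) (hab : a ≤ b) : Phi p a ≤ Phi p b := by
  have := nonneg_of_deriv (f := fun x => Phi p x - Phi p a) (f' := fun x => x ^ (-p)) (a := a) (b := b)
    (fun x hx => (Phi_deriv p x (ha.trans_le hx.1)).sub_const _)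
    (fun x hx => Real.rpow_nonneg (ha.le.trans hx.1) _) (by simp) b ⟨hab, le_rfl⟩
  linarith

lemma Phi_log {p : ℝ} (hp : 1 ≤ p) {a b : ℝ} (ha : 0 < a) (hab : a ≤ b) :
    Phi p b - Phi p a ≤ a ^ (1 - p) * (Real.log b - Real.log a) := by
  have := nonneg_of_deriv (f := fun x => a ^ (1 - p) * (Real.log x - Real.log a) - (Phi p x - Phi p a))
    (f' := fun x => a ^ (1 - p) * x⁻¹ - x ^ (-p)) (a := a) (b := b) ?_ ?_ (by simp) b ⟨hab, le_rfl⟩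
  · linarith
  · intro x hx
    have hx0 := ha.trans_le hx.1
    exact (((Real.hasDerivAt_log hx0.ne').sub_const _).const_mul _).sub ((Phi_deriv p x hx0).sub_const _)
  · intro x hx
    have hx0 := ha.trans_le hx.1
    have h1 : x ^ (-p) = x ^ (1 - p) * x⁻¹ := by
      rw [← Real.rpow_neg_one x, ← Real.rpow_add hx0]; congr 1; ring
    have h2 := Real.rpow_le_rpow_of_nonpos ha hx.1 (by linarith : 1 - p ≤ 0)
    rw [h1, ← sub_mul]
    exact mul_nonneg (by linarith) (by positivity)

/-- quadratic lower bound -/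
lemma Phi_quad {p : ℝ} (hp : 0 ≤ p) {a b : ℝ} (ha : 0 < a) (hab : a ≤ b) :
    a ^ (-p) * ((b - a) - p / (2 * a) * (b - a) ^ 2) ≤ Phi p b - Phi p a := by
  have key : ∀ x, a ≤ x → a ^ (-p) * (1 - p / a * (x - a)) ≤ x ^ (-p) := by
    intro x hx
    have := nonneg_of_deriv (f := fun x => x ^ (-p) - a ^ (-p) * (1 - p / a * (x - a)))
      (f' := fun x => (-p) * x ^ (-p - 1) - a ^ (-p) * (-(p / a * 1))) (a := a) (b := x) ?_ ?_ (by simp) x ⟨hx, le_rfl⟩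
    · linarith
    · intro y hy
      have hy0 := ha.trans_le hy.1
      exact (Real.hasDerivAt_rpow_const (Or.inl hy0.ne')).sub
        (((((hasDerivAt_id y).sub_const a).const_mul _).const_sub 1).const_mul _)
    · intro y hy
      have h1 : a ^ (-p) / a = a ^ (-p - 1) := (Real.rpow_sub_one ha.ne' _).symm
      have h2 := Real.rpow_le_rpow_of_nonpos ha hy.1 (by linarith : -p - 1 ≤ 0)
      have : -p * y ^ (-p - 1) - a ^ (-p) * -(p / a * 1) = p * (a ^ (-p - 1) - y ^ (-p - 1)) := by
        rw [← h1]; ring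
      rw [this]
      exact mul_nonneg hp (by linarith)
  have := nonneg_of_deriv (f := fun x => (Phi p x - Phi p a) - a ^ (-p) * ((x - a) - p / (2 * a) * (x - a) ^ 2))
    (f' := fun x => x ^ (-p) - a ^ (-p) * (1 - p / (2 * a) * (((2:ℕ):ℝ) * (x - a) ^ (2 - 1) * 1)))
    (a := a) (b := b) ?_ ?_ (by simp) b ⟨hab, le_rfl⟩
  · linarith
  · intro x hx
    have hx0 := ha.trans_le hx.1
    have e := (hasDerivAt_id x).sub_const a
    exact ((Phi_deriv p x hx0).sub_const _).sub ((e.sub ((e.pow 2).const_mul _)).const_mul _)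
  · intro x hx
    have := key x hx.1
    have e : p / (2 * a) * (((2:ℕ):ℝ) * (x - a) ^ (2 - 1) * 1) = p / a * (x - a) := by
      norm_num
      field_simp
    rw [e]; linarith

/-- the constant in the fourth-order estimate -/
def K3 (p : ℝ) : ℝ := 2 * (p + 2) * (1/2 : ℝ) ^ (-(p + 2) - 1)

lemma K3_nonneg {p : ℝ} (hp : 0 ≤ p) : 0 ≤ K3 p := by unfold K3; positivity

lemma dm (a v : ℝ) (hv : v ∈ Set.Icc (0:ℝ) (1/2)) :
    HasDerivAt (fun v : ℝ => (1 - v) ^ (-a)) (a * (1 - v) ^ (-a - 1)) v := by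
  have h1 : HasDerivAt (fun v : ℝ => 1 - v) (-1) v := by
    simpa using (hasDerivAt_id v).const_sub 1
  have := h1.rpow_const (p := -a) (Or.inl (by linarith [hv.2] : 1 - v ≠ 0))
  convert this using 1; ring

lemma dp (a v : ℝ) (hv : v ∈ Set.Icc (0:ℝ) (1/2)) :
    HasDerivAt (fun v : ℝ => (1 + v) ^ (-a)) (-(a * (1 + v) ^ (-a - 1))) v := by
  have h1 : HasDerivAt (fun v : ℝ => 1 + v) 1 v := by
    simpa using (hasDerivAt_id v).const_add 1
  have := h1.rpow_const (p := -a) (Or.inl (by linarith [hv.1] : 1 + v ≠ 0))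
  convert this using 1; ring

lemma f3 {p : ℝ} (hp : 0 ≤ p) : ∀ v ∈ Set.Icc (0:ℝ) (1/2),
    0 ≤ K3 p * v - (1 - v) ^ (-(p+2)) + (1 + v) ^ (-(p+2)) := by
  refine nonneg_of_deriv (f := fun v => K3 p * v - (1 - v) ^ (-(p+2)) + (1 + v) ^ (-(p+2)))
    (f' := fun v => K3 p * 1 - (p+2) * (1 - v) ^ (-(p+2) - 1) + -((p+2) * (1 + v) ^ (-(p+2) - 1))) ?_ ?_ (by simp)
  · intro v hv
    exact (((hasDerivAt_id v).const_mul _).sub (dm _ v hv)).add (dp _ v hv)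
  · intro v hv
    have h1 : (1 - v) ^ (-(p+2) - 1) ≤ (1/2 : ℝ) ^ (-(p+2) - 1) :=
      Real.rpow_le_rpow_of_nonpos (by norm_num) (by linarith [hv.2]) (by linarith)
    have h2 : (1 + v) ^ (-(p+2) - 1) ≤ (1/2 : ℝ) ^ (-(p+2) - 1) :=
      Real.rpow_le_rpow_of_nonpos (by norm_num) (by linarith [hv.1]) (by linarith)
    unfold K3
    nlinarith

lemma f2 {p : ℝ} (hp : 0 ≤ p) : ∀ v ∈ Set.Icc (0:ℝ) (1/2),
    0 ≤ (p+1) * K3 p / 2 * v ^ 2 + 2 - (1 - v) ^ (-(p+1)) - (1 + v) ^ (-(p+1)) := by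
  refine nonneg_of_deriv (f := fun v => (p+1) * K3 p / 2 * v ^ 2 + 2 - (1 - v) ^ (-(p+1)) - (1 + v) ^ (-(p+1)))
    (f' := fun v => (p+1) * K3 p / 2 * (((2:ℕ):ℝ) * v ^ (2-1)) - (p+1) * (1 - v) ^ (-(p+1) - 1) - -((p+1) * (1 + v) ^ (-(p+1) - 1))) ?_ ?_ (by norm_num)
  · intro v hv
    exact ((((hasDerivAt_pow 2 v).const_mul _).add_const 2).sub (dm _ v hv)).sub (dp _ v hv)
  · intro v hv
    have := f3 hp v hv
    have e : -(p+1) - 1 = -(p+2) := by ring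
    rw [e]
    have h2 := mul_nonneg (by linarith : 0 ≤ p + 1) this
    have e3 : (((2:ℕ):ℝ) * v ^ (2-1)) = 2 * v := by norm_num
    rw [e3]
    generalize (1 - v) ^ (-(p+2)) = A at *
    generalize (1 + v) ^ (-(p+2)) = B at *
    linarith

lemma f1 {p : ℝ} (hp : 0 ≤ p) : ∀ v ∈ Set.Icc (0:ℝ) (1/2),
    0 ≤ 2 * p * v + p * ((p+1) * K3 p) / 6 * v ^ 3 - (1 - v) ^ (-p) + (1 + v) ^ (-p) := by
  refine nonneg_of_deriv (f := fun v => 2 * p * v + p * ((p+1) * K3 p) / 6 * v ^ 3 - (1 - v) ^ (-p) + (1 + v) ^ (-p))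
    (f' := fun v => 2 * p * 1 + p * ((p+1) * K3 p) / 6 * (((3:ℕ):ℝ) * v ^ (3-1)) - p * (1 - v) ^ (-p - 1) + -(p * (1 + v) ^ (-p - 1))) ?_ ?_ (by norm_num)
  · intro v hv
    exact ((((hasDerivAt_id v).const_mul _).add ((hasDerivAt_pow 3 v).const_mul _)).sub (dm _ v hv)).add (dp _ v hv)
  · intro v hv
    have := f2 hp v hv
    have e : -p - 1 = -(p+1) := by ring
    rw [e]
    have h2 := mul_nonneg hp this
    have e3 : (((3:ℕ):ℝ) * v ^ (3-1)) = 3 * v ^ 2 := by norm_num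
    rw [e3]
    generalize (1 - v) ^ (-(p+1)) = A at *
    generalize (1 + v) ^ (-(p+1)) = B at *
    linarith

lemma f0 {p : ℝ} (hp : 0 ≤ p) {s : ℝ} (hs : 0 < s) : ∀ v ∈ Set.Icc (0:ℝ) (1/2),
    0 ≤ s ^ (1 - p) * (p * v ^ 2 + p * ((p+1) * K3 p) / 24 * v ^ 4)
      - (2 * Phi p s - Phi p (s * (1 + v)) - Phi p (s * (1 - v))) := by
  refine nonneg_of_deriv (f := fun v => s ^ (1 - p) * (p * v ^ 2 + p * ((p+1) * K3 p) / 24 * v ^ 4)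
      - (2 * Phi p s - Phi p (s * (1 + v)) - Phi p (s * (1 - v))))
      (f' := fun v => s ^ (1 - p) * (p * (((2:ℕ):ℝ) * v ^ (2-1)) + p * ((p+1) * K3 p) / 24 * (((4:ℕ):ℝ) * v ^ (4-1)))
      - ( - ((s * (1 + v)) ^ (-p) * (s * 1)) - (s * (1 - v)) ^ (-p) * (s * (-1)))) ?_ ?_ (by norm_num; ring_nf; rfl)
  · intro v hv
    have h1 : HasDerivAt (fun v : ℝ => s * (1 + v)) (s * 1) v := ((hasDerivAt_id v).const_add 1).const_mul s
    have h2 : HasDerivAt (fun v : ℝ => s * (1 - v)) (s * (-1)) v := ((hasDerivAt_id v).const_sub 1).const_mul s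
    have g1 := (Phi_deriv p (s * (1 + v)) (mul_pos hs (by linarith [hv.1]))).comp v h1
    have g2 := (Phi_deriv p (s * (1 - v)) (mul_pos hs (by linarith [hv.2]))).comp v h2
    exact ((((hasDerivAt_pow 2 v).const_mul p).add ((hasDerivAt_pow 4 v).const_mul _)).const_mul _).sub
      ((g1.const_sub (2 * Phi p s)).sub g2)
  · intro v hv
    have := f1 hp v hv
    have e0 : s ^ (1 - p) = s * s ^ (-p) := by
      rw [sub_eq_add_neg, Real.rpow_add hs, Real.rpow_one]
    have e1 : (s * (1 + v)) ^ (-p) * (s * 1) = s ^ (1 - p) * (1 + v) ^ (-p) := by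
      rw [Real.mul_rpow hs.le (by linarith [hv.1]), e0]; ring
    have e2 : (s * (1 - v)) ^ (-p) * (s * (-1)) = - (s ^ (1 - p) * (1 - v) ^ (-p)) := by
      rw [Real.mul_rpow hs.le (by linarith [hv.2]), e0]; ring
    rw [e1, e2]
    have h2 := mul_nonneg (Real.rpow_nonneg hs.le (1 - p)) this
    have e3 : (((2:ℕ):ℝ) * v ^ (2-1)) = 2 * v := by norm_num
    have e4 : (((4:ℕ):ℝ) * v ^ (4-1)) = 4 * v ^ 3 := by norm_num
    rw [e3, e4]
    generalize (1 - v) ^ (-p) = A at *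
    generalize (1 + v) ^ (-p) = B at *
    linarith

/-- lower threshold for `c` -/
def cd (d : ℕ) : ℝ := 3 + ((d:ℝ)/2) * (((d:ℝ)/2+1) * K3 ((d:ℝ)/2)) 

lemma cd_ge (d : ℕ) : 3 ≤ cd d := by
  unfold cd
  have := K3_nonneg (p := (d:ℝ)/2) (by positivity)
  have : 0 ≤ ((d:ℝ)/2) * (((d:ℝ)/2+1) * K3 ((d:ℝ)/2)) := by positivity
  linarith

lemma rad {d : ℕ} (hd : 0 < d) (c : ℝ) (hc : cd d ≤ c) (x : V d) :
    Lap (fun y => - Phi ((d:ℝ)/2) (c + nsq y)) x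
      ≤ - (c / 2) * (c + nsq x + 1) ^ (-((d:ℝ)/2) - 1) := by
  have hd0 : (1:ℝ) ≤ d := by exact_mod_cast hd
  set p : ℝ := (d:ℝ)/2 with hp
  have hp0 : 0 ≤ p := by positivity
  set q := nsq x with hq
  have hq0 : 0 ≤ q := nsq_nonneg x
  have hc3 : 3 ≤ c := (cd_ge d).trans hc
  set s := c + q + 1 with hs
  have hs0 : 0 < s := by positivity
  set K := p * ((p+1) * K3 p) with hK
  have hK0 : 0 ≤ K := by have := K3_nonneg hp0; positivity
  have hcK : K ≤ c := by
    have : cd d = 3 + K := rfl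
    linarith
  -- per-direction bound
  have key : ∀ i, (-Phi p (c + nsq (x + Pi.single i 1)) + -Phi p (c + nsq (x + Pi.single i (-1)))
      - 2 * (- Phi p (c + q))) ≤ s ^ (-p) * (p * (4 * (x i : ℝ)^2) / s + K / 24 * (4 * (x i:ℝ)^2 * (4 * q)) / s ^ 3 - 2) := by
    intro i
    have hxq : ((x i : ℝ))^2 ≤ q := by
      rw [hq]; unfold nsq
      exact Finset.single_le_sum (f := fun i => ((x i:ℝ))^2) (fun j _ => sq_nonneg _) (Finset.mem_univ i)
    set y : ℝ := 2 * |(x i : ℝ)| with hy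
    have hy0 : 0 ≤ y := by positivity
    have hy2 : y ^ 2 = 4 * (x i:ℝ)^2 := by rw [hy, mul_pow, sq_abs]; ring
    have hys : y ≤ s / 2 := by
      apply le_of_sq_le_sq _ (by positivity)
      rw [hy2]
      nlinarith [sq_nonneg (c + 1 - q)]
    have hv : y / s ∈ Set.Icc (0:ℝ) (1/2) := ⟨by positivity, by rw [div_le_iff₀ hs0]; linarith⟩
    have h0 := f0 hp0 hs0 (y/s) hv
    have e1 : s * (1 + y / s) = s + y := by field_simp
    have e2 : s * (1 - y / s) = s - y := by field_simp
    rw [e1, e2] at h0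
    have hsum : Phi p (c + nsq (x + Pi.single i 1)) + Phi p (c + nsq (x + Pi.single i (-1)))
        = Phi p (s + y) + Phi p (s - y) := by
      rw [nsq_add_single, nsq_add_single]
      push_cast
      rcases abs_cases (x i:ℝ) with h | h
      · rw [hy, h.1]; congr 2 <;> rw [hs] <;> ring
      · rw [hy, h.1, add_comm]; congr 2 <;> rw [hs] <;> ring
    have ht := Phi_tangent hp0 hs0 (by positivity : 0 < c + q)
    have e3 : c + q - s = -1 := by rw [hs]; ring
    rw [e3] at ht
    have e4 : s ^ (1 - p) = s * s ^ (-p) := by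
      rw [sub_eq_add_neg, Real.rpow_add hs0, Real.rpow_one]
    rw [e4] at h0
    have hsp : 0 ≤ s ^ (-p) := Real.rpow_nonneg hs0.le _
    have e5 : s * s ^ (-p) * (p * (y / s)^2 + K / 24 * (y/s)^4) = s ^ (-p) * (p * y^2 / s + K / 24 * (y^2 * y^2) / s^3) := by
      field_simp
    rw [e5, hy2] at h0
    have h6 : s ^ (-p) * (p * (4 * (x i:ℝ)^2) / s + K / 24 * (4 * (x i:ℝ)^2 * (4 * (x i:ℝ)^2)) / s^3) ≤
      s ^ (-p) * (p * (4 * (x i:ℝ)^2) / s + K / 24 * (4 * (x i:ℝ)^2 * (4 * q)) / s^3) := by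
      gcongr
    rw [mul_sub]
    linarith
  rw [Lap_eq' hd, div_le_iff₀ (by positivity)]
  refine (Finset.sum_le_sum fun i _ => key i).trans ?_
  rw [← Finset.mul_sum]
  have e7 : ∑ i, (p * (4 * (x i : ℝ)^2) / s + K / 24 * (4 * (x i:ℝ)^2 * (4 * q)) / s ^ 3 - 2)
      = p * 4 * q / s + K / 24 * (4 * q * (4 * q)) / s ^ 3 - 2 * d := by
    rw [Finset.sum_sub_distrib, Finset.sum_add_distrib]
    congr 1
    · congr 1
      · rw [hq]; unfold nsq
        rw [Finset.mul_sum, Finset.sum_div]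
        exact Finset.sum_congr rfl fun i _ => by ring
      · have : ∀ i, K / 24 * (4 * (x i:ℝ)^2 * (4 * q)) / s ^ 3 = (K / 24 * 4 * (4 * q) / s^3) * (x i:ℝ)^2 := by
          intro i; ring
        rw [Finset.sum_congr rfl fun i _ => this i, ← Finset.mul_sum]
        have : ∑ i, (x i:ℝ)^2 = q := rfl
        rw [this]; ring
    · simp; ring
  rw [e7]
  have e8 : s ^ (-p - 1) = s ^ (-p) / s := Real.rpow_sub_one hs0.ne' _
  rw [e8]
  have hsp : 0 < s ^ (-p) := Real.rpow_pos_of_pos hs0 _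
  have h9 : K / 24 * (4 * q * (4 * q)) / s ^ 3 ≤ c / s := by
    rw [div_le_div_iff₀ (by positivity) hs0]
    have hqs : q ≤ s := by rw [hs]; linarith
    have : q * q ≤ s * s := mul_le_mul hqs hqs hq0 hs0.le
    calc K / 24 * (4 * q * (4 * q)) * s = (K * (q * q)) * (16 / 24) * s := by ring
      _ ≤ (c * (s * s)) * 1 * s := by gcongr; norm_num
      _ = c * s ^ 3 := by ring
  have h10 : p * 4 * q / s - 2 * d = - (2 * d * (c + 1)) / s := by
    rw [hp, hs]; field_simp; ring
  have h11 : p * 4 * q / s + K / 24 * (4 * q * (4 * q)) / s ^ 3 - 2 * d ≤ - (d * c) / s := by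
    have : - (2 * d * (c + 1)) / s + c / s ≤ - (d * c) / s := by
      rw [← add_div]
      gcongr
      nlinarith
    linarith
  calc s ^ (-p) * (p * 4 * q / s + K / 24 * (4 * q * (4 * q)) / s ^ 3 - 2 * d)
      ≤ s ^ (-p) * (- (d * c) / s) := by gcongr
    _ = _ := by ring

end

end UI

namespace UI
noncomputable section

/-- Euclidean norm of a lattice point -/
def nrm {d : ℕ} (x : V d) : ℝ := Real.sqrt (nsq x)

lemma nrm_nonneg {d : ℕ} (x : V d) : 0 ≤ nrm x := Real.sqrt_nonneg _
lemma nrm_sq {d : ℕ} (x : V d) : nrm x ^ 2 = nsq x := Real.sq_sqrt (nsq_nonneg x)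

/-- embedding in Euclidean space -/
def emb {d : ℕ} (x : V d) : EuclideanSpace ℝ (Fin d) := WithLp.toLp 2 (fun i => (x i : ℝ))

lemma nrm_eq {d : ℕ} (x : V d) : nrm x = ‖emb x‖ := by
  rw [EuclideanSpace.norm_eq]
  unfold nrm nsq emb
  simp

lemma emb_add {d : ℕ} (x y : V d) : emb (x + y) = emb x + emb y := by
  unfold emb; ext i; simp

lemma emb_sub {d : ℕ} (x y : V d) : emb (x - y) = emb x - emb y := by
  unfold emb; ext i; simp

lemma nrm_add_le {d : ℕ} (x y : V d) : nrm (x + y) ≤ nrm x + nrm y := by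
  rw [nrm_eq, nrm_eq, nrm_eq, emb_add]; exact norm_add_le _ _

lemma nrm_sub_comm {d : ℕ} (x y : V d) : nrm (x - y) = nrm (y - x) := by
  rw [nrm_eq, nrm_eq, emb_sub, emb_sub]; exact norm_sub_rev _ _

lemma nrm_tri {d : ℕ} (x y z : V d) : nrm (x - z) ≤ nrm (x - y) + nrm (y - z) := by
  have := nrm_add_le (x - y) (y - z)
  simpa using this

lemma nrm_le_sub {d : ℕ} (x y : V d) : nrm x ≤ nrm y + nrm (x - y) := by
  have := nrm_add_le y (x - y)
  simpa using this

lemma nrm_unit {d : ℕ} {e : V d} (he : e ∈ unitVecs d) : nrm e = 1 := by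
  obtain ⟨i, h | h⟩ := mem_unitVecs.1 he
  · have := nsq_add_single (0 : V d) i 1
    rw [h]; unfold nrm
    rw [zero_add] at this
    rw [this]; simp [nsq]
  · have := nsq_add_single (0 : V d) i (-1)
    rw [h]; unfold nrm
    rw [zero_add] at this
    rw [this]; simp [nsq]

lemma nrm_add_unit {d : ℕ} (x : V d) {e : V d} (he : e ∈ unitVecs d) : nrm (x + e) ≤ nrm x + 1 := by
  have := nrm_add_le x e
  rwa [nrm_unit he] at this

lemma nrm_le_add_unit {d : ℕ} (x : V d) {e : V d} (he : e ∈ unitVecs d) : nrm x ≤ nrm (x + e) + 1 := by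
  have := nrm_add_unit (x + e) (neg_mem_unitVecs he)
  simpa using this

lemma nrm_zero {d : ℕ} : nrm (0 : V d) = 0 := by simp [nrm, nsq]

lemma mem_ball {d : ℕ} (r : ℝ) (x : V d) : x ∈ ball d r ↔ nrm x ≤ r := by
  unfold ball
  rw [Finset.mem_filter]
  have e : Real.sqrt (∑ i, ((x i : ℝ)) ^ 2) = nrm x := rfl
  rw [e]
  refine ⟨fun h => h.2, fun h => ⟨?_, h⟩⟩
  have h1 : ∀ i, |(x i : ℝ)| ≤ r := by
    intro i
    refine le_trans ?_ h
    unfold nrm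
    rw [← Real.sqrt_sq_eq_abs]
    exact Real.sqrt_le_sqrt (Finset.single_le_sum (f := fun i => ((x i:ℝ))^2) (fun j _ => sq_nonneg _) (Finset.mem_univ i))
  rw [Finset.mem_Icc, Pi.le_def, Pi.le_def]
  constructor
  · intro i
    have := (abs_le.1 (h1 i)).1
    have h2 : -(⌈r⌉ : ℝ) ≤ x i := by linarith [Int.le_ceil r]
    exact_mod_cast h2
  · intro i
    have := (abs_le.1 (h1 i)).2
    have h2 : (x i : ℝ) ≤ ⌈r⌉ := by linarith [Int.le_ceil r]
    exact_mod_cast h2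

/-- profile of the obstacle -/
def Gm (p c N q : ℝ) : ℝ := if q ≤ N then -q else -N - (c + N) ^ p * (Phi p (c + q) - Phi p (c + N))

/-- smooth outer branch -/
def Gt (p c N q : ℝ) : ℝ := -N - (c + N) ^ p * (Phi p (c + q) - Phi p (c + N))

lemma Gm_ge {p c N q : ℝ} (h : N ≤ q) : Gm p c N q = Gt p c N q := by
  unfold Gm Gt
  split_ifs with h1
  · have : q = N := le_antisymm h1 h
    subst this; simp
  · rfl

lemma Gm_le_Gt {p c N q : ℝ} (hp : 0 ≤ p) (hc : 0 < c) (hN : 0 ≤ N) (hq : 0 ≤ q) : Gm p c N q ≤ Gt p c N q := by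
  by_cases h : q ≤ N
  · unfold Gm Gt
    rw [if_pos h]
    have hcN : 0 < c + N := by linarith
    have h1 := Phi_tangent hp hcN (by linarith : 0 < c + q)
    have h2 : (c + N) ^ p * (Phi p (c + q) - Phi p (c + N)) ≤ (c + N) ^ p * ((c + N) ^ (-p) * (c + q - (c + N))) := by
      gcongr
    rw [← mul_assoc, ← Real.rpow_add hcN] at h2
    simp at h2
    linarith
  · exact (Gm_ge (not_le.1 h).le).le

lemma Gm_quad {p c N q : ℝ} (hp : 0 ≤ p) (hc : 0 < c) (hN : 0 < N) :
    Gm p c N q ≤ -q + p / (2 * N) * (max (q - N) 0) ^ 2 := by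
  by_cases h : q ≤ N
  · unfold Gm
    rw [if_pos h]
    have : 0 ≤ p / (2 * N) * (max (q - N) 0) ^ 2 := by positivity
    linarith
  · push Not at h
    rw [Gm_ge h.le, max_eq_left (by linarith)]
    unfold Gt
    have hcN : 0 < c + N := by linarith
    have h1 := Phi_quad hp hcN (by linarith : c + N ≤ c + q)
    have h2 : (c + N) ^ p * ((c + N) ^ (-p) * ((c + q - (c + N)) - p / (2 * (c + N)) * (c + q - (c + N)) ^ 2)) ≤
      (c + N) ^ p * (Phi p (c + q) - Phi p (c + N)) := by gcongr
    rw [← mul_assoc, ← Real.rpow_add hcN] at h2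
    simp only [add_neg_cancel, Real.rpow_zero, one_mul] at h2
    have e : c + q - (c + N) = q - N := by ring
    rw [e] at h2
    have h3 : p / (2 * (c + N)) * (q - N) ^ 2 ≤ p / (2 * N) * (q - N) ^ 2 := by
      gcongr; linarith
    linarith

lemma one_add_pow_le (d : ℕ) (t : ℝ) (h0 : 0 ≤ t) (h1 : t ≤ 1) : (1 + t) ^ d ≤ 1 + 2 ^ d * t := by
  have h2 : (1:ℝ) ≤ 2 ^ d := one_le_pow₀ (by norm_num)
  have : (1 + t) ^ d ≤ 1 + (2 ^ d - 1) * t := by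
    induction d with
    | zero => simp
    | succ k ih =>
      have hk : (1:ℝ) ≤ 2 ^ k := one_le_pow₀ (by norm_num)
      have := ih hk
      rw [pow_succ, pow_succ]
      have h3 : (1 + t) ^ k * (1 + t) ≤ (1 + (2 ^ k - 1) * t) * (1 + t) := by gcongr
      refine h3.trans ?_
      nlinarith [mul_nonneg (sub_nonneg.2 hk) (mul_nonneg h0 (sub_nonneg.2 h1))]
  nlinarith

/-- obstacle function of the squared norm -/
def Wq (p c N a qs q : ℝ) : ℝ := (q - qs) + a * (Gm p c N q - Gm p c N qs)

lemma Wq_outer {p c N a qs q : ℝ} (hqs : N ≤ qs) (h : N ≤ q) (hb : (c + qs) ^ p = a * (c + N) ^ p) :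
    Wq p c N a qs q = (q - qs) - (c + qs) ^ p * (Phi p (c + q) - Phi p (c + qs)) := by
  unfold Wq
  rw [Gm_ge hqs, Gm_ge h, hb]
  unfold Gt; ring

lemma Wq_nonneg {p c N a qs q : ℝ} (hp : 0 ≤ p) (hc : 0 < c) (hN : 0 < N) (ha : 1 ≤ a) (hqs : N ≤ qs)
    (hb : (c + qs) ^ p = a * (c + N) ^ p) : 0 ≤ Wq p c N a qs q := by
  have main : ∀ q, N ≤ q → 0 ≤ Wq p c N a qs q := by
    intro q hq
    rw [Wq_outer hqs hq hb]
    have hcs : 0 < c + qs := by linarith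
    have h1 := Phi_tangent hp hcs (by linarith : 0 < c + q)
    have h2 : (c + qs) ^ p * (Phi p (c + q) - Phi p (c + qs)) ≤ (c + qs) ^ p * ((c + qs) ^ (-p) * (c + q - (c + qs))) := by
      gcongr
    rw [← mul_assoc, ← Real.rpow_add hcs] at h2
    simp at h2
    linarith
  by_cases h : N ≤ q
  · exact main q h
  · push Not at h
    have h1 := main N le_rfl
    have h2 : Wq p c N a qs q = Wq p c N a qs N + (a - 1) * (N - q) := by
      unfold Wq Gm
      rw [if_pos h.le, if_pos (le_refl N)]; ring
    rw [h2]
    have := mul_nonneg (sub_nonneg.2 ha) (sub_nonneg.2 h.le)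
    linarith

lemma Lap_Gm {d : ℕ} (hd : 2 ≤ d) {c N : ℝ} (hc : cd d ≤ c) (hN : 2 * d ≤ N) (x : V d) :
    Lap (fun y => Gm ((d:ℝ)/2) c N (nsq y)) x ≤ 0 := by
  have hd0 : 0 < d := by omega
  have hdR : (2:ℝ) ≤ d := by exact_mod_cast hd
  have hc3 : 3 ≤ c := (cd_ge d).trans hc
  have hN0 : 0 < N := by linarith
  have hp : 0 ≤ (d:ℝ)/2 := by positivity
  by_cases h : N ≤ nsq x
  · have h1 := Lap_le_of_touch (fun y => Gm ((d:ℝ)/2) c N (nsq y)) (fun y => Gt ((d:ℝ)/2) c N (nsq y)) x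
      (fun e he => Gm_le_Gt hp (by linarith) hN0.le (nsq_nonneg _)) (Gm_ge h)
    refine h1.trans ?_
    have e : (fun y : V d => Gt ((d:ℝ)/2) c N (nsq y)) = fun y => (c + N) ^ ((d:ℝ)/2) * (- Phi ((d:ℝ)/2) (c + nsq y)) +
        (-N + (c + N) ^ ((d:ℝ)/2) * Phi ((d:ℝ)/2) (c + N)) := by
      funext y; unfold Gt; ring
    rw [e, Lap_add, Lap_smul, Lap_const hd0]
    have h2 := rad hd0 c hc x
    have h3 : -(c / 2) * (c + nsq x + 1) ^ (-((d:ℝ)/2) - 1) ≤ 0 := by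
      have : 0 ≤ (c / 2) * (c + nsq x + 1) ^ (-((d:ℝ)/2) - 1) := by
        have := nsq_nonneg x
        positivity
      linarith
    have h4 : 0 ≤ (c + N) ^ ((d:ℝ)/2) := by positivity
    have := mul_nonpos_of_nonneg_of_nonpos h4 (h2.trans h3)
    linarith
  · push Not at h
    have hx : Gm ((d:ℝ)/2) c N (nsq x) = - nsq x := by unfold Gm; rw [if_pos h.le]
    rw [Lap_eq' hd0]
    rw [div_le_iff₀ (by positivity), zero_mul, hx]
    have key : ∀ i, (Gm ((d:ℝ)/2) c N (nsq (x + Pi.single i 1)) + Gm ((d:ℝ)/2) c N (nsq (x + Pi.single i (-1))) - 2 * (-nsq x))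
        ≤ -2 + (d:ℝ) / (4 * N) * (6 * (x i:ℝ)^2 + 4) := by
      intro i
      have h1 := Gm_quad (q := nsq (x + Pi.single i 1)) hp (by linarith : 0 < c) hN0
      have h2 := Gm_quad (q := nsq (x + Pi.single i (-1))) hp (by linarith : 0 < c) hN0
      rw [nsq_add_single] at h1 h2
      push_cast at h1 h2
      rw [nsq_add_single, nsq_add_single]
      push_cast
      set y := (x i : ℝ)
      set q := nsq x
      have b1 : (max (q + 2 * 1 * y + 1 ^ 2 - N) 0) ^ 2 + (max (q + 2 * (-1) * y + (-1) ^ 2 - N) 0) ^ 2 ≤ 6 * y ^ 2 + 4 := by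
        have c1 : max (q + 2 * 1 * y + 1 ^ 2 - N) 0 ≤ max (1 + 2 * y) 0 := max_le_max (by linarith) le_rfl
        have c2 : max (q + 2 * (-1) * y + (-1) ^ 2 - N) 0 ≤ max (1 - 2 * y) 0 := max_le_max (by linarith) le_rfl
        have d1 : (max (q + 2 * 1 * y + 1 ^ 2 - N) 0) ^ 2 ≤ (max (1 + 2 * y) 0) ^ 2 := by gcongr
        have d2 : (max (q + 2 * (-1) * y + (-1) ^ 2 - N) 0) ^ 2 ≤ (max (1 - 2 * y) 0) ^ 2 := by gcongr
        rcases le_total 0 y with hy | hy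
        · rw [max_eq_left (by linarith : (0:ℝ) ≤ 1 + 2 * y)] at d1
          have : (max (1 - 2 * y) 0) ^ 2 ≤ 1 ^ 2 := by
            gcongr; exact max_le (by linarith) (by norm_num)
          nlinarith [sq_nonneg (y - 1)]
        · rw [max_eq_left (by linarith : (0:ℝ) ≤ 1 - 2 * y)] at d2
          have : (max (1 + 2 * y) 0) ^ 2 ≤ 1 ^ 2 := by
            gcongr; exact max_le (by linarith) (by norm_num)
          nlinarith [sq_nonneg (y + 1)]
      have e : (d:ℝ)/2 / (2 * N) = (d:ℝ) / (4 * N) := by field_simp; norm_num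
      rw [e] at h1 h2
      have b2 : (d:ℝ) / (4 * N) * ((max (q + 2 * 1 * y + 1 ^ 2 - N) 0) ^ 2 + (max (q + 2 * (-1) * y + (-1) ^ 2 - N) 0) ^ 2) ≤
        (d:ℝ) / (4 * N) * (6 * y ^ 2 + 4) := by gcongr
      rw [mul_add] at b2
      linarith
    refine (Finset.sum_le_sum fun i _ => key i).trans ?_
    rw [Finset.sum_add_distrib, ← Finset.mul_sum, Finset.sum_add_distrib, ← Finset.mul_sum]
    have : ∑ i, (x i:ℝ)^2 = nsq x := rfl
    rw [this]
    simp only [Finset.sum_const, Finset.card_univ, Fintype.card_fin, nsmul_eq_mul]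
    have h5 : (d:ℝ) / (4 * N) * (6 * nsq x + d * 4) ≤ (d:ℝ) / (4 * N) * (8 * N) := by
      gcongr; linarith
    have h6 : (d:ℝ) / (4 * N) * (8 * N) = 2 * d := by field_simp; norm_num
    linarith

set_option maxHeartbeats 1000000 in
lemma obstacle {d : ℕ} (hd : 2 ≤ d) : ∃ CW n0 : ℝ, 0 < CW ∧ 1 ≤ n0 ∧ ∀ n a : ℝ, n0 ≤ n → 1 ≤ a → a ≤ 2 →
    ∃ W : V d → ℝ, (∀ x, 0 ≤ W x) ∧ (∀ x, nrm x ≤ n → Lap W x ≤ 1 - a) ∧ (∀ x, Lap W x ≤ 1) ∧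
      ∀ s, 1 ≤ s → s ≤ n → ∀ x, (n + 3) * a ^ ((1:ℝ)/d) - 1 ≤ nrm x → nrm x ≤ (n + 3) * a ^ ((1:ℝ)/d) + s →
        W x ≤ CW * s ^ 2 := by
  have hd0 : 0 < d := by omega
  have hdR : (2:ℝ) ≤ d := by exact_mod_cast hd
  set c := cd d with hc
  have hc3 : 3 ≤ c := cd_ge d
  set p : ℝ := (d:ℝ)/2 with hp
  have hp1 : 1 ≤ p := by rw [hp]; linarith
  refine ⟨2 ^ d * 289, max (2 * d) c, by positivity, le_max_of_le_right (by linarith), ?_⟩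
  intro n a hn ha1 ha2
  have hn1 : 2 * (d:ℝ) ≤ n := (le_max_left _ _).trans hn
  have hn2 : c ≤ n := (le_max_right _ _).trans hn
  have hn0 : 0 < n := by linarith
  set N := (n + 2) ^ 2 with hN
  have hNn : n ^ 2 ≤ N := by rw [hN]; gcongr; linarith
  have hN0 : 0 < N := by positivity
  have hNd : 2 * (d:ℝ) ≤ N := by nlinarith
  set α := a ^ ((1:ℝ)/d) with hα
  have hα1 : 1 ≤ α := Real.one_le_rpow ha1 (by positivity)
  have hαd : α ^ d = a := by
    rw [hα, ← Real.rpow_natCast, ← Real.rpow_mul (by linarith)]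
    have : (1:ℝ) / d * d = 1 := by field_simp
    rw [this, Real.rpow_one]
  have hα2 : α ^ 2 ≤ 2 := by
    calc α ^ 2 ≤ α ^ d := pow_le_pow_right₀ hα1 hd
      _ ≤ 2 := by rw [hαd]; exact ha2
  have hα15 : α ≤ 3/2 := by nlinarith
  set qs := α ^ 2 * (c + N) - c with hqs
  have hcqs : c + qs = α ^ 2 * (c + N) := by rw [hqs]; ring
  have hα21 : 1 ≤ α ^ 2 := one_le_pow₀ hα1
  have hqsN : N ≤ qs := by rw [hqs]; nlinarith
  have hb : (c + qs) ^ p = a * (c + N) ^ p := by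
    rw [hcqs, Real.mul_rpow (by positivity) (by positivity)]
    congr 1
    rw [← Real.rpow_natCast α 2, ← Real.rpow_mul (by linarith), ← hαd, ← Real.rpow_natCast α d]
    congr 1
    rw [hp]; push_cast; ring
  refine ⟨fun y => Wq p c N a qs (nsq y), fun x => Wq_nonneg (by linarith) (by linarith) hN0 ha1 hqsN hb, ?_, ?_, ?_⟩
  · intro x hx
    have e : Lap (fun y => Wq p c N a qs (nsq y)) x = Lap (fun y => (1 - a) * nsq y + (- qs - a * Gm p c N qs)) x := by
      have inn : ∀ y : V d, nrm y ≤ n + 1 → Wq p c N a qs (nsq y) = (1 - a) * nsq y + (- qs - a * Gm p c N qs) := by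
        intro y hy
        have : nsq y ≤ N := by
          rw [← nrm_sq, hN]
          have := nrm_nonneg y
          gcongr; linarith
        have e1 : Gm p c N (nsq y) = - nsq y := by unfold Gm; rw [if_pos this]
        unfold Wq
        rw [e1]; ring
      apply Lap_congr
      · intro e he
        exact inn _ ((nrm_add_unit x he).trans (by linarith))
      · exact inn _ (by linarith)
    rw [e, Lap_add, Lap_smul, Lap_const hd0, Lap_nsq hd0]
    linarith
  · intro x
    have e : (fun y : V d => Wq p c N a qs (nsq y)) = fun y => nsq y + (a * Gm p c N (nsq y) + (- qs - a * Gm p c N qs)) := by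
      funext y; unfold Wq; ring
    rw [e, Lap_add, Lap_add, Lap_smul, Lap_const hd0, Lap_nsq hd0]
    have := Lap_Gm hd le_rfl hNd x
    have := mul_nonpos_of_nonneg_of_nonpos (by linarith : 0 ≤ a) this
    linarith
  · intro s hs1 hsn x hx1 hx2
    set q := nsq x with hq
    have hq2 : nrm x ^ 2 = q := nrm_sq x
    have hNq : N ≤ q := by
      rw [← hq2, hN]
      have : n + 2 ≤ nrm x := by nlinarith
      gcongr
    have hlow : - (17 * n * s) ≤ q - qs := by
      have h1 : ((n + 3) * α - 1) ^ 2 ≤ q := by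
        rw [← hq2]
        have : 0 ≤ (n + 3) * α - 1 := by nlinarith
        gcongr
      have h2 : (n+3) * α ≤ (n+3) * (3/2) := by gcongr
      have h3 : α ^ 2 * (n + 2) ^ 2 ≤ α ^ 2 * (n + 3) ^ 2 := by gcongr; linarith
      have h4 : α ^ 2 * c ≤ 2 * n := by gcongr
      have h7 : n * 1 ≤ n * s := by gcongr
      have e : ((n + 3) * α - 1) ^ 2 = α ^ 2 * (n + 3) ^ 2 - 2 * ((n+3) * α) + 1 := by ring
      rw [e] at h1
      rw [hqs, hN, mul_add]
      linarith
    have hup : q - qs ≤ 17 * n * s := by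
      have h1 : q ≤ ((n + 3) * α + s) ^ 2 := by
        rw [← hq2]
        have := nrm_nonneg x
        gcongr
      have h2 : (n+3) * α ≤ (n+3) * (3/2) := by gcongr
      have h3 : (n + 3) * α * s ≤ (n+3) * (3/2) * s := by gcongr
      have h4 : α ^ 2 * (2 * n + 5) ≤ 2 * (2 * n + 5) := by gcongr
      have h5 : s ^ 2 ≤ n * s := by rw [sq]; gcongr
      have h6 : 1 * c ≤ α ^ 2 * c := by gcongr
      have h7 : n * 1 ≤ n * s := by gcongr
      have h8 : 3 * s ≤ n * s := by gcongr; linarith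
      have e : ((n + 3) * α + s) ^ 2 = α ^ 2 * (n + 2) ^ 2 + α ^ 2 * (2 * n + 5) + 2 * ((n + 3) * α * s) + s ^ 2 := by ring
      rw [e] at h1
      rw [hqs, hN, mul_add]
      linarith
    have hsq : (q - qs) ^ 2 ≤ 289 * s ^ 2 * N := by
      have : (q - qs) ^ 2 ≤ (17 * n * s) ^ 2 := sq_le_sq' hlow hup
      calc (q - qs) ^ 2 ≤ (17 * n * s) ^ 2 := this
        _ = 289 * s ^ 2 * n ^ 2 := by ring
        _ ≤ _ := by gcongr
    have hW : Wq p c N a qs q ≤ 2 ^ d * ((q - qs) ^ 2 / N) := by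
      rw [Wq_outer hqsN hNq hb]
      have hcs : 0 < c + qs := by linarith
      rcases le_total qs q with h | h
      · have h1 := Phi_quad (by linarith : 0 ≤ p) hcs (by linarith : c + qs ≤ c + q)
        have h2 : (c + qs) ^ p * ((c + qs) ^ (-p) * ((c + q - (c + qs)) - p / (2 * (c + qs)) * (c + q - (c + qs)) ^ 2)) ≤
          (c + qs) ^ p * (Phi p (c + q) - Phi p (c + qs)) := by gcongr
        rw [← mul_assoc, ← Real.rpow_add hcs] at h2
        simp only [add_neg_cancel, Real.rpow_zero, one_mul] at h2
        have e : c + q - (c + qs) = q - qs := by ring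
        rw [e] at h2
        have h3 : p / (2 * (c + qs)) * (q - qs) ^ 2 ≤ 2 ^ d * ((q - qs) ^ 2 / N) := by
          have h4 : p ≤ 2 ^ d := by
            have : (d:ℝ) ≤ 2 ^ d := by exact_mod_cast Nat.lt_two_pow_self.le
            rw [hp]; linarith
          calc p / (2 * (c + qs)) * (q - qs) ^ 2 ≤ 2 ^ d / N * (q - qs) ^ 2 := by
                gcongr; linarith
            _ = _ := by ring
        linarith
      · have hcq : 0 < c + q := by linarith
        have h1 := Phi_tangent (by linarith : 0 ≤ p) hcq hcs
        have h2 : (c + qs) ^ p * (Phi p (c + qs) - Phi p (c + q)) ≤ (c + qs) ^ p * ((c + q) ^ (-p) * (c + qs - (c + q))) := by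
          gcongr
        set δ := qs - q with hδ
        have hδ0 : 0 ≤ δ := by linarith
        set t := δ / (c + q) with ht
        have ht0 : 0 ≤ t := by positivity
        have ht1 : t ≤ 1 := by
          rw [ht, div_le_one hcq, hδ]
          nlinarith
        have e1 : (c + qs) ^ p * (c + q) ^ (-p) = (1 + t) ^ p := by
          rw [Real.rpow_neg hcq.le, ← div_eq_mul_inv, ← Real.div_rpow hcs.le hcq.le]
          congr 1
          rw [ht, hδ]; field_simp; ring
        have h3 : (1 + t) ^ p ≤ 1 + 2 ^ d * t := by
          refine le_trans ?_ (one_add_pow_le d t ht0 ht1)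
          rw [← Real.rpow_natCast (1 + t) d]
          exact Real.rpow_le_rpow_of_exponent_le (by linarith) (by rw [hp]; linarith)
        rw [← mul_assoc, e1] at h2
        have e2 : c + qs - (c + q) = δ := by rw [hδ]; ring
        rw [e2] at h2
        have h4 : (1 + t) ^ p * δ ≤ (1 + 2 ^ d * t) * δ := by gcongr
        have h5 : 2 ^ d * t * δ ≤ 2 ^ d * (δ ^ 2 / N) := by
          rw [ht]
          calc 2 ^ d * (δ / (c + q)) * δ = 2 ^ d * (δ ^ 2 / (c + q)) := by ring
            _ ≤ _ := by gcongr; linarith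
        have e3 : (q - qs) ^ 2 = δ ^ 2 := by rw [hδ]; ring
        rw [e3]
        have e4 : q - qs = - δ := by rw [hδ]; ring
        rw [e4]
        nlinarith
    calc Wq p c N a qs q ≤ 2 ^ d * ((q - qs) ^ 2 / N) := hW
      _ ≤ 2 ^ d * (289 * s ^ 2 * N / N) := by gcongr
      _ = _ := by field_simp

end

end UI

namespace UI
noncomputable section

/-- truncated potential -/
def Pc (p c w q : ℝ) : ℝ := Phi p (c + 9 * w ^ 2) - Phi p (c + q)

lemma Pc_nonneg {p c w q : ℝ} (hc : 0 < c) (hq : 0 ≤ q) (h : q ≤ 9 * w ^ 2) : 0 ≤ Pc p c w q := by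
  unfold Pc
  have := Phi_mono (p := p) (by linarith : 0 < c + q) (by linarith : c + q ≤ c + 9 * w ^ 2)
  linarith

lemma Pc_le {p c w q : ℝ} (hp : 1 ≤ p) (hc : 1 ≤ c) (hq : 0 ≤ q) (h : q ≤ 9 * w ^ 2) :
    Pc p c w q ≤ (c + q) ^ (1 - p) * Real.log (c + 9 * w ^ 2) := by
  unfold Pc
  have h1 := Phi_log hp (by linarith : 0 < c + q) (by linarith : c + q ≤ c + 9 * w ^ 2)
  refine h1.trans ?_
  have : 0 ≤ Real.log (c + q) := Real.log_nonneg (by linarith)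
  gcongr
  linarith

lemma Lap_Pc {d : ℕ} (hd : 0 < d) {c w : ℝ} (hc : cd d ≤ c) (z x : V d) :
    Lap (fun y => Pc ((d:ℝ)/2) c w (nsq (y - z))) x ≤ - ((c / 2) * (c + nsq (x - z) + 1) ^ (-((d:ℝ)/2) - 1)) := by
  have h1 := rad hd c hc (x - z)
  rw [← Lap_translate] at h1
  have e : (fun y => Pc ((d:ℝ)/2) c w (nsq (y - z))) = fun y => Phi ((d:ℝ)/2) (c + 9 * w ^ 2) + - Phi ((d:ℝ)/2) (c + nsq (y - z)) := by
    funext y; unfold Pc; ring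
  rw [e, Lap_add, Lap_const hd]
  linarith

lemma Lap_Pc_nonpos {d : ℕ} (hd : 0 < d) {c w : ℝ} (hc : cd d ≤ c) (z x : V d) :
    Lap (fun y => Pc ((d:ℝ)/2) c w (nsq (y - z))) x ≤ 0 := by
  refine (Lap_Pc hd hc z x).trans ?_
  have := nsq_nonneg (x - z)
  have h3 := (cd_ge d).trans hc
  have : 0 ≤ (c / 2) * (c + nsq (x - z) + 1) ^ (-((d:ℝ)/2) - 1) := by positivity
  linarith

/-- the exponential test function -/
def hh {d : ℕ} (R w : ℝ) (y : V d) : ℝ := Real.exp (max (nrm y - R - w) 0 / w)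

lemma hh_pos {d : ℕ} (R w : ℝ) (y : V d) : 0 < hh R w y := Real.exp_pos _

lemma one_le_hh {d : ℕ} {R w : ℝ} (hw : 0 < w) (y : V d) : 1 ≤ hh R w y :=
  Real.one_le_exp (by positivity)

lemma hh_le {d : ℕ} {R w : ℝ} (hw : 1 ≤ w) (x y : V d) (h : nrm (y - x) ≤ 2 * w) : hh R w y ≤ 8 * hh R w x := by
  unfold hh
  have h1 : max (nrm y - R - w) 0 ≤ max (nrm x - R - w) 0 + 2 * w := by
    apply max_le
    · have := nrm_le_sub y x
      have := le_max_left (nrm x - R - w) 0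
      linarith
    · have := le_max_right (nrm x - R - w) 0
      linarith
  have h2 : max (nrm y - R - w) 0 / w ≤ max (nrm x - R - w) 0 / w + 2 := by
    rw [div_le_iff₀ (by linarith), add_mul, div_mul_cancel₀ _ (by linarith)]; linarith
  have h3 : Real.exp 2 ≤ 8 := by
    have := Real.exp_one_lt_d9
    have e : Real.exp 2 = Real.exp 1 * Real.exp 1 := by rw [← Real.exp_add]; norm_num
    rw [e]; nlinarith [Real.exp_pos 1]
  calc Real.exp (max (nrm y - R - w) 0 / w) ≤ Real.exp (max (nrm x - R - w) 0 / w + 2) := Real.exp_le_exp.2 h2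
    _ = Real.exp 2 * Real.exp (max (nrm x - R - w) 0 / w) := by rw [Real.exp_add]; ring
    _ ≤ _ := by gcongr

lemma hh_near {d : ℕ} {R w : ℝ} (hw : 1 ≤ w) (y : V d) (h : nrm y ≤ R + w + 1) : hh R w y ≤ 3 := by
  unfold hh
  have h1 : max (nrm y - R - w) 0 / w ≤ 1 := by
    rw [div_le_iff₀ (by linarith)]
    exact max_le (by linarith) (by linarith)
  have := Real.exp_one_lt_d9
  have := Real.exp_le_exp.2 h1
  linarith

/-- barrier near a far point -/
lemma barrier {d : ℕ} (hd : 2 ≤ d) : ∃ K1 : ℝ, 0 < K1 ∧ ∀ (A : Finset (V d)) (R w ρ : ℝ), 1 ≤ w →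
    cd d ≤ ρ ^ 2 → 1 ≤ ρ → ((A.filter (fun y => R < nrm y)).card : ℝ) ≤ ρ ^ d →
    K1 * (ρ ^ 2 * Real.log (ρ ^ 2 + 9 * w ^ 2)) ≤ w ^ 2 → ∀ x ∈ A, R + w ≤ nrm x →
    ∃ f : V d → ℝ, (∀ y ∈ A, nrm (y - x) < w → Lap f y ≤ -1) ∧ (∀ y, nrm (y - x) ≤ 2 * w → 0 ≤ f y) ∧ f x ≤ w ^ 2 / 64 := by
  have hd0 : 0 < d := by omega
  have hdR : (2:ℝ) ≤ d := by exact_mod_cast hd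
  set c := cd d with hc
  have hc3 : 3 ≤ c := cd_ge d
  set p : ℝ := (d:ℝ)/2 with hp
  have hp1 : 1 ≤ p := by rw [hp]; linarith
  set κ : ℝ := 2 * 3 ^ (p + 1) + (c + 1) ^ (p + 1) with hκ
  have hκ0 : 0 < κ := by positivity
  refine ⟨128 * κ, by positivity, ?_⟩
  intro A R w ρ hw hρc hρ hM hK x hx hxR
  classical
  set T := A.filter (fun y => ρ < nrm (y - x) ∧ nrm (y - x) < w) with hT
  have hTM : (T.card : ℝ) ≤ ρ ^ d := by
    refine le_trans ?_ hM
    have : T ⊆ A.filter (fun y => R < nrm y) := by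
      intro y hy
      rw [hT, Finset.mem_filter] at hy
      rw [Finset.mem_filter]
      refine ⟨hy.1, ?_⟩
      have h1 := nrm_le_sub x y
      rw [nrm_sub_comm] at h1
      linarith [hy.2.2]
    exact_mod_cast Finset.card_le_card this
  set L := Real.log (ρ ^ 2 + 9 * w ^ 2) with hL
  have hL0 : 0 ≤ L := Real.log_nonneg (by nlinarith)
  refine ⟨fun y => κ * (ρ ^ d * Pc p (ρ ^ 2) w (nsq (y - x)) + ∑ z ∈ T, Pc p c w (nsq (y - z))), ?_, ?_, ?_⟩
  · intro y hy hyx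
    rw [Lap_smul, Lap_add, Lap_smul, Lap_sum]
    have hS : ∀ z ∈ T, Lap (fun y => Pc p c w (nsq (y - z))) y ≤ 0 := fun z _ => Lap_Pc_nonpos hd0 le_rfl z y
    have hρ2 : 0 < ρ ^ 2 := by positivity
    by_cases hyρ : ρ < nrm (y - x)
    · have hyT : y ∈ T := by rw [hT, Finset.mem_filter]; exact ⟨hy, hyρ, hyx⟩
      have h1 : ∑ z ∈ T, Lap (fun y => Pc p c w (nsq (y - z))) y ≤ Lap (fun u => Pc p c w (nsq (u - y))) y := by
        rw [← Finset.add_sum_erase T _ hyT]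
        have : ∑ z ∈ T.erase y, Lap (fun y => Pc p c w (nsq (y - z))) y ≤ 0 :=
          Finset.sum_nonpos fun z hz => hS z (Finset.mem_of_mem_erase hz)
        linarith
      have h2 := Lap_Pc (w := w) hd0 (le_refl (cd d)) y y
      rw [sub_self] at h2
      have e0 : nsq (0 : V d) = 0 := by simp [nsq]
      rw [e0, add_zero] at h2
      have h3 := Lap_Pc_nonpos (w := w) hd0 hρc x y
      have h4 : ρ ^ d * Lap (fun y => Pc p (ρ ^ 2) w (nsq (y - x))) y ≤ 0 :=
        mul_nonpos_of_nonneg_of_nonpos (by positivity) h3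
      have h5 : (c + 1) ^ (-p - 1) ≤ c / 2 * (c + 1) ^ (-p - 1) := by
        have : 0 ≤ (c + 1) ^ (-p - 1) := by positivity
        nlinarith
      have h6 : κ * (c + 1) ^ (-p - 1) ≥ 1 := by
        have e : (c + 1) ^ (p + 1) * (c + 1) ^ (-p - 1) = 1 := by
          rw [← Real.rpow_add (by linarith)]; ring_nf; exact Real.rpow_zero _
        have : (c + 1) ^ (p + 1) * (c + 1) ^ (-p - 1) ≤ κ * (c + 1) ^ (-p - 1) := by
          gcongr
          rw [hκ]
          have : 0 ≤ (3:ℝ) ^ (p+1) := by positivity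
          linarith
        linarith
      have h7 : ρ ^ d * Lap (fun y => Pc p (ρ ^ 2) w (nsq (y - x))) y + ∑ z ∈ T, Lap (fun y => Pc p c w (nsq (y - z))) y ≤ - (c+1) ^ (-p - 1) := by
        linarith
      have h8 := mul_le_mul_of_nonneg_left h7 hκ0.le
      linarith
    · push Not at hyρ
      have h1 : ∑ z ∈ T, Lap (fun y => Pc p c w (nsq (y - z))) y ≤ 0 := Finset.sum_nonpos hS
      have h2 := Lap_Pc (w := w) hd0 hρc x y
      have hq : nsq (y - x) ≤ ρ ^ 2 := by
        rw [← nrm_sq]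
        have := nrm_nonneg (y - x)
        gcongr
      have h3 : (3 * ρ ^ 2) ^ (-p - 1) ≤ (ρ ^ 2 + nsq (y - x) + 1) ^ (-p - 1) := by
        have := nsq_nonneg (y - x)
        apply Real.rpow_le_rpow_of_nonpos (by positivity) _ (by linarith)
        nlinarith
      have e1 : ρ ^ d * (ρ ^ 2 / 2 * (3 * ρ ^ 2) ^ (-p - 1)) = 3 ^ (-p - 1) / 2 := by
        rw [Real.mul_rpow (by norm_num) hρ2.le]
        have : ρ ^ d * ρ ^ 2 * (ρ ^ 2) ^ (-p - 1) = 1 := by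
          have e : ρ ^ d = (ρ ^ 2) ^ p := by
            rw [← Real.rpow_natCast, ← Real.rpow_natCast, ← Real.rpow_mul (by linarith)]
            congr 1; rw [hp]; push_cast; ring
          rw [e, ← Real.rpow_add_one hρ2.ne', ← Real.rpow_add hρ2]
          ring_nf; exact Real.rpow_zero _
        linear_combination (3 ^ (-p - 1) / 2) * this
      have h4 : ρ ^ d * Lap (fun y => Pc p (ρ ^ 2) w (nsq (y - x))) y ≤ - (3 ^ (-p - 1) / 2) := by
        rw [← e1]
        calc ρ ^ d * Lap (fun y => Pc p (ρ ^ 2) w (nsq (y - x))) y ≤ ρ ^ d * (-(ρ ^ 2 / 2 * (ρ ^ 2 + nsq (y - x) + 1) ^ (-p - 1))) := by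
              gcongr
          _ ≤ ρ ^ d * (-(ρ ^ 2 / 2 * (3 * ρ ^ 2) ^ (-p - 1))) := by gcongr
          _ = _ := by ring
      have h6 : κ * (3 ^ (-p - 1) / 2) ≥ 1 := by
        have e : (3:ℝ) ^ (p + 1) * 3 ^ (-p - 1) = 1 := by
          rw [← Real.rpow_add (by norm_num)]; ring_nf; exact Real.rpow_zero _
        have : 2 * (3:ℝ) ^ (p + 1) * (3 ^ (-p - 1) / 2) ≤ κ * (3 ^ (-p - 1) / 2) := by
          gcongr
          rw [hκ]
          have : 0 ≤ (c + 1) ^ (p+1) := by positivity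
          linarith
        linarith
      have h8 := mul_le_mul_of_nonneg_left (add_le_add h4 h1) hκ0.le
      linarith
  · intro y hy
    have b : ∀ u : V d, nrm u ≤ 3 * w → nsq u ≤ 9 * w ^ 2 := by
      intro u hu
      rw [← nrm_sq]
      have := nrm_nonneg u
      calc nrm u ^ 2 ≤ (3 * w) ^ 2 := by gcongr
        _ = _ := by ring
    have h1 : 0 ≤ Pc p (ρ ^ 2) w (nsq (y - x)) := Pc_nonneg (by positivity) (nsq_nonneg _) (b _ (by linarith))
    have h2 : 0 ≤ ∑ z ∈ T, Pc p c w (nsq (y - z)) := by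
      refine Finset.sum_nonneg fun z hz => ?_
      rw [hT, Finset.mem_filter] at hz
      refine Pc_nonneg (by linarith) (nsq_nonneg _) (b _ ?_)
      have := nrm_tri y x z
      rw [nrm_sub_comm x z] at this
      linarith [hz.2.2]
    positivity
  · have hρ2 : 0 < ρ ^ 2 := by positivity
    have e : ρ ^ d = (ρ ^ 2) ^ p := by
      rw [← Real.rpow_natCast, ← Real.rpow_natCast, ← Real.rpow_mul (by linarith)]
      congr 1; rw [hp]; push_cast; ring
    have e2 : ρ ^ d * (ρ ^ 2) ^ (1 - p) = ρ ^ 2 := by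
      rw [e, ← Real.rpow_add hρ2]
      have : p + (1 - p) = 1 := by ring
      rw [this, Real.rpow_one]
    have h1 : ρ ^ d * Pc p (ρ ^ 2) w (nsq (x - x)) ≤ ρ ^ 2 * L := by
      have := Pc_le (w := w) hp1 (by nlinarith : 1 ≤ ρ ^ 2) (le_refl (0:ℝ)) (by positivity)
      rw [add_zero] at this
      have e0 : nsq (x - x) = 0 := by rw [sub_self]; simp [nsq]
      rw [e0]
      calc ρ ^ d * Pc p (ρ ^ 2) w 0 ≤ ρ ^ d * ((ρ ^ 2) ^ (1 - p) * L) := by gcongr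
        _ = (ρ ^ d * (ρ ^ 2) ^ (1 - p)) * L := by ring
        _ = _ := by rw [e2]
    have h2 : ∑ z ∈ T, Pc p c w (nsq (x - z)) ≤ ρ ^ 2 * L := by
      have h3 : ∀ z ∈ T, Pc p c w (nsq (x - z)) ≤ (ρ ^ 2) ^ (1 - p) * L := by
        intro z hz
        rw [hT, Finset.mem_filter, nrm_sub_comm] at hz
        have hq1 : ρ ^ 2 ≤ nsq (x - z) := by
          rw [← nrm_sq]
          have := hz.2.1
          gcongr
        have hq2 : nsq (x - z) ≤ 9 * w ^ 2 := by
          rw [← nrm_sq]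
          have := nrm_nonneg (x - z)
          have : nrm (x - z) ^ 2 ≤ w ^ 2 := by gcongr; exact hz.2.2.le
          nlinarith
        refine (Pc_le hp1 (by linarith) (nsq_nonneg _) hq2).trans ?_
        have h5 : (c + nsq (x - z)) ^ (1 - p) ≤ (ρ ^ 2) ^ (1 - p) :=
          Real.rpow_le_rpow_of_nonpos hρ2 (by linarith) (by linarith)
        have h6 : Real.log (c + 9 * w ^ 2) ≤ L := by
          apply Real.log_le_log (by positivity); linarith
        have h7 : 0 ≤ Real.log (c + 9 * w ^ 2) := Real.log_nonneg (by nlinarith)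
        gcongr
      calc ∑ z ∈ T, Pc p c w (nsq (x - z)) ≤ ∑ z ∈ T, (ρ ^ 2) ^ (1 - p) * L := Finset.sum_le_sum h3
        _ = T.card * ((ρ ^ 2) ^ (1 - p) * L) := by rw [Finset.sum_const, nsmul_eq_mul]
        _ ≤ ρ ^ d * ((ρ ^ 2) ^ (1 - p) * L) := by gcongr
        _ = (ρ ^ d * (ρ ^ 2) ^ (1 - p)) * L := by ring
        _ = _ := by rw [e2]
    have h9 := mul_le_mul_of_nonneg_left (add_le_add h1 h2) hκ0.le
    linarith

lemma tent {d : ℕ} (hd : 2 ≤ d) : ∃ K1 : ℝ, 0 < K1 ∧ ∀ (A : Finset (V d)) (R w ρ : ℝ), 1 ≤ w →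
    cd d ≤ ρ ^ 2 → 1 ≤ ρ → ((A.filter (fun y => R < nrm y)).card : ℝ) ≤ ρ ^ d →
    K1 * (ρ ^ 2 * Real.log (ρ ^ 2 + 9 * w ^ 2)) ≤ w ^ 2 →
    ∀ x ∈ A, harm A (hh R w) x ≤ 40 * hh R w x := by
  have hd0 : 0 < d := by omega
  obtain ⟨K1, hK1, hbar⟩ := barrier hd
  refine ⟨K1, hK1, ?_⟩
  intro A R w ρ hw hρc hρ hM hK
  classical
  by_cases hAe : A.Nonempty
  swap
  · intro x hx; exact absurd ⟨x, hx⟩ hAe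
  obtain ⟨x0, hx0, hmax⟩ := A.exists_max_image (fun x => harm A (hh R w) x / hh R w x) hAe
  set S := harm A (hh R w) x0 / hh R w x0 with hS
  have hS0 : 0 ≤ S := div_nonneg (harm_nonneg hd0 A _ (fun x => (hh_pos R w x).le) _) (hh_pos _ _ _).le
  have hH : ∀ x ∈ A, harm A (hh R w) x ≤ S * hh R w x := by
    intro x hx
    have := hmax x hx
    rwa [div_le_iff₀ (hh_pos _ _ _)] at this
  have far : ∀ x ∈ A, R + w ≤ nrm x → harm A (hh R w) x ≤ 8 * hh R w x * (1 + S / 64) := by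
    intro x hx hxR
    obtain ⟨f, hf1, hf2, hf3⟩ := hbar A R w ρ hw hρc hρ hM hK x hx hxR
    have hw2 : 0 < w ^ 2 := by positivity
    have hp := hh_pos R w x
    have := cmpP hd0 (A.filter (fun y => nrm (y - x) < w)) (harm A (hh R w))
      (fun y => 8 * hh R w x * (S / w ^ 2) * (f y + nsq (y - x)) + 8 * hh R w x) ?_ ?_ x ?_
    · refine this.trans ?_
      have e0 : nsq (x - x) = 0 := by rw [sub_self]; simp [nsq]
      rw [e0, add_zero]
      have : 8 * hh R w x * (S / w ^ 2) * f x ≤ 8 * hh R w x * (S / w ^ 2) * (w ^ 2 / 64) := by gcongr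
      have e : 8 * hh R w x * (S / w ^ 2) * (w ^ 2 / 64) = 8 * hh R w x * (S / 64) := by field_simp
      linarith
    · intro y hy
      rw [Finset.mem_filter] at hy
      rw [harm_in hd0 A _ hy.1, Lap_add, Lap_smul, Lap_const hd0, Lap_add, Lap_translate nsq, Lap_nsq hd0, add_zero]
      apply mul_nonpos_of_nonneg_of_nonpos (by positivity)
      linarith [hf1 y hy.1 hy.2]
    · intro y hy e he hye
      rw [Finset.mem_filter] at hy
      set z := y + e with hz
      have hzx : nrm (z - x) ≤ 2 * w := by
        have := nrm_add_unit (y - x) he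
        have e1 : y - x + e = z - x := by rw [hz]; abel
        rw [e1] at this
        linarith [hy.2]
      have hf0 := hf2 z hzx
      have hq0 := nsq_nonneg (z - x)
      have hle := hh_le (R := R) hw x z hzx
      by_cases hzA : z ∈ A
      · have hzw : w ≤ nrm (z - x) := by
          by_contra hcon
          push Not at hcon
          exact hye (Finset.mem_filter.2 ⟨hzA, hcon⟩)
        have h1 : w ^ 2 ≤ nsq (z - x) := by rw [← nrm_sq]; gcongr
        calc harm A (hh R w) z ≤ S * hh R w z := hH z hzA
          _ ≤ S * (8 * hh R w x) := by gcongr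
          _ = 8 * hh R w x * (S / w ^ 2) * w ^ 2 := by field_simp
          _ ≤ 8 * hh R w x * (S / w ^ 2) * (f z + nsq (z - x)) := by gcongr; linarith
          _ ≤ _ := by linarith
      · rw [harm_out hd0 A _ hzA]
        have : 0 ≤ 8 * hh R w x * (S / w ^ 2) * (f z + nsq (z - x)) := by positivity
        linarith
    · rw [Finset.mem_filter]
      refine ⟨hx, ?_⟩
      rw [sub_self, nrm_zero]; linarith
  have near : ∀ x ∈ A, nrm x < R + w → harm A (hh R w) x ≤ 24 * (1 + S / 64) := by
    intro x hx hxR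
    refine maxP hd0 (A.filter (fun y => nrm y < R + w)) (harm A (hh R w)) _ ?_ ?_ x (Finset.mem_filter.2 ⟨hx, hxR⟩)
    · intro y hy
      rw [Finset.mem_filter] at hy
      rw [harm_in hd0 A _ hy.1]
    · intro y hy e he hye
      rw [Finset.mem_filter] at hy
      set z := y + e with hz
      have hzn : nrm z ≤ R + w + 1 := (nrm_add_unit y he).trans (by linarith [hy.2])
      have h3 := hh_near hw z hzn
      by_cases hzA : z ∈ A
      · have hzw : R + w ≤ nrm z := by
          by_contra hcon
          push Not at hcon
          exact hye (Finset.mem_filter.2 ⟨hzA, hcon⟩)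
        refine (far z hzA hzw).trans ?_
        have : 8 * hh R w z * (1 + S / 64) ≤ 8 * 3 * (1 + S / 64) := by gcongr
        linarith
      · rw [harm_out hd0 A _ hzA]
        linarith
  have hS40 : S ≤ 40 := by
    have h0 := one_le_hh (R := R) (by linarith : 0 < w) x0
    have : S ≤ 24 * (1 + S / 64) := by
      rw [hS, div_le_iff₀ (hh_pos _ _ _), ← hS]
      rcases lt_or_ge (nrm x0) (R + w) with h | h
      · have := near x0 hx0 h
        have h2 : 24 * (1 + S / 64) * 1 ≤ 24 * (1 + S / 64) * hh R w x0 := by gcongr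
        linarith
      · have := far x0 hx0 h
        have h2 : 0 ≤ 16 * hh R w x0 * (1 + S / 64) := by
          have := hh_pos R w x0
          positivity
        linarith
    linarith
  intro x hx
  have := hh_pos R w x
  exact (hH x hx).trans (by gcongr)

end

end UI

namespace UI
noncomputable section

lemma sum_insert_le {d : ℕ} (A : Finset (V d)) (z : V d) (h : V d → ℝ) (hh : ∀ x, 0 ≤ h x) :
    ∑ x ∈ insert z A, h x ≤ ∑ x ∈ A, h x + h z := by
  classical
  by_cases hz : z ∈ A
  · rw [Finset.insert_eq_of_mem hz]; linarith [hh z]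
  · rw [Finset.sum_insert hz]; linarith

lemma EA_affine {d : ℕ} (hd : 0 < d) (A : Finset (V d)) (hA : A.Nonempty) (a b : ℝ) (h : V d → ℝ) :
    EA A (fun y => a + b * h y) = a + b * EA A h := by
  have h1 := EA_add hd A (fun _ => a) (fun y => b * h y)
  rw [EA_const hd A hA, EA_smul hd] at h1
  exact h1

lemma tent_prob {d : ℕ} (hd : 2 ≤ d) : ∃ K1 : ℝ, 0 < K1 ∧ ∀ (S : Finset (V d)) (R w ρ I : ℝ) (k : ℕ), S.Nonempty →
    S ⊆ ball d R → k ≤ S.card → 1 ≤ w → cd d ≤ ρ ^ 2 → 1 ≤ ρ → 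
    K1 * (ρ ^ 2 * Real.log (ρ ^ 2 + 9 * w ^ 2)) ≤ w ^ 2 →
    P {s | (((agg S s k).filter (fun y => R < nrm y)).card : ℝ) ≤ ρ ^ d ∧ ¬ agg S s k ⊆ ball d (R + (I + 1) * w)}
      ≤ ENNReal.ofReal (S.card * Real.exp 40 * Real.exp (-I)) := by
  have hd0 : 0 < d := by omega
  obtain ⟨K1, hK1, htent⟩ := tent hd
  refine ⟨K1, hK1, ?_⟩
  intro S R w ρ I k hS hSR hk hw hρc hρ hK
  classical
  set h : V d → ℝ := hh R w with hhdef
  have hpos : ∀ x, 0 < h x := fun x => hh_pos R w x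
  have hsum : ∀ A : Finset (V d), A.Nonempty → 0 < ∑ x ∈ A, h x := fun A hA =>
    Finset.sum_pos (fun x _ => hpos x) hA
  let good : Finset (V d) → Prop := fun A => ((A.filter (fun y => R < nrm y)).card : ℝ) ≤ ρ ^ d
  let X : ℕ → Finset (V d) → Finset (V d) → ℝ≥0∞ := fun _ A B =>
    if good A then ENNReal.ofReal ((∑ x ∈ B, h x) / ((∑ x ∈ A, h x) * (1 + 40 / A.card))) else 0
  have hX : ∀ j, ∀ A : Finset (V d), A.Nonempty → ∫⁻ u, X j A (uStep A u) ∂μ0 ≤ 1 := by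
    intro j A hA
    by_cases hg : good A
    swap
    · simp [X, hg]
    have hD : 0 < (∑ x ∈ A, h x) * (1 + 40 / (A.card : ℝ)) := by
      have := hsum A hA
      positivity
    set D := (∑ x ∈ A, h x) * (1 + 40 / (A.card : ℝ)) with hDd
    clear_value D
    have h1 : ∀ u, X j A (uStep A u) ≤ ENNReal.ofReal ((fun y => (∑ x ∈ A, h x) / D + D⁻¹ * h y) (newPt A u)) := by
      intro u
      simp only [X, if_pos hg, uStep_eq, ← hDd]
      apply ENNReal.ofReal_le_ofReal
      have := sum_insert_le A (newPt A u) h (fun x => (hpos x).le)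
      calc (∑ x ∈ insert (newPt A u) A, h x) / D ≤ (∑ x ∈ A, h x + h (newPt A u)) / D := by gcongr
        _ = _ := by rw [add_div]; ring
    refine (lintegral_mono h1).trans ((kern hd0 A hA (fun y => (∑ x ∈ A, h x) / D + D⁻¹ * h y) ?_).trans ?_)
    · intro x
      exact add_nonneg (div_nonneg (hsum A hA).le hD.le) (mul_nonneg (inv_nonneg.2 hD.le) (hpos x).le)
    · rw [EA_affine hd0 A hA]
      rw [← ENNReal.ofReal_one]
      apply ENNReal.ofReal_le_ofReal
      have hE : EA A h ≤ 40 * (∑ x ∈ A, h x) / A.card := by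
        unfold EA
        gcongr
        rw [Finset.mul_sum]
        exact Finset.sum_le_sum fun x hx => htent A R w ρ hw hρc hρ hg hK x hx
      calc (∑ x ∈ A, h x) / D + D⁻¹ * EA A h = (∑ x ∈ A, h x + EA A h) / D := by ring
        _ ≤ (∑ x ∈ A, h x + 40 * (∑ x ∈ A, h x) / A.card) / D := by gcongr
        _ = D / D := by rw [hDd]; congr 1; ring
        _ = 1 := div_self hD.ne'
  have hm : 0 < (S.card : ℝ) := by exact_mod_cast hS.card_pos
  have hL : 0 < Real.exp I / (S.card * Real.exp 40) := by positivity
  have hmk := wt_markov X S hS hX k _ hL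
  have e : (Real.exp I / (S.card * Real.exp 40))⁻¹ = S.card * Real.exp 40 * Real.exp (-I) := by
    rw [inv_div, Real.exp_neg]; rfl
  rw [e] at hmk
  refine le_trans (measure_mono ?_) hmk
  rintro s ⟨hcard, hnot⟩
  rw [Set.mem_ofPred_eq]
  have hgood : ∀ j ≤ k, good (agg S s j) := by
    intro j hj
    refine le_trans ?_ hcard
    have := Finset.card_le_card (Finset.filter_subset_filter (fun y => R < nrm y) (agg_mono S s hj))
    exact_mod_cast this
  have hind : ∀ j ≤ k, ENNReal.ofReal ((∑ x ∈ agg S s j, h x) / (S.card * Real.exp (40 / S.card) ^ j)) ≤ wt X S j s := by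
    intro j
    induction j with
    | zero =>
      intro _
      simp only [wt, Finset.range_zero, Finset.prod_empty, pow_zero, mul_one]
      rw [← ENNReal.ofReal_one]
      apply ENNReal.ofReal_le_ofReal
      rw [div_le_one hm]
      have : ∀ x ∈ agg S s 0, h x ≤ 1 := by
        intro x hx
        have := (mem_ball R x).1 (hSR hx)
        simp only [h, hh]
        rw [max_eq_right (by linarith)]; simp
      have := Finset.sum_le_card_nsmul _ _ _ this
      simpa [agg] using this
    | succ j ih =>
      intro hj
      have hj' := ih (by omega)
      have hw1 : wt X S (j+1) s = wt X S j s * X j (agg S s j) (agg S s (j+1)) := by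
        unfold wt; rw [Finset.prod_range_succ]
      rw [hw1]
      have hgj := hgood j (by omega)
      have hne := agg_nonempty S hS s j
      have hne1 := agg_nonempty S hS s (j+1)
      have p0 := hsum _ hne
      have p1 := hsum _ hne1
      have hcj : (S.card : ℝ) ≤ (agg S s j).card := by
        exact_mod_cast Finset.card_le_card (agg_mono S s (Nat.zero_le j))
      have hstep : ENNReal.ofReal ((∑ x ∈ agg S s (j+1), h x) / ((∑ x ∈ agg S s j, h x) * Real.exp (40 / S.card))) ≤
          X j (agg S s j) (agg S s (j+1)) := by
        simp only [X, if_pos hgj]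
        apply ENNReal.ofReal_le_ofReal
        have : 1 + 40 / ((agg S s j).card : ℝ) ≤ Real.exp (40 / S.card) := by
          have h1 := Real.add_one_le_exp (40 / (S.card : ℝ))
          have h2 : 40 / ((agg S s j).card : ℝ) ≤ 40 / (S.card : ℝ) := by gcongr
          linarith
        gcongr
      refine le_trans ?_ (mul_le_mul' hj' hstep)
      rw [← ENNReal.ofReal_mul (by positivity)]
      apply ENNReal.ofReal_le_ofReal
      apply le_of_eq
      rw [pow_succ]
      field_simp
  refine le_trans ?_ (hind k le_rfl)
  apply ENNReal.ofReal_le_ofReal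
  rw [Finset.not_subset] at hnot
  obtain ⟨y, hy, hyn⟩ := hnot
  rw [mem_ball] at hyn
  push Not at hyn
  have h1 : Real.exp I ≤ ∑ x ∈ agg S s k, h x := by
    refine le_trans ?_ (Finset.single_le_sum (f := h) (fun x _ => (hpos x).le) hy)
    simp only [h, hh]
    apply Real.exp_le_exp.2
    rw [le_div_iff₀ (by linarith)]
    refine le_trans ?_ (le_max_left _ _)
    linarith
  have h2 : Real.exp (40 / S.card) ^ k ≤ Real.exp 40 := by
    rw [← Real.exp_nat_mul]
    apply Real.exp_le_exp.2
    have : (k:ℝ) ≤ S.card := by exact_mod_cast hk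
    calc (k:ℝ) * (40 / S.card) ≤ S.card * (40 / S.card) := by gcongr
      _ = 40 := by field_simp
  have h3 : 0 ≤ ∑ x ∈ agg S s k, h x := (hsum _ (agg_nonempty S hS s k)).le
  exact div_le_div₀ h3 h1 (by positivity) (by gcongr)

end

end UI

namespace UI
noncomputable section

/-- the martingale noise attached to a test function -/
def noise {d : ℕ} (S : Finset (V d)) (s : ℕ → ℝ) (k : ℕ) (g : V d → ℝ) : ℝ :=
  ∑ j ∈ Finset.range k, (1 / (((agg S s j).card : ℝ) + 1)) *
    (∑ x ∈ agg S s (j+1), g x - ∑ x ∈ agg S s j, g x - EA (agg S s j) g)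

/-- quadratic variation bound -/
def qv {d : ℕ} (S : Finset (V d)) (s : ℕ → ℝ) (k : ℕ) (g : V d → ℝ) : ℝ :=
  ∑ j ∈ Finset.range k, (1 / (((agg S s j).card : ℝ) + 1)) ^ 2 * EA (agg S s j) (fun x => g x ^ 2)

lemma exp_le_quad (v : ℝ) (h : |v| ≤ 1) : Real.exp v ≤ 1 + v + v ^ 2 := by
  have := Real.abs_exp_sub_one_sub_id_le h
  have := (abs_le.1 this).2
  linarith

lemma noise_prob {d : ℕ} (hd : 0 < d) (S : Finset (V d)) (hS : S.Nonempty) (g : V d → ℝ) (G θ lam : ℝ) (k : ℕ)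
    (hg0 : ∀ x, 0 ≤ g x) (hgG : ∀ x, g x ≤ G) (hθ : |θ| * G ≤ S.card) :
    P {s | lam ≤ θ * noise S s k g - θ ^ 2 * qv S s k g} ≤ ENNReal.ofReal (Real.exp (-lam)) := by
  classical
  let c : Finset (V d) → ℝ := fun A => 1 / ((A.card : ℝ) + 1)
  let Y : Finset (V d) → Finset (V d) → ℝ := fun A B =>
    θ * (c A * (∑ x ∈ B, g x - ∑ x ∈ A, g x - EA A g)) - θ ^ 2 * (c A ^ 2 * EA A (fun x => g x ^ 2))
  let X : ℕ → Finset (V d) → Finset (V d) → ℝ≥0∞ := fun _ A B =>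
    if S.card ≤ A.card then ENNReal.ofReal (Real.exp (Y A B)) else 0
  have hX : ∀ j, ∀ A : Finset (V d), A.Nonempty → ∫⁻ u, X j A (uStep A u) ∂μ0 ≤ 1 := by
    intro j A hA
    by_cases hcard : S.card ≤ A.card
    swap
    · simp [X, hcard]
    have hcA : 0 ≤ c A := by simp only [c]; positivity
    set b := θ * c A with hb
    have hbg : ∀ x, |b * g x| ≤ 1 := by
      intro x
      rw [hb, abs_mul, abs_mul, abs_of_nonneg hcA, abs_of_nonneg (hg0 x)]
      have h1 : |θ| * g x ≤ A.card := by
        have : |θ| * g x ≤ |θ| * G := by gcongr; exact hgG x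
        have : (S.card : ℝ) ≤ A.card := by exact_mod_cast hcard
        linarith
      have : |θ| * c A * g x = (|θ| * g x) / ((A.card : ℝ) + 1) := by simp only [c]; ring
      rw [this, div_le_one (by positivity)]
      linarith
    set E1 := EA A g with hE1
    set E2 := EA A (fun x => g x ^ 2) with hE2
    set M := Real.exp (-(b * E1 + b ^ 2 * E2)) with hM
    have hMpos : 0 < M := Real.exp_pos _
    have hae : ∀ᵐ u ∂μ0, X j A (uStep A u) ≤ ENNReal.ofReal ((fun y => 0 + M * (1 + b * g y + b ^ 2 * g y ^ 2)) (newPt A u)) := by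
      filter_upwards [newPt_ae hd A hA] with u hu
      simp only [X, if_pos hcard, uStep_eq]
      apply ENNReal.ofReal_le_ofReal
      rw [zero_add]
      have e : Y A (insert (newPt A u) A) = -(b * E1 + b ^ 2 * E2) + b * g (newPt A u) := by
        simp only [Y]
        rw [Finset.sum_insert hu, ← hE1, ← hE2, hb]; ring
      rw [e, Real.exp_add]
      have := exp_le_quad _ (hbg (newPt A u))
      rw [mul_pow] at this
      gcongr
    refine (lintegral_mono_ae hae).trans ((kern hd A hA (fun y => 0 + M * (1 + b * g y + b ^ 2 * g y ^ 2)) ?_).trans ?_)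
    · intro x
      rw [zero_add]
      refine mul_nonneg hMpos.le ?_
      nlinarith [sq_nonneg (b * g x + 1/2)]
    · have e1 : EA A (fun y => 0 + M * (1 + b * g y + b ^ 2 * g y ^ 2)) = 0 + M * (1 + b * E1 + b ^ 2 * E2) := by
        rw [EA_affine hd A hA 0 M (fun y => 1 + b * g y + b ^ 2 * g y ^ 2)]
        have h1 := EA_add hd A (fun y => 1 + b * g y) (fun y => b ^ 2 * g y ^ 2)
        rw [EA_affine hd A hA 1 b g, EA_smul hd A (b ^ 2) (fun y => g y ^ 2)] at h1
        rw [h1]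
      rw [e1, ← ENNReal.ofReal_one]
      apply ENNReal.ofReal_le_ofReal
      have h1 := Real.add_one_le_exp (b * E1 + b ^ 2 * E2)
      rw [zero_add, hM, Real.exp_neg, inv_mul_le_one₀ (Real.exp_pos _)]
      linarith
  have hmk := wt_markov X S hS hX k _ (Real.exp_pos lam)
  rw [← Real.exp_neg] at hmk
  refine le_trans (measure_mono ?_) hmk
  intro s hs
  rw [Set.mem_ofPred_eq] at hs ⊢
  have hcd : ∀ j, S.card ≤ (agg S s j).card := fun j => Finset.card_le_card (agg_mono S s (Nat.zero_le j))
  have hwt : wt X S k s = ENNReal.ofReal (Real.exp (θ * noise S s k g - θ ^ 2 * qv S s k g)) := by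
    unfold wt noise qv
    rw [Finset.mul_sum, Finset.mul_sum, ← Finset.sum_sub_distrib, Real.exp_sum,
      ENNReal.ofReal_prod_of_nonneg (fun _ _ => (Real.exp_pos _).le)]
    refine Finset.prod_congr rfl fun j _ => ?_
    simp only [X, if_pos (hcd j), Y, c]
  rw [hwt]
  exact ENNReal.ofReal_le_ofReal (Real.exp_le_exp.2 hs)

lemma card_agg {d : ℕ} (S : Finset (V d)) (s : ℕ → ℝ) (h : ∀ k, newPt (agg S s k) (s k) ∉ agg S s k) (k : ℕ) :
    (agg S s k).card = S.card + k := by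
  classical
  induction k with
  | zero => rfl
  | succ k ih => 
    have : agg S s (k+1) = insert (newPt (agg S s k) (s k)) (agg S s k) := by
      rw [agg, uStep_eq]
    rw [this, Finset.card_insert_of_notMem (h k), ih]; ring

lemma noise_id {d : ℕ} (hd : 0 < d) (S : Finset (V d)) (hS : S.Nonempty) (s : ℕ → ℝ)
    (h : ∀ k, newPt (agg S s k) (s k) ∉ agg S s k) (k : ℕ) :
    ∃ U : V d → ℝ, (∀ x, 0 ≤ U x) ∧ (∀ x ∉ agg S s k, U x = 0) ∧ ∀ g : V d → ℝ,
      ((S.card : ℝ) + k) * noise S s k g = ∑ x ∈ agg S s k, g x - (((S.card : ℝ) + k) / S.card) * ∑ x ∈ S, g x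
        - ∑ x ∈ agg S s k, U x * Lap g x := by
  classical
  have hm : 0 < (S.card : ℝ) := by exact_mod_cast hS.card_pos
  have hc : ∀ j, ((agg S s j).card : ℝ) = S.card + j := fun j => by
    rw [card_agg S s h j]; push_cast; ring
  refine ⟨fun x => ((S.card : ℝ) + k) * ∑ j ∈ Finset.range k, (1 / (((agg S s j).card : ℝ) + 1)) * vA (agg S s j) x, ?_, ?_, ?_⟩
  · intro x
    refine mul_nonneg (by positivity) (Finset.sum_nonneg fun j _ => mul_nonneg (by positivity) (vA_nonneg hd _ _))
  · intro x hx
    beta_reduce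
    rw [Finset.sum_eq_zero, mul_zero]
    intro j hj
    rw [vA_out hd, mul_zero]
    exact fun hx' => hx (agg_mono S s (Finset.mem_range.1 hj).le hx')
  · intro g
    have key : ∀ i ≤ k, noise S s i g = (∑ x ∈ agg S s i, g x) / ((S.card : ℝ) + i) - (∑ x ∈ S, g x) / S.card
        - ∑ x ∈ agg S s k, (∑ j ∈ Finset.range i, (1 / (((agg S s j).card : ℝ) + 1)) * vA (agg S s j) x) * Lap g x := by
      intro i
      induction i with
      | zero => intro _; simp [noise, agg]
      | succ i ih =>
        intro hi
        have e : noise S s (i+1) g = noise S s i g + (1 / (((agg S s i).card : ℝ) + 1)) *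
            (∑ x ∈ agg S s (i+1), g x - ∑ x ∈ agg S s i, g x - EA (agg S s i) g) := by
          unfold noise; rw [Finset.sum_range_succ]
        rw [e, ih (by omega), EA_eq hd _ (agg_nonempty S hS s i) g]
        have e2 : ∑ x ∈ agg S s i, vA (agg S s i) x * Lap g x = ∑ x ∈ agg S s k, vA (agg S s i) x * Lap g x := by
          apply Finset.sum_subset (agg_mono S s (by omega))
          intro x _ hx
          rw [vA_out hd _ hx, zero_mul]
        rw [e2]
        have e3 : ∑ x ∈ agg S s k, (∑ j ∈ Finset.range (i+1), (1 / (((agg S s j).card : ℝ) + 1)) * vA (agg S s j) x) * Lap g x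
          = ∑ x ∈ agg S s k, (∑ j ∈ Finset.range i, (1 / (((agg S s j).card : ℝ) + 1)) * vA (agg S s j) x) * Lap g x
            + (1 / (((agg S s i).card : ℝ) + 1)) * ∑ x ∈ agg S s k, vA (agg S s i) x * Lap g x := by
          rw [Finset.mul_sum, ← Finset.sum_add_distrib]
          refine Finset.sum_congr rfl fun x _ => ?_
          rw [Finset.sum_range_succ]; ring
        rw [e3]
        generalize ∑ x ∈ agg S s k, (∑ j ∈ Finset.range i, (1 / (((agg S s j).card : ℝ) + 1)) * vA (agg S s j) x) * Lap g x = Z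
        rw [hc i]
        have hmi : 0 < (S.card : ℝ) + i := by positivity
        have hmi1 : 0 < (S.card : ℝ) + i + 1 := by positivity
        push_cast
        rw [← add_assoc]
        field_simp
        ring
    rw [key k le_rfl]
    have hmk : 0 < (S.card : ℝ) + k := by positivity
    simp only [mul_assoc, ← Finset.mul_sum]
    field_simp

lemma green {d : ℕ} (hd : 2 ≤ d) : ∃ K0 : ℝ, 0 < K0 ∧ ∀ r : ℝ, 1 ≤ r → ∀ z ∈ ball d r,
    ∃ g : V d → ℝ, (∀ x ∈ ball d r, x ≠ z → Lap g x = 0) ∧ Lap g z = -1 ∧ (∀ x ∉ ball d r, g x = 0) ∧ (∀ x, 0 ≤ g x) ∧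
      (∀ x, g x ≤ K0 * Real.log (cd d + 9 * r ^ 2)) ∧ ∑ x ∈ ball d r, g x ≤ (r + 1) ^ 2 := by
  classical
  have hd0 : 0 < d := by omega
  have hdR : (2:ℝ) ≤ d := by exact_mod_cast hd
  have hc3 := cd_ge d
  set κ : ℝ := (cd d / 2) * (cd d + 0 + 1) ^ (-((d:ℝ)/2) - 1) with hκ
  have hκ0 : 0 < κ := by rw [hκ]; positivity
  refine ⟨κ⁻¹, by positivity, ?_⟩
  intro r hr z hz
  have hzr := (mem_ball r z).1 hz
  set D := ball d r
  obtain ⟨a1, a2⟩ := dir_spec hd0 D (fun x => if x = z then -1 else 0) (fun _ => 0)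
  set g := dir D (fun x => if x = z then -1 else 0) (fun _ => 0)
  have hlog : 0 ≤ Real.log (cd d + 9 * r ^ 2) := Real.log_nonneg (by nlinarith)
  refine ⟨g, ?_, ?_, a2, ?_, ?_, ?_⟩
  · intro x hx hxz; rw [a1 x hx, if_neg hxz]
  · rw [a1 z hz, if_pos rfl]
  · intro x
    by_cases hx : x ∈ D
    · refine cmpP hd0 D (fun _ => 0) g (fun y hy => ?_) (fun y hy e he hA => ?_) x hx
      · rw [a1 y hy, Lap_const hd0]; split_ifs <;> norm_num
      · rw [a2 _ hA]
    · rw [a2 x hx]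
  · intro x
    by_cases hx : x ∈ D
    · have h1 : g x ≤ κ⁻¹ * Pc ((d:ℝ)/2) (cd d) r (nsq (x - z)) := by
        refine cmpP hd0 D g (fun y => κ⁻¹ * Pc ((d:ℝ)/2) (cd d) r (nsq (y - z))) (fun y hy => ?_) (fun y hy e he hA => ?_) x hx
        · rw [Lap_smul, a1 y hy]
          split_ifs with h
          · have := Lap_Pc hd0 (w := r) (le_refl (cd d)) z y
            have e0 : nsq (y - z) = 0 := by rw [h, sub_self, ← nrm_sq, nrm_zero]; norm_num
            rw [e0, ← hκ] at this
            calc κ⁻¹ * _ ≤ κ⁻¹ * (-κ) := by gcongr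
              _ = -1 := by field_simp
          · exact mul_nonpos_of_nonneg_of_nonpos (by positivity) (Lap_Pc_nonpos hd0 (le_refl (cd d)) z y)
        · rw [a2 _ hA]
          refine mul_nonneg (by positivity) (Pc_nonneg (by linarith) (nsq_nonneg _) ?_)
          rw [← nrm_sq]
          have hyr := (mem_ball r y).1 hy
          have h2 : nrm (y + e - z) ≤ 2 * r + 1 := by
            have h3 := nrm_tri (y + e) 0 z
            rw [sub_zero, nrm_sub_comm 0 z, sub_zero] at h3
            have h4 := nrm_add_unit y he
            linarith
          have := nrm_nonneg (y + e - z)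
          nlinarith
      have hxr := (mem_ball r x).1 hx
      have h2 : nrm (x - z) ≤ 2 * r := by
        have h3 := nrm_tri x 0 z
        rw [sub_zero, nrm_sub_comm 0 z, sub_zero] at h3
        linarith
      have hq : nsq (x - z) ≤ 9 * r ^ 2 := by
        rw [← nrm_sq]
        have := nrm_nonneg (x - z)
        nlinarith
      have h3 := Pc_le (p := (d:ℝ)/2) (c := cd d) (by linarith) (by linarith) (nsq_nonneg (x - z)) hq
      have h4 : (cd d + nsq (x - z)) ^ (1 - (d:ℝ)/2) ≤ 1 :=
        Real.rpow_le_one_of_one_le_of_nonpos (by linarith [nsq_nonneg (x - z)]) (by linarith)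
      refine h1.trans ?_
      gcongr
      refine h3.trans ?_
      calc _ ≤ 1 * Real.log (cd d + 9 * r ^ 2) := by gcongr
        _ = _ := one_mul _
    · rw [a2 x hx]; positivity
  · obtain ⟨b1, b2⟩ := dir_spec hd0 D (fun _ => -1) (fun _ => 0)
    set h := dir D (fun _ => -1) (fun _ => 0)
    have e := byParts D g h a2 b2
    have e1 : ∑ x ∈ D, g x * Lap h x = - ∑ x ∈ D, g x := by
      rw [← Finset.sum_neg_distrib]
      exact Finset.sum_congr rfl fun x hx => by rw [b1 x hx]; ring
    have e2 : ∑ x ∈ D, h x * Lap g x = - h z := by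
      rw [Finset.sum_eq_single z]
      · rw [a1 z hz, if_pos rfl]; ring
      · intro x hx hxz; rw [a1 x hx, if_neg hxz, mul_zero]
      · intro hz'; exact absurd hz hz'
    have e3 : ∑ x ∈ D, g x = h z := by linarith
    rw [e3]
    have := cmpP hd0 D h (fun y => (r+1)^2 - nsq y) (fun y hy => ?_) (fun y hy e he hA => ?_) z hz
    · have := nsq_nonneg z
      linarith
    · rw [b1 y hy, Lap_sub, Lap_const hd0]
      have : Lap (fun y => nsq y) y = 1 := Lap_nsq hd0 y
      linarith
    · rw [b2 _ hA, ← nrm_sq]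
      have h4 := nrm_add_unit y he
      have hyr := (mem_ball r y).1 hy
      have := nrm_nonneg (y + e)
      nlinarith

end

end UI

namespace UI
noncomputable section

lemma det_U {d : ℕ} (hd : 0 < d) (D E S : Finset (V d)) (hSE : S ⊆ E) (hED : E ⊆ D) (U W : V d → ℝ) (a κ : ℝ)
    (hU : ∀ x ∉ E, U x = 0) (hW : ∀ x, 0 ≤ W x) (hWS : ∀ x ∈ S, Lap W x ≤ 1 - a) (hW1 : ∀ x, Lap W x ≤ 1) (hκ : 0 ≤ κ)
    (hg : ∀ z ∈ D, ∃ g : V d → ℝ, (∀ x ∈ D, x ≠ z → Lap g x = 0) ∧ Lap g z = -1 ∧ (∀ x ∉ D, g x = 0) ∧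
      |∑ x ∈ E, g x - a * ∑ x ∈ S, g x - ∑ x ∈ E, U x * Lap g x| ≤ κ) :
    ∀ x ∈ E, U x ≤ W x + 2 * κ := by
  classical
  obtain ⟨b1, b2⟩ := dir_spec hd D (fun x => (if x ∈ E then 1 else 0) - a * (if x ∈ S then 1 else 0)) (fun _ => 0)
  set U0 := dir D (fun x => (if x ∈ E then 1 else 0) - a * (if x ∈ S then 1 else 0)) (fun _ => 0)
  have key : ∀ z ∈ D, |U z - U0 z| ≤ κ := by
    intro z hz
    obtain ⟨g, g1, g2, g3, g4⟩ := hg z hz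
    have hsum : ∀ u : V d → ℝ, ∑ x ∈ D, u x * Lap g x = - u z := by
      intro u
      rw [Finset.sum_eq_single z]
      · rw [g2]; ring
      · intro x hx hxz; rw [g1 x hx hxz, mul_zero]
      · intro hz'; exact absurd hz hz'
    have e1 : ∑ x ∈ E, U x * Lap g x = - U z := by
      rw [← hsum U]
      apply Finset.sum_subset hED
      intro x _ hx; rw [hU x hx, zero_mul]
    have e2 : ∑ x ∈ E, g x - a * ∑ x ∈ S, g x = - U0 z := by
      rw [← hsum U0, byParts D U0 g b2 g3]
      have : ∀ x ∈ D, g x * Lap U0 x = (if x ∈ E then g x else 0) - a * (if x ∈ S then g x else 0) := by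
        intro x hx; rw [b1 x hx]; split_ifs <;> ring
      rw [Finset.sum_congr rfl this, Finset.sum_sub_distrib, ← Finset.mul_sum, ← Finset.sum_filter, ← Finset.sum_filter,
        Finset.filter_mem_eq_inter, Finset.filter_mem_eq_inter, Finset.inter_eq_right.2 hED,
        Finset.inter_eq_right.2 (hSE.trans hED)]
    rw [e1, e2] at g4
    have : U z - U0 z = - U0 z - - U z := by ring
    rw [this]; exact g4
  have h2 : ∀ x ∈ E, U0 x ≤ W x + κ := by
    refine cmpP hd E U0 (fun y => W y + κ) (fun y hy => ?_) (fun y hy e he hA => ?_)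
    · rw [Lap_add, Lap_const hd, b1 y (hED hy), if_pos hy]
      split_ifs with h
      · have := hWS y h; linarith
      · have := hW1 y; linarith
    · by_cases hD : y + e ∈ D
      · have := (abs_le.1 (key _ hD)).1
        rw [hU _ hA] at this
        have := hW (y + e)
        linarith
      · rw [b2 _ hD]; have := hW (y + e); linarith
  intro x hx
  have := (abs_le.1 (key _ (hED hx))).2
  have := h2 x hx
  linarith

/-- cutoff function -/
def cut {d : ℕ} (R s : ℝ) (x : V d) : ℝ := min ((max (nrm x - R) 0) ^ 2 / s ^ 2) 1

lemma cut_nonneg {d : ℕ} (R s : ℝ) (x : V d) : 0 ≤ cut R s x := le_min (by positivity) zero_le_one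
lemma cut_le_one {d : ℕ} (R s : ℝ) (x : V d) : cut R s x ≤ 1 := min_le_right _ _
lemma cut_in {d : ℕ} {R s : ℝ} {x : V d} (h : nrm x ≤ R) : cut R s x = 0 := by
  unfold cut; rw [max_eq_right (by linarith)]; simp
lemma cut_out {d : ℕ} {R s : ℝ} (hs : 0 < s) {x : V d} (h : R + s ≤ nrm x) : cut R s x = 1 := by
  unfold cut
  apply min_eq_right
  rw [one_le_div (by positivity), max_eq_left (by linarith)]
  gcongr; linarith

lemma Lap_cut_far {d : ℕ} {R s : ℝ} (hd : 0 < d) (hs : 0 < s) {x : V d} (h : nrm x < R - 1 ∨ R + s < nrm x) : Lap (cut R s) x ≤ 0 := by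
  rcases h with h | h
  · have := Lap_le_of_touch (cut R s) (fun _ => 0) x (fun e he => ?_) (cut_in (by linarith))
    · rwa [Lap_const hd] at this
    · rw [cut_in]; have := nrm_add_unit x he; linarith
  · have := Lap_le_of_touch (cut R s) (fun _ => 1) x (fun e he => cut_le_one _ _ _) (cut_out hs h.le)
    rwa [Lap_const hd] at this

lemma Lap_quad {d : ℕ} (hd : 0 < d) (t b : ℝ) (x y : V d) :
    Lap (fun y => (1 - t) * nsq y + t * nsq (y - x) + b) y = 1 := by
  have h1 := Lap_add (fun y => (1 - t) * nsq y + t * nsq (y - x)) (fun _ => b) y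
  have h2 := Lap_add (fun y => (1 - t) * nsq y) (fun y => t * nsq (y - x)) y
  have h3 := Lap_smul (1 - t) nsq y
  have h4 := Lap_smul t (fun y => nsq (y - x)) y
  have h5 := Lap_translate nsq x y
  rw [Lap_nsq hd] at h3 h5
  rw [h5] at h4
  rw [h1, h2, h3, h4, Lap_const hd]; ring

lemma nsq_sub_ge {d : ℕ} (x y : V d) : (nrm y - nrm x) ^ 2 ≤ nsq (y - x) := by
  rw [← nrm_sq]
  apply sq_le_sq'
  · have := nrm_le_sub x y; rw [nrm_sub_comm] at this; linarith
  · have := nrm_le_sub y x; linarith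

lemma Lap_cut {d : ℕ} {R s : ℝ} (hd : 0 < d) (hs : 0 < s) (hR : 0 < R) (x : V d) : Lap (cut R s) x ≤ 1 / s ^ 2 := by
  by_cases hbig : R + s < nrm x
  · exact (Lap_cut_far hd hs (Or.inr hbig)).trans (by positivity)
  push Not at hbig
  -- choose the projection parameter
  obtain ⟨t, ht0, ht1, hpt, htch⟩ : ∃ t : ℝ, 0 ≤ t ∧ t ≤ 1 ∧ t * nrm x ≤ R ∧ max (nrm x - R) 0 = (1 - t) * nrm x := by
    by_cases h : nrm x ≤ R
    · exact ⟨1, by norm_num, le_refl _, by linarith, by rw [max_eq_right (by linarith)]; ring⟩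
    · push Not at h
      have hx : 0 < nrm x := by linarith
      refine ⟨R / nrm x, by positivity, by rw [div_le_one hx]; linarith, by field_simp; exact le_refl _, ?_⟩
      rw [max_eq_left (by linarith)]; field_simp
  have e := Lap_smul (1 / s ^ 2) (fun y => (1 - t) * nsq y + t * nsq (y - x) + -(t * (1 - t) * nsq x)) x
  rw [Lap_quad hd, mul_one] at e
  rw [← e]
  have hq : ∀ y : V d, (nrm y - t * nrm x) ^ 2 ≤ (1 - t) * nsq y + t * nsq (y - x) + -(t * (1 - t) * nsq x) := by
    intro y
    have h1 := mul_le_mul_of_nonneg_left (nsq_sub_ge x y) ht0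
    have h2 := nrm_sq x
    have h3 := nrm_sq y
    rw [← h2, ← h3]
    nlinarith
  apply Lap_le_of_touch
  · intro e he
    refine (min_le_left _ _).trans ?_
    rw [div_eq_inv_mul, one_div]
    gcongr
    refine le_trans ?_ (hq (x + e))
    by_cases hc : nrm (x + e) ≤ R
    · rw [max_eq_right (by linarith)]
      simpa using sq_nonneg (nrm (x + e) - t * nrm x)
    · push Not at hc
      rw [max_eq_left (by linarith)]
      apply sq_le_sq' <;> linarith
  · unfold cut
    rw [htch, min_eq_left]
    · have : nsq (x - x) = 0 := by rw [sub_self, ← nrm_sq, nrm_zero]; norm_num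
      rw [this, ← nrm_sq]; ring
    · rw [← htch, div_le_one (by positivity)]
      have : max (nrm x - R) 0 ≤ s := max_le (by linarith) hs.le
      gcongr

lemma card_ball {d : ℕ} (r : ℝ) (hr : 0 ≤ r) : ((ball d r).card : ℝ) ≤ (2 * r + 3) ^ d := by
  have h1 : (ball d r).card ≤ (Finset.Icc (fun _ => -⌈r⌉ : V d) (fun _ => ⌈r⌉)).card := by
    unfold ball; exact Finset.card_filter_le _ _
  rw [Pi.card_Icc] at h1
  simp only [Int.card_Icc, Finset.prod_const, Finset.card_univ, Fintype.card_fin] at h1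
  have h0 : 0 ≤ ⌈r⌉ := Int.ceil_nonneg hr
  have h2 : (((⌈r⌉ + 1 - -⌈r⌉).toNat : ℤ) : ℝ) ≤ 2 * r + 3 := by
    rw [Int.toNat_of_nonneg (by omega)]
    push_cast
    have := (Int.ceil_lt_add_one r).le
    linarith
  calc ((ball d r).card : ℝ) ≤ (((⌈r⌉ + 1 - -⌈r⌉).toNat ^ d : ℕ) : ℝ) := by exact_mod_cast h1
    _ ≤ _ := by
      push_cast
      gcongr
      exact_mod_cast h2

lemma half_count (T : Finset ℤ) (L : ℝ) (hL : 0 ≤ L) (h0 : ∀ t ∈ T, 0 ≤ t)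
    (h : ∀ t ∈ T, ∀ t' ∈ T, (t : ℝ) ^ 2 - (t' : ℝ) ^ 2 ≤ L) : (T.card : ℝ) ≤ Real.sqrt L + 1 := by
  have hsq := Real.sqrt_nonneg L
  rcases T.eq_empty_or_nonempty with he | hne
  · rw [he]; simp; positivity
  · set m := T.min' hne
    have hm := T.min'_mem hne
    have hsub : T ⊆ Finset.Icc m (m + ⌊Real.sqrt L⌋) := by
      intro t ht
      have h1 : m ≤ t := T.min'_le t ht
      rw [Finset.mem_Icc]
      refine ⟨h1, ?_⟩
      have h2 := h t ht m hm
      have h3 : ((t - m : ℤ) : ℝ) ≤ Real.sqrt L := by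
        apply Real.le_sqrt_of_sq_le
        push_cast
        have h4 : (m : ℝ) ≤ t := by exact_mod_cast h1
        have h5 : (0 : ℝ) ≤ m := by exact_mod_cast h0 m hm
        nlinarith
      have := Int.le_floor.2 h3
      omega
    have hc := Finset.card_le_card hsub
    rw [Int.card_Icc] at hc
    have h0 : 0 ≤ ⌊Real.sqrt L⌋ := Int.floor_nonneg.2 hsq
    have hc' : (T.card : ℤ) ≤ ⌊Real.sqrt L⌋ + 1 := by omega
    have : (T.card : ℝ) ≤ ((⌊Real.sqrt L⌋ + 1 : ℤ) : ℝ) := by exact_mod_cast hc'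
    push_cast at this
    have := Int.floor_le (Real.sqrt L)
    linarith

lemma int_count (T : Finset ℤ) (L : ℝ) (hL : 0 ≤ L)
    (h : ∀ t ∈ T, ∀ t' ∈ T, (t : ℝ) ^ 2 - (t' : ℝ) ^ 2 ≤ L) : (T.card : ℝ) ≤ 2 * (Real.sqrt L + 1) := by
  classical
  have e := Finset.card_filter_add_card_filter_not (s := T) (fun t => 0 ≤ t)
  have h1 := half_count (T.filter (fun t => 0 ≤ t)) L hL (fun t ht => (Finset.mem_filter.1 ht).2)
    (fun t ht t' ht' => h t (Finset.mem_filter.1 ht).1 t' (Finset.mem_filter.1 ht').1)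
  have h2 := half_count ((T.filter (fun t => ¬ 0 ≤ t)).image (fun t => -t)) L hL
    (fun t ht => by
      obtain ⟨u, hu, rfl⟩ := Finset.mem_image.1 ht
      have := (Finset.mem_filter.1 hu).2
      omega)
    (fun t ht t' ht' => by
      obtain ⟨u, hu, rfl⟩ := Finset.mem_image.1 ht
      obtain ⟨u', hu', rfl⟩ := Finset.mem_image.1 ht'
      have := h u (Finset.mem_filter.1 hu).1 u' (Finset.mem_filter.1 hu').1
      push_cast
      simpa using this)
  rw [Finset.card_image_of_injective _ neg_injective] at h2
  have e' : (((T.filter (fun t => 0 ≤ t)).card : ℝ)) + ((T.filter (fun t => ¬ 0 ≤ t)).card : ℝ) = T.card := by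
    exact_mod_cast e
  linarith

lemma shell_count {d : ℕ} (hd : 2 ≤ d) (T : Finset (V d)) (r1 r2 : ℝ) (h12 : r1 ≤ r2) (hr1 : 0 ≤ r1)
    (hT : ∀ x ∈ T, r1 ≤ nrm x ∧ nrm x ≤ r2) :
    (T.card : ℝ) ≤ 2 * (Real.sqrt (r2 ^ 2 - r1 ^ 2) + 1) * (2 * r2 + 3) ^ (d - 1) := by
  classical
  let i0 : Fin d := ⟨0, by omega⟩
  have hL : 0 ≤ r2 ^ 2 - r1 ^ 2 := by nlinarith
  let f : V d → V d := fun x => Function.update x i0 0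
  set B : ℝ := 2 * (Real.sqrt (r2 ^ 2 - r1 ^ 2) + 1) with hB
  have hB0 : 0 ≤ B := by rw [hB]; positivity
  have hfib : ∀ a ∈ T.image f, (T.filter (fun x => f x = a)).card ≤ ⌊B⌋₊ := by
    intro a _
    apply Nat.le_floor
    have hinj : Set.InjOn (fun x : V d => x i0) (T.filter (fun x => f x = a) : Finset (V d)) := by
      intro x hx y hy hxy
      have hx' := (Finset.mem_filter.1 hx).2
      have hy' := (Finset.mem_filter.1 hy).2
      ext i
      by_cases hi : i = i0
      · rw [hi]; exact hxy
      · have := congrFun (hx'.trans hy'.symm) i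
        simpa [f, Function.update_of_ne hi] using this
    rw [← Finset.card_image_of_injOn hinj]
    apply int_count _ _ hL
    intro t ht t' ht'
    obtain ⟨x, hx, rfl⟩ := Finset.mem_image.1 ht
    obtain ⟨y, hy, rfl⟩ := Finset.mem_image.1 ht'
    have hx' := Finset.mem_filter.1 hx
    have hy' := Finset.mem_filter.1 hy
    have e : ∀ x : V d, nsq x = (x i0 : ℝ) ^ 2 + nsq (f x) := by
      intro x
      unfold nsq
      rw [← Finset.add_sum_erase _ _ (Finset.mem_univ i0), ← Finset.add_sum_erase (a := i0) (s := Finset.univ)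
        (fun i => ((f x i : ℝ)) ^ 2) (Finset.mem_univ i0)]
      have h0 : f x i0 = 0 := by simp [f]
      rw [h0]
      have : ∑ i ∈ Finset.univ.erase i0, ((x i : ℝ)) ^ 2 = ∑ i ∈ Finset.univ.erase i0, ((f x i : ℝ)) ^ 2 := by
        refine Finset.sum_congr rfl fun i hi => ?_
        simp [f, Function.update_of_ne (Finset.ne_of_mem_erase hi)]
      rw [this]; push_cast; ring
    have ex := e x
    have ey := e y
    rw [hx'.2] at ex
    rw [hy'.2] at ey
    have h1 := (hT x hx'.1).2
    have h2 := (hT y hy'.1).1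
    rw [← nrm_sq] at ex ey
    have h3 := nrm_nonneg x
    have h4 := nrm_nonneg y
    nlinarith
  have h1 := Finset.card_le_mul_card_image T _ hfib
  set M : ℤ := ⌊r2⌋ with hM
  have hM0 : 0 ≤ M := Int.floor_nonneg.2 (by linarith)
  have h2 : T.image f ⊆ Fintype.piFinset (fun i => if i = i0 then ({0} : Finset ℤ) else Finset.Icc (-M) M) := by
    intro y hy
    obtain ⟨x, hx, rfl⟩ := Finset.mem_image.1 hy
    rw [Fintype.mem_piFinset]
    intro i
    by_cases hi : i = i0
    · simp [hi, f]
    · rw [if_neg hi]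
      simp only [f, Function.update_of_ne hi, Finset.mem_Icc]
      have h3 : |(x i : ℝ)| ≤ r2 := by
        refine le_trans ?_ (hT x hx).2
        unfold nrm
        apply Real.le_sqrt_of_sq_le
        rw [sq_abs]
        exact Finset.single_le_sum (f := fun i => ((x i : ℝ)) ^ 2) (fun i _ => sq_nonneg _) (Finset.mem_univ i)
      rw [abs_le] at h3
      constructor
      · have : ((-x i : ℤ) : ℝ) ≤ r2 := by push_cast; linarith
        have := Int.le_floor.2 this
        omega
      · exact Int.le_floor.2 h3.2
  have h3 := Finset.card_le_card h2
  rw [Fintype.card_piFinset] at h3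
  have h4 : ∏ i : Fin d, (if i = i0 then ({0} : Finset ℤ) else Finset.Icc (-M) M).card = (2 * M + 1).toNat ^ (d - 1) := by
    rw [← Finset.mul_prod_erase _ _ (Finset.mem_univ i0), if_pos rfl, Finset.card_singleton, one_mul]
    rw [Finset.prod_congr rfl (g := fun _ => (2 * M + 1).toNat)]
    · rw [Finset.prod_const, Finset.card_erase_of_mem (Finset.mem_univ _)]; simp
    · intro i hi
      rw [if_neg (Finset.ne_of_mem_erase hi), Int.card_Icc]
      congr 1; ring
  rw [h4] at h3
  have h5 : (((2 * M + 1).toNat : ℕ) : ℝ) ≤ 2 * r2 + 3 := by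
    have : (((2 * M + 1).toNat : ℤ) : ℝ) = 2 * M + 1 := by
      rw [Int.toNat_of_nonneg (by omega)]; push_cast; ring
    have h6 : (((2 * M + 1).toNat : ℕ) : ℝ) = 2 * M + 1 := by exact_mod_cast this
    rw [h6]
    have := Int.floor_le r2
    linarith
  calc (T.card : ℝ) ≤ ((⌊B⌋₊ * (T.image f).card : ℕ) : ℝ) := by exact_mod_cast h1
    _ ≤ ((⌊B⌋₊ * (2 * M + 1).toNat ^ (d - 1) : ℕ) : ℝ) := by exact_mod_cast Nat.mul_le_mul_left _ h3
    _ = (⌊B⌋₊ : ℝ) * (((2 * M + 1).toNat : ℕ) : ℝ) ^ (d - 1) := by push_cast; ring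
    _ ≤ B * (2 * r2 + 3) ^ (d - 1) := by
      gcongr
      exact Nat.floor_le hB0

/-- counting the points outside -/
lemma out_count {d : ℕ} (hd : 2 ≤ d) (E S : Finset (V d)) (U : V d → ℝ) (a R s η M : ℝ) (hU0 : ∀ x, 0 ≤ U x)
    (hs : 0 < s) (hR : 1 ≤ R) (hSR : ∀ x ∈ S, nrm x ≤ R) 
    (hUM : ∀ x ∈ E, R - 1 ≤ nrm x → nrm x ≤ R + s → U x ≤ M) (hM : 0 ≤ M)
    (hη : ∑ x ∈ E, cut R s x - a * ∑ x ∈ S, cut R s x - ∑ x ∈ E, U x * Lap (cut R s) x ≤ η) :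
    ((E.filter (fun x => R + s < nrm x)).card : ℝ) ≤ η + 
      2 * (Real.sqrt ((R + s) ^ 2 - (R - 1) ^ 2) + 1) * (2 * (R + s) + 3) ^ (d - 1) * (M / s ^ 2) := by
  classical
  have hd0 : 0 < d := by omega
  have h1 : ((E.filter (fun x => R + s < nrm x)).card : ℝ) ≤ ∑ x ∈ E, cut R s x := by
    have : ((E.filter (fun x => R + s < nrm x)).card : ℝ) = ∑ x ∈ E.filter (fun x => R + s < nrm x), cut R s x := by
      rw [Finset.sum_congr rfl (g := fun _ => (1:ℝ))]
      · simp
      · intro x hx; exact cut_out hs (Finset.mem_filter.1 hx).2.le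
    rw [this]
    exact Finset.sum_le_sum_of_subset_of_nonneg (Finset.filter_subset _ _) (fun x _ _ => cut_nonneg _ _ _)
  have h2 : ∑ x ∈ S, cut R s x = 0 := Finset.sum_eq_zero fun x hx => cut_in (hSR x hx)
  rw [h2, mul_zero, sub_zero] at hη
  set Q := E.filter (fun x => R - 1 ≤ nrm x ∧ nrm x ≤ R + s) with hQ
  have h3 : ∑ x ∈ E, U x * Lap (cut R s) x ≤ ∑ x ∈ Q, M / s ^ 2 := by
    rw [hQ, Finset.sum_filter]
    refine Finset.sum_le_sum fun x hx => ?_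
    split_ifs with h
    · calc U x * Lap (cut R s) x ≤ U x * (1 / s ^ 2) := by
            have := hU0 x
            gcongr
            exact Lap_cut hd0 hs (by linarith) x
        _ ≤ M * (1 / s ^ 2) := by gcongr; exact hUM x hx h.1 h.2
        _ = _ := by ring
    · apply mul_nonpos_of_nonneg_of_nonpos (hU0 x)
      apply Lap_cut_far hd0 hs
      by_contra hcon
      push Not at hcon
      exact h hcon
  have h4 := shell_count hd Q (R - 1) (R + s) (by linarith) (by linarith) (fun x hx => (Finset.mem_filter.1 hx).2)
  rw [Finset.sum_const, nsmul_eq_mul] at h3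
  have h5 : (Q.card : ℝ) * (M / s ^ 2) ≤ _ * (M / s ^ 2) := mul_le_mul_of_nonneg_right h4 (by positivity)
  linarith

end

end UI

namespace UI
noncomputable section

lemma qv_le {d : ℕ} (S : Finset (V d)) (hS : S.Nonempty) (s : ℕ → ℝ) (k : ℕ) (hk : k ≤ S.card) (g : V d → ℝ) (Q : ℝ) (hQ : 0 ≤ Q)
    (h : ∀ j < k, EA (agg S s j) (fun x => g x ^ 2) ≤ Q) : qv S s k g ≤ Q / S.card := by
  have hm : 0 < (S.card : ℝ) := by exact_mod_cast hS.card_pos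
  have h1 : ∀ j ∈ Finset.range k, (1 / (((agg S s j).card : ℝ) + 1)) ^ 2 * EA (agg S s j) (fun x => g x ^ 2) ≤ (1 / (S.card : ℝ)) ^ 2 * Q := by
    intro j hj
    have h2 : (S.card : ℝ) ≤ ((agg S s j).card : ℝ) + 1 := by
      have : (S.card : ℝ) ≤ ((agg S s j).card : ℝ) := by exact_mod_cast Finset.card_le_card (agg_mono S s (Nat.zero_le j))
      linarith
    have h3 := h j (Finset.mem_range.1 hj)
    have h4 : (1 / (((agg S s j).card : ℝ) + 1)) ^ 2 ≤ (1 / (S.card : ℝ)) ^ 2 := by gcongr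
    calc _ ≤ (1 / (((agg S s j).card : ℝ) + 1)) ^ 2 * Q := by gcongr
      _ ≤ _ := by gcongr
  unfold qv
  refine (Finset.sum_le_sum h1).trans ?_
  rw [Finset.sum_const, Finset.card_range, nsmul_eq_mul]
  have : (k : ℝ) ≤ S.card := by exact_mod_cast hk
  calc (k : ℝ) * ((1 / (S.card : ℝ)) ^ 2 * Q) ≤ S.card * ((1 / (S.card : ℝ)) ^ 2 * Q) := by gcongr
    _ = _ := by field_simp

/-- scaled noise bound off the exceptional event -/
lemma noise_scaled {m k θ N q lam Q : ℝ} (hm : 0 < m) (hk0 : 0 ≤ k) (hk : k ≤ m) (hθ : 0 < θ) (hq : q ≤ Q / m) (hlam : 0 ≤ lam) (hQ : 0 ≤ Q)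
    (h : θ * N - θ ^ 2 * q < lam) : (m + k) * N ≤ 2 * (lam * (m / θ) + θ * Q) := by
  have h1 : θ * N ≤ lam + θ ^ 2 * (Q / m) := by
    have : θ ^ 2 * q ≤ θ ^ 2 * (Q / m) := by gcongr
    linarith
  have h2 : N ≤ lam / θ + θ * (Q / m) := by
    have e : lam / θ + θ * (Q / m) = (lam + θ ^ 2 * (Q / m)) / θ := by field_simp
    rw [e, le_div_iff₀ hθ]; linarith
  calc (m + k) * N ≤ (m + k) * (lam / θ + θ * (Q / m)) := by gcongr
    _ ≤ (2 * m) * (lam / θ + θ * (Q / m)) := by gcongr; linarith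
    _ = _ := by field_simp

lemma EA_green {d : ℕ} (hd : 0 < d) (A D : Finset (V d)) (hA : A.Nonempty) (hAD : A ⊆ D) (m G Z : ℝ) (hm : 0 < m) (hmA : m ≤ A.card)
    (z : V d) (g : V d → ℝ) (h1 : ∀ x ∈ D, x ≠ z → Lap g x = 0) (h2 : Lap g z = -1) (h0 : ∀ x, 0 ≤ g x) (hG : ∀ x, g x ≤ G)
    (hZ : ∑ x ∈ D, g x ≤ Z) : EA A (fun x => g x ^ 2) ≤ G * (Z / m) := by
  have hG0 : 0 ≤ G := (h0 z).trans (hG z)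
  have a1 : EA A (fun x => g x ^ 2) ≤ G * EA A g := by
    rw [← EA_smul hd]
    apply EA_mono hd
    intro x _
    have := h0 x
    have := hG x
    nlinarith
  have a2 : EA A g ≤ (∑ x ∈ A, g x) / A.card := by
    rw [EA_eq hd A hA]
    have : ∑ x ∈ A, vA A x * Lap g x ≤ 0 := by
      refine Finset.sum_nonpos fun x hx => mul_nonpos_of_nonneg_of_nonpos (vA_nonneg hd _ _) ?_
      by_cases hxz : x = z
      · rw [hxz, h2]; norm_num
      · rw [h1 x (hAD hx) hxz]
    linarith
  have a3 : ∑ x ∈ A, g x ≤ Z := (Finset.sum_le_sum_of_subset_of_nonneg hAD fun x _ _ => h0 x).trans hZ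
  have a4 : 0 ≤ ∑ x ∈ A, g x := Finset.sum_nonneg fun x _ => h0 x
  refine a1.trans ?_
  gcongr
  refine a2.trans ?_
  exact div_le_div₀ (by linarith) a3 hm hmA

set_option maxHeartbeats 2000000 in
lemma one_step {d : ℕ} (hd : 2 ≤ d) : ∃ K1 K0 CW n0 : ℝ, 0 < K1 ∧ 0 < K0 ∧ 0 < CW ∧ 1 ≤ n0 ∧
    ∀ (n t w1 ρ1 r G κ σ R ρ2 w2 : ℝ) (S : Finset (V d)) (k : ℕ), n0 ≤ n → S.Nonempty → S ⊆ ball d n → k ≤ S.card → 0 < t →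
      1 ≤ w1 → cd d ≤ ρ1 ^ 2 → 1 ≤ ρ1 → K1 * (ρ1 ^ 2 * Real.log (ρ1 ^ 2 + 9 * w1 ^ 2)) ≤ w1 ^ 2 → 2 * (S.card : ℝ) ≤ ρ1 ^ d →
      r = n + (t + 1) * w1 →
      G = K0 * Real.log (cd d + 9 * r ^ 2) → G ≤ n →
      κ = 2 * (t * n + G * (r + 1) ^ 2 / n) → 1 ≤ σ → σ ≤ n →
      R = (n + 3) * (((S.card : ℝ) + k) / S.card) ^ ((1:ℝ)/d) →
      2 * (t * Real.sqrt n + S.card / Real.sqrt n) + 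
        2 * (Real.sqrt ((R + σ) ^ 2 - (R - 1) ^ 2) + 1) * (2 * (R + σ) + 3) ^ (d - 1) * ((CW * σ ^ 2 + 2 * κ) / σ ^ 2) ≤ ρ2 ^ d →
      1 ≤ w2 → cd d ≤ ρ2 ^ 2 → 1 ≤ ρ2 → K1 * (ρ2 ^ 2 * Real.log (ρ2 ^ 2 + 9 * w2 ^ 2)) ≤ w2 ^ 2 →
      P {s | ¬ agg S s k ⊆ ball d (R + σ + (t + 1) * w2)} ≤
        ENNReal.ofReal ((2 * (S.card * Real.exp 40) + 2 * (2 * r + 3) ^ d + 1) * Real.exp (-t)) := by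
  classical
  have hd0 : 0 < d := by omega
  obtain ⟨K1, hK1, hT⟩ := tent_prob hd
  obtain ⟨K0, hK0, hGr⟩ := green hd
  obtain ⟨CW, n0, hCW, hn0, hOb⟩ := obstacle hd
  refine ⟨K1, K0, CW, n0, hK1, hK0, hCW, hn0, ?_⟩
  intro n t w1 ρ1 r G κ σ R ρ2 w2 S k hn hS hSn hk ht hw1 hρ1c hρ1 hK1t hm2 hr hG hGn hκ hσ hσn hR hcount hw2 hρ2c hρ2 hK2t
  have hn1 : 1 ≤ n := hn0.trans hn
  have hm : 0 < (S.card : ℝ) := by exact_mod_cast hS.card_pos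
  have hkm : (k : ℝ) ≤ S.card := by exact_mod_cast hk
  have hk0 : (0 : ℝ) ≤ k := Nat.cast_nonneg k
  have hr1 : 1 ≤ r := by rw [hr]; nlinarith
  set m : ℝ := (S.card : ℝ) with hmdef
  set a : ℝ := (m + k) / m with ha
  have ha1 : 1 ≤ a := by rw [ha, one_le_div hm]; linarith
  have ha2 : a ≤ 2 := by rw [ha, div_le_iff₀ hm]; linarith
  have haR : 1 ≤ a ^ ((1:ℝ)/d) := Real.one_le_rpow ha1 (by positivity)
  have hRn : n + 3 ≤ R := by rw [hR]; nlinarith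
  obtain ⟨W, hW0, hWn, hW1, hWs⟩ := hOb n a hn ha1 ha2
  set D := ball d r with hD
  choose! gz g1 g2 g3 g4 g5 g6 using hGr r hr1
  -- events
  set B1 := {s | (((agg S s k).filter (fun y => n < nrm y)).card : ℝ) ≤ ρ1 ^ d ∧ ¬ agg S s k ⊆ ball d (n + (t + 1) * w1)}
  set Bp := fun z => {s | t ≤ (m / n) * noise S s k (gz z) - (m / n) ^ 2 * qv S s k (gz z)}
  set Bm := fun z => {s | t ≤ (-(m / n)) * noise S s k (gz z) - (-(m / n)) ^ 2 * qv S s k (gz z)}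
  set B3 := {s | t ≤ (m / Real.sqrt n) * noise S s k (cut R σ) - (m / Real.sqrt n) ^ 2 * qv S s k (cut R σ)}
  set B4 := {s | (((agg S s k).filter (fun y => R + σ < nrm y)).card : ℝ) ≤ ρ2 ^ d ∧ ¬ agg S s k ⊆ ball d (R + σ + (t + 1) * w2)}
  set B0 := {s | ¬ ∀ k, newPt (agg S s k) (s k) ∉ agg S s k}
  have pos_n : 0 < n := by linarith
  have hsq : 1 ≤ Real.sqrt n := Real.one_le_sqrt.2 hn1
  have p0 : P B0 = 0 := ae_iff.1 (newPt_chain_ae hd0 S hS)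
  have p1 : P B1 ≤ ENNReal.ofReal (m * Real.exp 40 * Real.exp (-t)) := hT S n w1 ρ1 t k hS hSn hk hw1 hρ1c hρ1 hK1t
  have hGpos : 0 ≤ G := by
    rw [hG]; exact mul_nonneg hK0.le (Real.log_nonneg (by nlinarith [cd_ge d]))
  have p2 : ∀ z ∈ D, P (Bp z) ≤ ENNReal.ofReal (Real.exp (-t)) := by
    intro z hz
    apply noise_prob hd0 S hS (gz z) G _ t k (g4 z hz) (fun x => by rw [hG]; exact g5 z hz x)
    rw [abs_of_nonneg (by positivity)]
    calc m / n * G ≤ m / n * n := by gcongr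
      _ = m := by field_simp
  have p3 : ∀ z ∈ D, P (Bm z) ≤ ENNReal.ofReal (Real.exp (-t)) := by
    intro z hz
    apply noise_prob hd0 S hS (gz z) G _ t k (g4 z hz) (fun x => by rw [hG]; exact g5 z hz x)
    rw [abs_neg, abs_of_nonneg (by positivity)]
    calc m / n * G ≤ m / n * n := by gcongr
      _ = m := by field_simp
  have p4 : P B3 ≤ ENNReal.ofReal (Real.exp (-t)) := by
    apply noise_prob hd0 S hS (cut R σ) 1 _ t k (cut_nonneg R σ) (cut_le_one R σ)
    rw [abs_of_nonneg (by positivity), mul_one]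
    exact div_le_self hm.le hsq
  have hSR : S ⊆ ball d (R + σ) := by
    intro x hx
    have := (mem_ball n x).1 (hSn hx)
    rw [mem_ball]; linarith
  have p5 : P B4 ≤ ENNReal.ofReal (m * Real.exp 40 * Real.exp (-t)) := hT S (R + σ) w2 ρ2 t k hS hSR hk hw2 hρ2c hρ2 hK2t
  have hsub : {s | ¬ agg S s k ⊆ ball d (R + σ + (t + 1) * w2)} ⊆ B0 ∪ (B1 ∪ ((⋃ z ∈ D, Bp z) ∪ ((⋃ z ∈ D, Bm z) ∪ (B3 ∪ B4)))) := by
    intro s hs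
    by_contra hcon
    simp only [Set.mem_union, Set.mem_iUnion, not_or, not_exists] at hcon
    obtain ⟨c0, c1, c2, c3, c5, c6⟩ := hcon
    have c0' : ∀ k, newPt (agg S s k) (s k) ∉ agg S s k := by
      by_contra h; exact c0 h
    apply c6
    refine ⟨?_, hs⟩
    have hcard : ((agg S s k).card : ℝ) = m + k := by rw [card_agg S s c0' k]; push_cast; rfl
    have hED : agg S s k ⊆ D := by
      by_contra h
      apply c1
      refine ⟨?_, by rw [← hr]; exact h⟩
      have : (((agg S s k).filter (fun y => n < nrm y)).card : ℝ) ≤ (agg S s k).card := by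
        exact_mod_cast Finset.card_filter_le _ _
      linarith
    obtain ⟨U, U0, U1, U2⟩ := noise_id hd0 S hS s c0' k
    have hSE : S ⊆ agg S s k := agg_mono S s (Nat.zero_le k)
    have hκ0 : 0 ≤ κ := by rw [hκ]; positivity
    have hUW := det_U hd0 D (agg S s k) S hSE hED U W a κ U1 hW0 (fun x hx => hWn x ((mem_ball n x).1 (hSn hx))) hW1 hκ0 (by
      intro z hz
      refine ⟨gz z, g1 z hz, g2 z hz, g3 z hz, ?_⟩
      rw [← U2 (gz z)]
      have hQ : qv S s k (gz z) ≤ (G * ((r + 1) ^ 2 / m)) / m := by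
        apply qv_le S hS s k hk _ _ (by positivity)
        intro j hj
        apply EA_green hd0 (agg S s j) D (agg_nonempty S hS s j) ((agg_mono S s hj.le).trans hED) m G _ hm
          (Nat.cast_le.2 (Finset.card_le_card (agg_mono S s (Nat.zero_le j)))) z (gz z) (g1 z hz) (g2 z hz) (g4 z hz)
          (fun x => by rw [hG]; exact g5 z hz x) (g6 z hz)
      have eκ' : ∀ N : ℝ, m / n * N - (m / n) ^ 2 * qv S s k (gz z) < t → (m + k) * N ≤ κ := by
        intro N hN
        have := noise_scaled (N := N) hm hk0 hkm (θ := m / n) (by positivity) hQ ht.le (by positivity) hN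
        have e1 : m / (m / n) = n := by field_simp
        have e2 : m / n * (G * ((r + 1) ^ 2 / m)) = G * (r + 1) ^ 2 / n := by field_simp
        rw [e1, e2, ← hκ] at this
        exact this
      rw [abs_le]
      constructor
      · have h1 := c3 z hz
        have h2 : m / n * (-noise S s k (gz z)) - (m / n) ^ 2 * qv S s k (gz z) < t := by
          have : ¬ t ≤ (-(m / n)) * noise S s k (gz z) - (-(m / n)) ^ 2 * qv S s k (gz z) := h1
          push Not at this
          calc _ = (-(m / n)) * noise S s k (gz z) - (-(m / n)) ^ 2 * qv S s k (gz z) := by ring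
            _ < t := this
        have := eκ' _ h2
        linarith
      · have h1 : ¬ t ≤ (m / n) * noise S s k (gz z) - (m / n) ^ 2 * qv S s k (gz z) := c2 z hz
        push Not at h1
        exact eκ' _ h1)
    refine le_trans ?_ hcount
    apply out_count hd (agg S s k) S U a R σ _ _ U0 (by linarith) (by linarith)
      (fun x hx => by have := (mem_ball n x).1 (hSn hx); linarith)
    · intro x hx h1 h2
      have h3 := hUW x hx
      have h4 := hWs σ hσ hσn x (by rw [← hR]; exact h1) (by rw [← hR]; exact h2)
      linarith
    · positivity
    · rw [← U2 (cut R σ)]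
      have hQ : qv S s k (cut R σ) ≤ 1 / m := by
        apply qv_le S hS s k hk _ _ (by norm_num)
        intro j hj
        rw [← EA_const hd0 (agg S s j) (agg_nonempty S hS s j) 1]
        apply EA_mono hd0
        intro x _
        exact pow_le_one₀ (cut_nonneg R σ x) (cut_le_one R σ x)
      have h1 : ¬ t ≤ (m / Real.sqrt n) * noise S s k (cut R σ) - (m / Real.sqrt n) ^ 2 * qv S s k (cut R σ) := c5
      push Not at h1
      have h2 := noise_scaled hm hk0 hkm (θ := m / Real.sqrt n) (by positivity) hQ ht.le (by norm_num) h1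
      have e1 : m / (m / Real.sqrt n) = Real.sqrt n := by field_simp
      rw [e1, mul_one] at h2
      exact h2
  have hDc : (D.card : ℝ) ≤ (2 * r + 3) ^ d := card_ball r (by linarith)
  have hun : ∀ B : V d → Set (ℕ → ℝ), (∀ z ∈ D, P (B z) ≤ ENNReal.ofReal (Real.exp (-t))) →
      P (⋃ z ∈ D, B z) ≤ ENNReal.ofReal ((2 * r + 3) ^ d * Real.exp (-t)) := by
    intro B hB
    refine (measure_biUnion_finset_le D B).trans ?_
    refine (Finset.sum_le_sum hB).trans ?_
    rw [Finset.sum_const, nsmul_eq_mul, ← ENNReal.ofReal_natCast, ← ENNReal.ofReal_mul (by positivity)]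
    apply ENNReal.ofReal_le_ofReal
    gcongr
  have e0 := Real.exp_pos (-t)
  have hr3 : 0 ≤ (2 * r + 3) ^ d := by positivity
  calc P {s | ¬ agg S s k ⊆ ball d (R + σ + (t + 1) * w2)} 
      ≤ P (B0 ∪ (B1 ∪ ((⋃ z ∈ D, Bp z) ∪ ((⋃ z ∈ D, Bm z) ∪ (B3 ∪ B4))))) := measure_mono hsub
    _ ≤ P B0 + (P B1 + (P (⋃ z ∈ D, Bp z) + (P (⋃ z ∈ D, Bm z) + (P B3 + P B4)))) := by
      refine (measure_union_le _ _).trans (add_le_add le_rfl ?_)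
      refine (measure_union_le _ _).trans (add_le_add le_rfl ?_)
      refine (measure_union_le _ _).trans (add_le_add le_rfl ?_)
      refine (measure_union_le _ _).trans (add_le_add le_rfl ?_)
      exact measure_union_le _ _
    _ ≤ 0 + (ENNReal.ofReal (m * Real.exp 40 * Real.exp (-t)) + (ENNReal.ofReal ((2 * r + 3) ^ d * Real.exp (-t)) +
        (ENNReal.ofReal ((2 * r + 3) ^ d * Real.exp (-t)) + (ENNReal.ofReal (Real.exp (-t)) + ENNReal.ofReal (m * Real.exp 40 * Real.exp (-t)))))) := by
      rw [p0]
      exact add_le_add le_rfl (add_le_add p1 (add_le_add (hun Bp p2) (add_le_add (hun Bm p3) (add_le_add p4 p5))))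
    _ = _ := by
      rw [zero_add, ← ENNReal.ofReal_add (by positivity) (by positivity), ← ENNReal.ofReal_add (by positivity) (by positivity),
        ← ENNReal.ofReal_add (by positivity) (by positivity), ← ENNReal.ofReal_add (by positivity) (by positivity)]
      congr 1; ring

end

end UI

namespace UI
noncomputable section

lemma log_ev (K C0 : ℝ) (hC : 0 < C0) (M : ℕ) : ∀ᶠ t : ℝ in atTop, K * Real.log (C0 * t ^ M) ≤ t := by
  have h1 : Tendsto (fun t : ℝ => K * (Real.log C0 + M * Real.log t) / t) atTop (nhds 0) := by
    have a1 : Tendsto (fun t : ℝ => Real.log t / t) atTop (nhds 0) := by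
      have := Real.isLittleO_log_id_atTop.tendsto_div_nhds_zero
      simpa using this
    have a2 : Tendsto (fun t : ℝ => K * Real.log C0 * t⁻¹ + K * M * (Real.log t / t)) atTop (nhds (K * Real.log C0 * 0 + K * M * 0)) :=
      (tendsto_inv_atTop_zero.const_mul _).add (a1.const_mul _)
    simp only [mul_zero, add_zero] at a2
    refine a2.congr fun t => ?_
    ring
  filter_upwards [h1.eventually (eventually_le_nhds (show (0:ℝ) < 1 by norm_num)), eventually_gt_atTop 0] with t h2 h3
  rw [div_le_one h3] at h2
  rwa [Real.log_mul hC.ne' (by positivity), Real.log_pow]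

set_option maxHeartbeats 1000000 in
/-- the arithmetic of the counting condition -/
lemma count_arith {d : ℕ} (hd : 2 ≤ d) (t u n m R σ κ CW : ℝ) (ht : 21 ^ d + 2 + 2 * 5 ^ d + 100 + CW ≤ t) (hCW : 0 < CW) (hu : u = t ^ (25 * d))
    (hn : n = u ^ 4) (hm0 : 0 ≤ m) (hm : m ≤ (5 * n) ^ d) (hR1 : 1 ≤ R) (hR : R ≤ 8 * n) (hσ : σ = u ^ 2 * t ^ 4) (hσn : σ ≤ n) (hκ : κ ≤ n * t ^ 6) :
    2 * (t * Real.sqrt n + m / Real.sqrt n) + 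
        2 * (Real.sqrt ((R + σ) ^ 2 - (R - 1) ^ 2) + 1) * (2 * (R + σ) + 3) ^ (d - 1) * ((CW * σ ^ 2 + 2 * κ) / σ ^ 2)
      ≤ (n / t ^ 23) ^ d := by
  have p21 : (0:ℝ) < 21 ^ d := by positivity
  have p5 : (0:ℝ) < 5 ^ d := by positivity
  have ht1 : 100 ≤ t := by linarith
  have ht0 : 0 < t := by linarith
  have hut : t ^ 50 ≤ u := by
    rw [hu]; exact pow_le_pow_right₀ (by linarith) (by omega)
  have htu : t ≤ u := le_trans (by nth_rewrite 1 [← pow_one t]; exact pow_le_pow_right₀ (by linarith) (by norm_num)) hut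
  have hu1 : 1 ≤ u := by linarith
  have hu0 : 0 < u := by linarith
  have hn1 : 1 ≤ n := by rw [hn]; exact one_le_pow₀ hu1
  have hn0 : 0 < n := by linarith
  have hsq : Real.sqrt n = u ^ 2 := by
    rw [hn, show u ^ 4 = (u ^ 2) ^ 2 by ring]; exact Real.sqrt_sq (by positivity)
  have hσ1 : 1 ≤ σ := by rw [hσ]; exact one_le_mul_of_one_le_of_one_le (one_le_pow₀ hu1) (one_le_pow₀ (by linarith))
  -- sqrt bound
  have b1 : Real.sqrt ((R + σ) ^ 2 - (R - 1) ^ 2) + 1 ≤ 7 * (u ^ 3 * t ^ 2) := by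
    have c1 : Real.sqrt ((R + σ) ^ 2 - (R - 1) ^ 2) ≤ 6 * (u ^ 3 * t ^ 2) := by
      apply Real.sqrt_le_left (by positivity) |>.mpr
      have c2 : (R + σ) ^ 2 - (R - 1) ^ 2 = (σ + 1) * (2 * R + σ - 1) := by ring
      have c3 : (σ + 1) * (2 * R + σ - 1) ≤ (2 * σ) * (17 * n) := by
        apply mul_le_mul <;> nlinarith
      have c4 : (2 * σ) * (17 * n) = 34 * (u ^ 3 * t ^ 2) ^ 2 := by rw [hσ, hn]; ring
      rw [c2]
      have : 0 ≤ (u ^ 3 * t ^ 2) ^ 2 := by positivity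
      nlinarith
    have : 1 ≤ u ^ 3 * t ^ 2 := one_le_mul_of_one_le_of_one_le (one_le_pow₀ hu1) (one_le_pow₀ (by linarith))
    linarith
  have b2 : (2 * (R + σ) + 3) ^ (d - 1) ≤ (21 * n) ^ (d - 1) := by
    gcongr
    linarith
  have b3 : (CW * σ ^ 2 + 2 * κ) / σ ^ 2 ≤ t := by
    rw [div_le_iff₀ (by positivity)]
    have e : σ ^ 2 = (n * t ^ 6) * t ^ 2 := by rw [hσ, hn]; ring
    have e2 : n * t ^ 6 ≤ σ ^ 2 := by
      rw [e]; exact le_mul_of_one_le_right (by positivity) (one_le_pow₀ (by linarith))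
    have : 0 ≤ σ ^ 2 := by positivity
    nlinarith
  have b3' : 0 ≤ t := by linarith
  have b4 : 2 * (Real.sqrt ((R + σ) ^ 2 - (R - 1) ^ 2) + 1) * (2 * (R + σ) + 3) ^ (d - 1) * ((CW * σ ^ 2 + 2 * κ) / σ ^ 2)
      ≤ 2 * (7 * (u ^ 3 * t ^ 2)) * (21 * n) ^ (d - 1) * t := by
    have : 0 ≤ 2 * (R + σ) + 3 := by linarith
    calc _ ≤ 2 * (Real.sqrt ((R + σ) ^ 2 - (R - 1) ^ 2) + 1) * (2 * (R + σ) + 3) ^ (d - 1) * t := by gcongr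
      _ ≤ _ := by gcongr
  have hnd : n ^ d = n * n ^ (d - 1) := by rw [← pow_succ']; congr 1; omega
  have h21 : (21:ℝ) ^ d = 21 * 21 ^ (d - 1) := by rw [← pow_succ']; congr 1; omega
  have b5 : 2 * (7 * (u ^ 3 * t ^ 2)) * (21 * n) ^ (d - 1) * t ≤ 21 ^ d * t ^ 3 * (n ^ d / u) := by
    have e : n ^ d / u = u ^ 3 * n ^ (d - 1) := by
      rw [hnd]
      nth_rewrite 1 [hn]
      field_simp
    rw [e, h21, mul_pow]
    have : 0 ≤ 21 ^ (d - 1) * t ^ 3 * (u ^ 3 * n ^ (d - 1)) := by positivity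
    nlinarith
  have b6 : t * Real.sqrt n ≤ n ^ d / u := by
    rw [hsq, le_div_iff₀ hu0]
    have : n ≤ n ^ d := le_self_pow₀ hn1 (by omega)
    calc t * u ^ 2 * u ≤ u * u ^ 2 * u := by gcongr
      _ = n := by rw [hn]; ring
      _ ≤ _ := this
  have b7 : m / Real.sqrt n ≤ 5 ^ d * (n ^ d / u) := by
    rw [hsq]
    calc m / u ^ 2 ≤ (5 * n) ^ d / u := by
          apply div_le_div₀ (by positivity) hm hu0
          exact le_self_pow₀ hu1 (by norm_num)
      _ = _ := by rw [mul_pow]; ring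
  have hX : 0 ≤ n ^ d / u := by positivity
  have b8 : (21 ^ d * t ^ 3 + 2 + 2 * 5 ^ d) * (n ^ d / u) ≤ t ^ 4 * (n ^ d / u) := by
    gcongr
    have : (1:ℝ) ≤ t ^ 3 := one_le_pow₀ (by linarith)
    have e : t ^ 4 = t * t ^ 3 := by ring
    rw [e]
    calc (21:ℝ) ^ d * t ^ 3 + 2 + 2 * 5 ^ d ≤ 21 ^ d * t ^ 3 + (2 + 2 * 5 ^ d) * t ^ 3 := by
          have := le_mul_of_one_le_right (show (0:ℝ) ≤ 2 + 2 * 5 ^ d by positivity) this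
          linarith
      _ = (21 ^ d + 2 + 2 * 5 ^ d) * t ^ 3 := by ring
      _ ≤ _ := mul_le_mul_of_nonneg_right (by linarith) (by positivity)
  have b9 : t ^ 4 * (n ^ d / u) ≤ (n / t ^ 23) ^ d := by
    have e : u = t ^ (23 * d) * t ^ (2 * d) := by rw [hu, ← pow_add]; congr 1; ring
    have e2 : t ^ 4 ≤ t ^ (2 * d) := pow_le_pow_right₀ (by linarith) (by omega)
    rw [div_pow, ← pow_mul, e]
    rw [mul_div_assoc', div_le_div_iff₀ (by positivity) (by positivity)]
    have hk : 0 ≤ n ^ d * t ^ (23 * d) := by positivity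
    calc t ^ 4 * n ^ d * t ^ (23 * d) = t ^ 4 * (n ^ d * t ^ (23 * d)) := by ring
      _ ≤ t ^ (2 * d) * (n ^ d * t ^ (23 * d)) := mul_le_mul_of_nonneg_right e2 hk
      _ = _ := by ring
  linarith

end

end UI

namespace UI
noncomputable section

lemma card_le5 {d : ℕ} (n : ℝ) (hn : 1 ≤ n) (S : Finset (V d)) (hS : S ⊆ ball d n) : (S.card : ℝ) ≤ (5 * n) ^ d := by
  calc (S.card : ℝ) ≤ ((ball d n).card : ℝ) := by exact_mod_cast Finset.card_le_card hS
    _ ≤ (2 * n + 3) ^ d := card_ball n (by linarith)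
    _ ≤ _ := by gcongr; linarith

lemma ball_mono {d : ℕ} {r r' : ℝ} (h : r ≤ r') : ball d r ⊆ ball d r' := by
  intro x hx
  rw [mem_ball] at hx ⊢
  linarith

lemma ratio_bd {d : ℕ} (hd : 2 ≤ d) (m k : ℝ) (hm : 0 < m) (hk0 : 0 ≤ k) (hk : k ≤ m) :
    1 ≤ ((m + k) / m) ^ ((1:ℝ) / d) ∧ ((m + k) / m) ^ ((1:ℝ) / d) ≤ 2 := by
  have hd1 : (1:ℝ) ≤ d := by exact_mod_cast (by omega : 1 ≤ d)
  have h1 : 1 ≤ (m + k) / m := by rw [le_div_iff₀ hm]; linarith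
  have h2 : (m + k) / m ≤ 2 := by rw [div_le_iff₀ hm]; linarith
  have he : (1:ℝ) / d ≤ 1 := by rw [div_le_one (by linarith)]; exact hd1
  refine ⟨Real.one_le_rpow h1 (by positivity), ?_⟩
  calc ((m + k) / m) ^ ((1:ℝ) / d) ≤ ((m + k) / m) ^ (1:ℝ) := Real.rpow_le_rpow_of_exponent_le h1 he
    _ ≤ 2 := by rw [Real.rpow_one]; exact h2

set_option maxHeartbeats 2000000 in
lemma one_scale_big {d : ℕ} (hd : 2 ≤ d) : ∃ T : ℝ, 1 ≤ T ∧ ∀ t : ℝ, T ≤ t → ∀ n : ℝ, n = t ^ (100 * d) →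
    ∀ S : Finset (V d), S.Nonempty → S ⊆ ball d n → ∀ k : ℕ, k ≤ S.card →
    P {s | ¬ agg S s k ⊆ ball d (n * (((S.card : ℝ) + k) / S.card) ^ ((1:ℝ) / d) * (1 + 2 / t ^ 20))}
      ≤ ENNReal.ofReal ((2 * Real.exp 40 + 3) * (9 * n * t ^ 2) ^ d * Real.exp (-t)) := by
  obtain ⟨K1, K0, CW, n0, hK1, hK0, hCW, hn0, H⟩ := one_step hd
  have hcd : 3 ≤ cd d := cd_ge d
  obtain ⟨T0, hT0⟩ := eventually_atTop.mp (log_ev (100 * K1 + K0) (cd d + 1000) (by linarith) (200 * d + 4))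
  have p21 : (0:ℝ) < 21 ^ d := by positivity
  have p5 : (0:ℝ) < 5 ^ d := by positivity
  refine ⟨max T0 (21 ^ d + 2 + 2 * 5 ^ d + 100 + CW + n0 + cd d), le_max_of_le_right (by linarith), ?_⟩
  intro t ht n hn S hSne hS k hk
  have hlog := hT0 t (le_trans (le_max_left _ _) ht)
  have htb := le_trans (le_max_right _ _) ht
  clear ht hT0
  have ht100 : 100 ≤ t := by linarith
  have ht0 : 0 < t := by linarith
  have ht1 : 1 ≤ t := by linarith
  obtain ⟨u, hu⟩ : ∃ u, u = t ^ (25 * d) := ⟨_, rfl⟩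
  have hnu : n = u ^ 4 := by rw [hn, hu, ← pow_mul]; congr 1; ring
  have hut : t ^ 50 ≤ u := by
    rw [hu]; exact pow_le_pow_right₀ (by linarith) (by omega)
  have hu1 : 1 ≤ u := le_trans (one_le_pow₀ ht1) hut
  have hu0 : 0 < u := by linarith
  have hn200 : t ^ 200 ≤ n := by
    rw [hn]; exact pow_le_pow_right₀ (by linarith) (by omega)
  have htn : t ≤ n := le_trans (le_self_pow₀ ht1 (by norm_num)) hn200
  have hn1 : 1 ≤ n := by linarith
  have hnp : 0 < n := by linarith
  have hm1 : (1:ℝ) ≤ S.card := by exact_mod_cast hSne.card_pos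
  have hm5 := card_le5 n hn1 S hS
  obtain ⟨ha1, ha2⟩ := ratio_bd hd (S.card : ℝ) k (by linarith) (by positivity) (by exact_mod_cast hk)
  obtain ⟨L, hL⟩ : ∃ L, L = Real.log ((cd d + 1000) * t ^ (200 * d + 4)) := ⟨_, rfl⟩
  rw [← hL] at hlog
  have hn2 : t ^ (200 * d + 4) = n ^ 2 * t ^ 4 := by rw [hn, ← pow_mul, ← pow_add]; congr 1; ring
  have hlogle : ∀ x : ℝ, 0 < x → x ≤ (cd d + 1000) * (n ^ 2 * t ^ 4) → Real.log x ≤ L := by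
    intro x hx hx2
    rw [hL, hn2]
    exact Real.log_le_log hx hx2
  have hnt2 : 1 ≤ n ^ 2 * t ^ 4 := one_le_mul_of_one_le_of_one_le (one_le_pow₀ hn1) (one_le_pow₀ ht1)
  have hL0 : 0 ≤ L := by
    rw [← Real.log_one]; exact hlogle 1 one_pos (by
      have : 0 ≤ cd d * (n ^ 2 * t ^ 4) := mul_nonneg (by linarith) (by linarith)
      linarith)
  have hK0L : K0 * L ≤ t := by
    have := mul_nonneg hK1.le hL0
    linarith
  have hK1L : 100 * (K1 * L) ≤ t := by
    have := mul_nonneg hK0.le hL0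
    linarith
  have ht2 : t ≤ t ^ 2 := le_self_pow₀ ht1 (by norm_num)
  have hnn : n ≤ n * t ^ 2 := le_mul_of_one_le_right hnp.le (by linarith)
  obtain ⟨r, hr⟩ : ∃ r, r = n + (t + 1) * (n * t) := ⟨_, rfl⟩
  have hr3 : r ≤ 3 * (n * t ^ 2) := by
    have : n * t ≤ n * t ^ 2 := by gcongr
    rw [hr]
    have e : n + (t + 1) * (n * t) = n + n * t ^ 2 + n * t := by ring
    linarith
  have hr0 : 0 < r := by rw [hr]; positivity
  obtain ⟨G, hG⟩ : ∃ G, G = K0 * Real.log (cd d + 9 * r ^ 2) := ⟨_, rfl⟩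
  have hGt : G ≤ t := by
    rw [hG]
    refine le_trans ?_ hK0L
    gcongr
    apply hlogle _ (by positivity)
    have : r ^ 2 ≤ (3 * (n * t ^ 2)) ^ 2 := by gcongr
    have e : (3 * (n * t ^ 2)) ^ 2 = 9 * (n ^ 2 * t ^ 4) := by ring
    have : cd d * 1 ≤ cd d * (n ^ 2 * t ^ 4) := by gcongr
    linarith
  have hG0 : 0 ≤ G := by
    rw [hG]
    have : 0 ≤ r ^ 2 := by positivity
    exact mul_nonneg hK0.le (Real.log_nonneg (by linarith))
  obtain ⟨κ, hκ⟩ : ∃ κ, κ = 2 * (t * n + G * (r + 1) ^ 2 / n) := ⟨_, rfl⟩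
  have hκ6 : κ ≤ n * t ^ 6 := by
    have c1 : (r + 1) ^ 2 ≤ (4 * (n * t ^ 2)) ^ 2 := by gcongr; linarith
    have c2 : G * (r + 1) ^ 2 / n ≤ t * (4 * (n * t ^ 2)) ^ 2 / n := by gcongr
    have c3 : t * (4 * (n * t ^ 2)) ^ 2 / n = 16 * (n * t ^ 5) := by field_simp; ring
    have c4 : t * n ≤ n * t ^ 5 := by
      rw [mul_comm]; gcongr; exact le_self_pow₀ ht1 (by norm_num)
    have c5 : 100 * (n * t ^ 5) ≤ t * (n * t ^ 5) := by gcongr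
    have c6 : t * (n * t ^ 5) = n * t ^ 6 := by ring
    have c7 : 0 ≤ n * t ^ 5 := by positivity
    rw [hκ]
    linarith
  obtain ⟨σ, hσ⟩ : ∃ σ, σ = u ^ 2 * t ^ 4 := ⟨_, rfl⟩
  have hσ1 : 1 ≤ σ := by rw [hσ]; exact one_le_mul_of_one_le_of_one_le (one_le_pow₀ hu1) (one_le_pow₀ ht1)
  -- q
  obtain ⟨q, hq⟩ : ∃ q, q = n / t ^ 22 := ⟨_, rfl⟩
  have hqn : n = q * t ^ 22 := by rw [hq]; field_simp
  have hσq : σ ≤ q := by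
    rw [hq, le_div_iff₀ (by positivity), hσ, hnu]
    calc u ^ 2 * t ^ 4 * t ^ 22 = u ^ 2 * t ^ 26 := by ring
      _ ≤ u ^ 2 * t ^ 50 := mul_le_mul_of_nonneg_left (pow_le_pow_right₀ ht1 (by norm_num)) (by positivity)
      _ ≤ u ^ 2 * u := by gcongr
      _ ≤ u ^ 2 * u * u := le_mul_of_one_le_right (by positivity) hu1
      _ = _ := by ring
  have hqt : t ≤ q := by
    rw [hq, le_div_iff₀ (by positivity)]
    calc t * t ^ 22 = t ^ 23 := by ring
      _ ≤ t ^ 200 := pow_le_pow_right₀ ht1 (by norm_num)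
      _ ≤ n := hn200
  have hqn' : q ≤ n := by
    rw [hqn]; exact le_mul_of_one_le_right (by linarith) (one_le_pow₀ ht1)
  obtain ⟨a', ha'⟩ : ∃ a', a' = (((S.card : ℝ) + k) / S.card) ^ ((1:ℝ) / d) := ⟨_, rfl⟩
  rw [← ha'] at ha1 ha2 ⊢
  have hρt : t ≤ n / t ^ 23 := by
    rw [le_div_iff₀ (by positivity)]
    calc t * t ^ 23 = t ^ 24 := by ring
      _ ≤ t ^ 200 := pow_le_pow_right₀ ht1 (by norm_num)
      _ ≤ n := hn200
  have hR1 : 1 ≤ (n + 3) * a' := one_le_mul_of_one_le_of_one_le (by linarith) ha1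
  have hR8 : (n + 3) * a' ≤ 8 * n := by
    have := mul_le_mul_of_nonneg_left ha2 (show 0 ≤ n + 3 by linarith)
    linarith
  have hnt1 : 1 ≤ n * t := one_le_mul_of_one_le_of_one_le hn1 ht1
  have hcd1 : cd d ≤ (10 * n) ^ 2 := by
    have := le_self_pow₀ (show 1 ≤ 10 * n by linarith) (show (2:ℕ) ≠ 0 by norm_num)
    linarith
  have hcd2 : cd d ≤ (n / t ^ 23) ^ 2 := by
    have := le_self_pow₀ (show 1 ≤ n / t ^ 23 by linarith) (show (2:ℕ) ≠ 0 by norm_num)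
    linarith
  have hmain := H n t (n * t) (10 * n) r G κ σ ((n + 3) * a') (n / t ^ 23) q S k (by linarith) hSne hS hk ht0
    hnt1 hcd1 (by linarith) ?_ ?_ hr hG (by linarith) hκ hσ1 (by linarith) (by rw [ha'])
    (count_arith hd t u n S.card ((n + 3) * a') σ κ CW (by linarith) hCW hu hnu (by linarith) hm5 hR1 hR8 hσ (by linarith) hκ6)
    (by linarith) hcd2 (by linarith) ?_
  · refine le_trans (measure_mono ?_) (le_trans hmain (ENNReal.ofReal_le_ofReal ?_))
    · intro s hs hsub
      refine hs (hsub.trans (ball_mono ?_))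
      have e1 : n * a' * (1 + 2 / t ^ 20) = n * a' + a' * (2 * t ^ 2 * q) := by rw [hqn]; field_simp
      have e2 : 2 * t ^ 2 * q ≤ a' * (2 * t ^ 2 * q) := le_mul_of_one_le_left (mul_nonneg (by positivity) (by linarith)) ha1
      have e3 : (t + 3) * q ≤ 2 * t ^ 2 * q := by
        exact mul_le_mul_of_nonneg_right (by linarith) (by linarith)
      have e4 : (n + 3) * a' = n * a' + 3 * a' := by ring
      have e5 : (t + 3) * q = (t + 1) * q + 2 * q := by ring
      linarith
    · have c1 : (S.card : ℝ) ≤ (9 * n * t ^ 2) ^ d := by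
        exact hm5.trans (pow_le_pow_left₀ (by linarith) (by linarith) _)
      have c2 : (2 * r + 3) ^ d ≤ (9 * n * t ^ 2) ^ d := pow_le_pow_left₀ (by linarith) (by linarith) _
      have c3 : (1:ℝ) ≤ (9 * n * t ^ 2) ^ d := one_le_pow₀ (by linarith)
      have := mul_le_mul_of_nonneg_right c1 (Real.exp_pos 40).le
      exact mul_le_mul_of_nonneg_right (by linarith) (Real.exp_pos _).le
  · -- K1 cond 1
    have c : Real.log ((10 * n) ^ 2 + 9 * (n * t) ^ 2) ≤ L := by
      apply hlogle _ (by positivity)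
      have c1 : n ^ 2 ≤ n ^ 2 * t ^ 4 := le_mul_of_one_le_right (by positivity) (one_le_pow₀ ht1)
      have c2 : n ^ 2 * t ^ 2 ≤ n ^ 2 * t ^ 4 := mul_le_mul_of_nonneg_left (pow_le_pow_right₀ ht1 (by norm_num)) (by positivity)
      have c3 : 0 ≤ cd d * (n ^ 2 * t ^ 4) := mul_nonneg (by linarith) (by linarith)
      have c4 : (10 * n) ^ 2 + 9 * (n * t) ^ 2 = 100 * n ^ 2 + 9 * (n ^ 2 * t ^ 2) := by ring
      linarith
    calc K1 * ((10 * n) ^ 2 * Real.log ((10 * n) ^ 2 + 9 * (n * t) ^ 2)) ≤ K1 * ((10 * n) ^ 2 * L) := by gcongr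
      _ = n ^ 2 * (100 * (K1 * L)) := by ring
      _ ≤ n ^ 2 * t ^ 2 := by gcongr; linarith
      _ = _ := by ring
  · calc 2 * (S.card : ℝ) ≤ 2 ^ d * (5 * n) ^ d := by
          exact mul_le_mul (le_self_pow₀ (by norm_num) (by omega)) hm5 (by linarith) (by positivity)
      _ = (10 * n) ^ d := by rw [← mul_pow]; congr 1; ring
  · have e : n / t ^ 23 = q / t := by rw [hq]; field_simp
    have hqp : 0 < q := by linarith
    rw [e]
    have c : Real.log ((q / t) ^ 2 + 9 * q ^ 2) ≤ L := by
      apply hlogle _ (by positivity)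
      have c1 : n ^ 2 ≤ n ^ 2 * t ^ 4 := le_mul_of_one_le_right (by positivity) (one_le_pow₀ ht1)
      have c2 : q ^ 2 ≤ n ^ 2 := by gcongr
      have c3 : 0 ≤ cd d * (n ^ 2 * t ^ 4) := mul_nonneg (by linarith) (by linarith)
      have c4 : (q / t) ^ 2 ≤ q ^ 2 := by
        gcongr
        exact div_le_self hqp.le ht1
      linarith
    calc K1 * ((q / t) ^ 2 * Real.log ((q / t) ^ 2 + 9 * q ^ 2)) ≤ K1 * ((q / t) ^ 2 * L) := by gcongr
      _ = q ^ 2 * (K1 * L) / t ^ 2 := by ring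
      _ ≤ q ^ 2 * t ^ 2 / t ^ 2 := by
          exact div_le_div_of_nonneg_right (mul_le_mul_of_nonneg_left (by linarith [mul_nonneg hK1.le hL0]) (sq_nonneg _)) (sq_nonneg _)
      _ = _ := by field_simp

end

end UI

namespace UI
noncomputable section

/-- the bad event at one scale -/
def Bad (d : ℕ) (n : ℝ) (S : Finset (V d)) : Set (ℕ → ℝ) :=
  {s | ∃ k ≤ S.card, ¬ agg S s k ⊆ ball d (n * (((S.card : ℝ) + k) / S.card) ^ ((1:ℝ) / d) * (1 + 2 * n ^ (-(1 / (5 * (d:ℝ))))))}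

lemma exp_ev (N : ℕ) : ∃ T : ℝ, ∀ t : ℝ, T ≤ t → t ^ N * Real.exp (-t) ≤ 1 := by
  have h := (Real.tendsto_pow_mul_exp_neg_atTop_nhds_zero N).eventually (eventually_le_nhds (show (0:ℝ) < 1 by norm_num))
  obtain ⟨T, hT⟩ := eventually_atTop.mp h
  exact ⟨T, hT⟩

lemma one_scale {d : ℕ} (hd : 2 ≤ d) (K : ℕ) : ∃ C : ℝ, 0 < C ∧ ∀ n : ℝ, 1 ≤ n → ∀ S : Finset (V d), S.Nonempty → S ⊆ ball d n →
    P (Bad d n S) ≤ ENNReal.ofReal (C / n ^ K) := by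
  obtain ⟨T, hT1, hT⟩ := one_scale_big hd
  obtain ⟨T2, hT2⟩ := exp_ev (100 * d * K + (100 * d + 2) * (2 * d))
  obtain ⟨T', hT'⟩ : ∃ T', T' = max T T2 := ⟨_, rfl⟩
  have hTT : T ≤ T' := by rw [hT']; exact le_max_left _ _
  have hTT2 : T2 ≤ T' := by rw [hT']; exact le_max_right _ _
  have hT'1 : 1 ≤ T' := by linarith
  obtain ⟨c, hc⟩ : ∃ c, c = 2 * (2 * Real.exp 40 + 3) * 9 ^ (2 * d) := ⟨_, rfl⟩
  have hc0 : 0 < c := by rw [hc]; positivity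
  have hTp : 0 < T' ^ (100 * d * K) := by positivity
  refine ⟨c + T' ^ (100 * d * K), by positivity, ?_⟩
  intro n hn S hSne hS
  have hn0 : 0 < n := by linarith
  have hd0 : (0:ℝ) < d := by exact_mod_cast (by omega : 0 < d)
  obtain ⟨t, ht⟩ : ∃ t : ℝ, t = n ^ (1 / (100 * (d:ℝ))) := ⟨_, rfl⟩
  have ht1 : 1 ≤ t := by rw [ht]; exact Real.one_le_rpow hn (by positivity)
  have ht0 : 0 < t := by linarith
  have htn : n = t ^ (100 * d) := by
    rw [ht, ← Real.rpow_natCast, ← Real.rpow_mul hn0.le]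
    push_cast
    rw [one_div_mul_cancel (by positivity), Real.rpow_one]
  have ht20 : n ^ (-(1 / (5 * (d:ℝ)))) = 1 / t ^ 20 := by
    rw [ht, ← Real.rpow_natCast, ← Real.rpow_mul hn0.le, one_div (n ^ _), ← Real.rpow_neg hn0.le]
    congr 1
    push_cast
    field_simp
    norm_num
  have hnK : n ^ K = t ^ (100 * d * K) := by rw [htn, ← pow_mul]
  by_cases htT : t < T'
  · refine le_trans prob_le_one ?_
    rw [← ENNReal.ofReal_one]
    apply ENNReal.ofReal_le_ofReal
    rw [le_div_iff₀ (by positivity), one_mul, hnK]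
    have : t ^ (100 * d * K) ≤ T' ^ (100 * d * K) := pow_le_pow_left₀ ht0.le htT.le _
    linarith
  · have htT' : T' ≤ t := not_lt.mp htT
    have hsub : Bad d n S ⊆ ⋃ k ∈ Finset.range (S.card + 1), {s | ¬ agg S s k ⊆ ball d (n * (((S.card : ℝ) + k) / S.card) ^ ((1:ℝ) / d) * (1 + 2 / t ^ 20))} := by
      rintro s ⟨k, hk, h⟩
      simp only [Set.mem_iUnion]
      refine ⟨k, Finset.mem_range.mpr (by omega), ?_⟩
      rw [ht20, mul_one_div] at h
      exact h
    refine le_trans (measure_mono hsub) (le_trans (measure_biUnion_finset_le _ _) ?_)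
    obtain ⟨X, hX⟩ : ∃ X, X = (2 * Real.exp 40 + 3) * (9 * n * t ^ 2) ^ d * Real.exp (-t) := ⟨_, rfl⟩
    have hX0 : 0 ≤ X := by rw [hX]; positivity
    refine le_trans (Finset.sum_le_sum (g := fun _ => ENNReal.ofReal X) fun k hk => ?_) ?_
    · rw [hX]
      exact hT t (by linarith) n htn S hSne hS k (by have := Finset.mem_range.mp hk; omega)
    · rw [Finset.sum_const, Finset.card_range, nsmul_eq_mul, ← ENNReal.ofReal_natCast, ← ENNReal.ofReal_mul (Nat.cast_nonneg _)]
      apply ENNReal.ofReal_le_ofReal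
      rw [le_div_iff₀ (by positivity), hX]
      have hm5 := card_le5 n hn S hS
      have h9 : 5 * n ≤ 9 * n * t ^ 2 := by
        have : 1 ≤ t ^ 2 := one_le_pow₀ ht1
        have : n * 1 ≤ n * t ^ 2 := mul_le_mul_of_nonneg_left this hn0.le
        linarith
      have hm9 : ((S.card + 1 : ℕ) : ℝ) ≤ 2 * (9 * n * t ^ 2) ^ d := by
        have a1 : (5 * n) ^ d ≤ (9 * n * t ^ 2) ^ d := pow_le_pow_left₀ (by linarith) h9 _
        have a2 : 1 ≤ (9 * n * t ^ 2) ^ d := one_le_pow₀ (by linarith)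
        push_cast
        linarith
      have hE := hT2 t (by linarith)
      calc ((S.card + 1 : ℕ) : ℝ) * ((2 * Real.exp 40 + 3) * (9 * n * t ^ 2) ^ d * Real.exp (-t)) * n ^ K
          ≤ (2 * (9 * n * t ^ 2) ^ d) * ((2 * Real.exp 40 + 3) * (9 * n * t ^ 2) ^ d * Real.exp (-t)) * n ^ K := by gcongr
        _ = c * (n ^ K * (n * t ^ 2) ^ (2 * d) * Real.exp (-t)) := by
            rw [hc]
            generalize Real.exp 40 = e1
            generalize Real.exp (-t) = e2
            have : (9 * n * t ^ 2) ^ d = 9 ^ d * (n * t ^ 2) ^ d := by rw [← mul_pow]; congr 1; ring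
            rw [this, pow_mul' (n * t ^ 2), pow_mul' (9:ℝ)]
            ring
        _ = c * (t ^ (100 * d * K + (100 * d + 2) * (2 * d)) * Real.exp (-t)) := by
            congr 2
            rw [hnK, pow_add, pow_mul t (100 * d + 2), pow_add t (100 * d), htn]
        _ ≤ c * 1 := by gcongr
        _ ≤ _ := by linarith

lemma shift_agg {d : ℕ} (K : ℕ) : ∀ (S : Finset (V d)) (s : ℕ → ℝ) (k : ℕ), agg S s (K + k) = agg (agg S s K) (fun i => s (K + i)) k := by
  intro S s k
  induction k with
  | zero => rfl
  | succ k ih =>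
    have e1 : agg S s (K + (k + 1)) = uStep (agg S s (K + k)) (s (K + k)) := rfl
    have e2 : agg (agg S s K) (fun i => s (K + i)) (k + 1) = uStep (agg (agg S s K) (fun i => s (K + i)) k) (s (K + k)) := rfl
    rw [e1, e2, ih]

lemma measurable_Bad {d : ℕ} (n : ℝ) (S : Finset (V d)) : MeasurableSet (Bad d n S) := by
  have e : Bad d n S = ⋃ k ∈ {k : ℕ | k ≤ S.card}, (fun s => agg S s k) ⁻¹' {A | ¬ A ⊆ ball d (n * (((S.card : ℝ) + k) / S.card) ^ ((1:ℝ) / d) * (1 + 2 * n ^ (-(1 / (5 * (d:ℝ))))))} := by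
    ext s
    simp [Bad]
  rw [e]
  exact MeasurableSet.biUnion (Set.to_countable _) fun k _ => measurable_agg S k MeasurableSpace.measurableSet_top

end

end UI

namespace UI
noncomputable section

/-- restart event -/
def Rst {d : ℕ} (S : Finset (V d)) (K : ℕ) (B : Finset (V d) → Set (ℕ → ℝ)) : Set (ℕ → ℝ) :=
  {s | (fun i => s (K + i)) ∈ B (agg S s K)}

lemma mem_Rst {d : ℕ} (S : Finset (V d)) (K : ℕ) (B : Finset (V d) → Set (ℕ → ℝ)) (s : ℕ → ℝ) :
    s ∈ Rst S K B ↔ (fun i => s (K + i)) ∈ B (agg S s K) := Iff.rfl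

lemma measurable_Rst {d : ℕ} (S : Finset (V d)) (K : ℕ) (B : Finset (V d) → Set (ℕ → ℝ)) (hB : ∀ A, MeasurableSet (B A)) :
    MeasurableSet (Rst S K B) := by
  have e : Rst S K B = ⋃ A : Finset (V d), ((fun s => agg S s K) ⁻¹' {A}) ∩ ((fun (s : ℕ → ℝ) i => s (K + i)) ⁻¹' B A) := by
    ext s
    rw [Set.mem_iUnion, mem_Rst]
    simp only [Set.mem_inter_iff, Set.mem_preimage, Set.mem_singleton_iff]
    generalize agg S s K = A'
    constructor
    · intro h
      exact ⟨A', rfl, h⟩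
    · rintro ⟨A, h1, h2⟩
      rw [h1]
      exact h2
  rw [e]
  have hsh : Measurable (fun (s : ℕ → ℝ) i => s (K + i)) := measurable_pi_lambda _ fun i => measurable_pi_apply (K + i)
  refine MeasurableSet.iUnion fun A => ?_
  exact MeasurableSet.inter (measurableSet_preimage (measurable_agg S K) MeasurableSet.of_discrete) (measurableSet_preimage hsh (hB A))

lemma Rst_le {d : ℕ} (B : Finset (V d) → Set (ℕ → ℝ)) (hB : ∀ A, MeasurableSet (B A)) (ε : ℝ≥0∞)
    (h : ∀ A, A.Nonempty → P (B A) ≤ ε) (K : ℕ) : ∀ S : Finset (V d), S.Nonempty → P (Rst S K B) ≤ ε := by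
  induction K with
  | zero =>
    intro S hS
    have e : Rst S 0 B = B S := by
      ext s
      have : (fun i => s (0 + i)) = s := by funext i; rw [zero_add]
      unfold Rst
      rw [Set.mem_ofPred_eq, this]
      rfl
    rw [e]
    exact h S hS
  | succ K ih =>
    intro S hS
    rw [← lintegral_indicator_one (measurable_Rst S (K+1) B hB), lintegral_cons _ (measurable_one.indicator (measurable_Rst S (K+1) B hB))]
    have e : ∀ u, ∫⁻ s, (Rst S (K+1) B).indicator (1 : (ℕ → ℝ) → ℝ≥0∞) (cons u s) ∂P = P (Rst (uStep S u) K B) := by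
      intro u
      rw [← lintegral_indicator_one (measurable_Rst (uStep S u) K B hB)]
      congr 1
      funext s
      have : cons u s ∈ Rst S (K+1) B ↔ s ∈ Rst (uStep S u) K B := by
        unfold Rst
        rw [Set.mem_ofPred_eq, Set.mem_ofPred_eq, agg_cons]
        have : (fun i => cons u s (K + 1 + i)) = fun i => s (K + i) := by
          funext i
          rw [show K + 1 + i = (K + i) + 1 by ring]
          rfl
        rw [this]
      by_cases hs : s ∈ Rst (uStep S u) K B
      · rw [Set.indicator_of_mem hs, Set.indicator_of_mem (this.mpr hs)]; rfl
      · rw [Set.indicator_of_notMem hs, Set.indicator_of_notMem (fun h => hs (this.mp h))]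
    simp_rw [e]
    calc ∫⁻ u, P (Rst (uStep S u) K B) ∂μ0 ≤ ∫⁻ _, ε ∂μ0 := lintegral_mono fun u => ih _ (uStep_nonempty S u)
      _ = ε := by rw [lintegral_const, measure_univ, mul_one]

/-- radii of the scales -/
def scl (d : ℕ) (n : ℝ) : ℕ → ℝ
  | 0 => n
  | i + 1 => scl d n i * 2 ^ ((1:ℝ) / d) * (1 + 2 * (scl d n i) ^ (-(1 / (5 * (d:ℝ)))))

lemma scl_ge {d : ℕ} (n : ℝ) (hn : 1 ≤ n) (i : ℕ) : n * (2 ^ ((1:ℝ) / d)) ^ i ≤ scl d n i := by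
  induction i with
  | zero => simp [scl]
  | succ i ih =>
    have hq : (0:ℝ) < 2 ^ ((1:ℝ) / d) := by positivity
    have h0 : 0 < scl d n i := lt_of_lt_of_le (by positivity) ih
    have h1 : 0 ≤ (scl d n i) ^ (-(1 / (5 * (d:ℝ)))) := by positivity
    unfold scl
    rw [pow_succ]
    calc n * ((2 ^ ((1:ℝ) / d)) ^ i * 2 ^ ((1:ℝ) / d)) = n * (2 ^ ((1:ℝ) / d)) ^ i * 2 ^ ((1:ℝ) / d) := by ring
      _ ≤ scl d n i * 2 ^ ((1:ℝ) / d) := by gcongr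
      _ ≤ _ := le_mul_of_one_le_right (by positivity) (by linarith)

/-- the contraction ratio of the relative errors -/
def pr (d : ℕ) : ℝ := (2 ^ ((1:ℝ) / d)) ^ (-(1 / (5 * (d:ℝ))))

lemma pr_lt {d : ℕ} (hd : 2 ≤ d) : 0 < pr d ∧ pr d < 1 := by
  have hd0 : (0:ℝ) < d := by exact_mod_cast (by omega : 0 < d)
  unfold pr
  refine ⟨by positivity, ?_⟩
  apply Real.rpow_lt_one_of_one_lt_of_neg
  · exact Real.one_lt_rpow (by norm_num) (by positivity)
  · have : 0 < 1 / (5 * (d:ℝ)) := by positivity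
    linarith

lemma scl_err {d : ℕ} (n : ℝ) (hn : 1 ≤ n) (i : ℕ) :
    (scl d n i) ^ (-(1 / (5 * (d:ℝ)))) ≤ n ^ (-(1 / (5 * (d:ℝ)))) * pr d ^ i := by
  have hq : (0:ℝ) < 2 ^ ((1:ℝ) / d) := by positivity
  have hneg : -(1 / (5 * (d:ℝ))) ≤ 0 := by
    have : 0 ≤ 1 / (5 * (d:ℝ)) := by positivity
    linarith
  calc (scl d n i) ^ (-(1 / (5 * (d:ℝ)))) ≤ (n * (2 ^ ((1:ℝ) / d)) ^ i) ^ (-(1 / (5 * (d:ℝ)))) :=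
        Real.rpow_le_rpow_of_nonpos (by positivity) (scl_ge n hn i) hneg
    _ = _ := by
        rw [Real.mul_rpow (by linarith) (by positivity)]
        unfold pr
        rw [← Real.rpow_natCast, ← Real.rpow_natCast, ← Real.rpow_mul hq.le, ← Real.rpow_mul hq.le, mul_comm (i:ℝ)]

lemma scl_le {d : ℕ} (n : ℝ) (hn : 1 ≤ n) (i : ℕ) :
    scl d n i ≤ n * (2 ^ ((1:ℝ) / d)) ^ i * Real.exp (2 * n ^ (-(1 / (5 * (d:ℝ)))) * ∑ l ∈ Finset.range i, pr d ^ l) ∧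
    scl d n i * (1 + 2 * (scl d n i) ^ (-(1 / (5 * (d:ℝ))))) ≤
      n * (2 ^ ((1:ℝ) / d)) ^ i * Real.exp (2 * n ^ (-(1 / (5 * (d:ℝ)))) * ∑ l ∈ Finset.range (i+1), pr d ^ l) := by
  have hq : (0:ℝ) < 2 ^ ((1:ℝ) / d) := by positivity
  have key : ∀ i, scl d n i ≤ n * (2 ^ ((1:ℝ) / d)) ^ i * Real.exp (2 * n ^ (-(1 / (5 * (d:ℝ)))) * ∑ l ∈ Finset.range i, pr d ^ l) →
    scl d n i * (1 + 2 * (scl d n i) ^ (-(1 / (5 * (d:ℝ))))) ≤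
      n * (2 ^ ((1:ℝ) / d)) ^ i * Real.exp (2 * n ^ (-(1 / (5 * (d:ℝ)))) * ∑ l ∈ Finset.range (i+1), pr d ^ l) := by
    intro i hi
    have h0 : 0 < scl d n i := lt_of_lt_of_le (by positivity) (scl_ge n hn i)
    have h1 : 0 ≤ (scl d n i) ^ (-(1 / (5 * (d:ℝ)))) := by positivity
    have h2 := scl_err (d := d) n hn i
    have h3 : 1 + 2 * (scl d n i) ^ (-(1 / (5 * (d:ℝ)))) ≤ Real.exp (2 * n ^ (-(1 / (5 * (d:ℝ)))) * pr d ^ i) := by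
      have := Real.add_one_le_exp (2 * n ^ (-(1 / (5 * (d:ℝ)))) * pr d ^ i)
      linarith
    rw [Finset.sum_range_succ, mul_add (2 * n ^ (-(1 / (5 * (d:ℝ))))), Real.exp_add, ← mul_assoc]
    exact mul_le_mul hi h3 (by linarith) (by positivity)
  suffices h : scl d n i ≤ n * (2 ^ ((1:ℝ) / d)) ^ i * Real.exp (2 * n ^ (-(1 / (5 * (d:ℝ)))) * ∑ l ∈ Finset.range i, pr d ^ l) from ⟨h, key i h⟩
  induction i with
  | zero => simp [scl]
  | succ i ih =>
    have := key i ih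
    have e : scl d n (i+1) = 2 ^ ((1:ℝ) / d) * (scl d n i * (1 + 2 * (scl d n i) ^ (-(1 / (5 * (d:ℝ)))))) := by
      rw [scl]; ring
    rw [e]
    calc _ ≤ 2 ^ ((1:ℝ) / d) * (n * (2 ^ ((1:ℝ) / d)) ^ i * Real.exp (2 * n ^ (-(1 / (5 * (d:ℝ)))) * ∑ l ∈ Finset.range (i+1), pr d ^ l)) :=
          mul_le_mul_of_nonneg_left this hq.le
      _ = _ := by ring

/-- the final constant -/
def C10 (d : ℕ) : ℝ := (2 / (1 - pr d)) * Real.exp (2 / (1 - pr d))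

lemma scl_fin {d : ℕ} (hd : 2 ≤ d) (n : ℝ) (hn : 1 ≤ n) (i : ℕ) :
    scl d n i * (1 + 2 * (scl d n i) ^ (-(1 / (5 * (d:ℝ))))) ≤ n * (2 ^ ((1:ℝ) / d)) ^ i * (1 + C10 d * n ^ (-(1 / (5 * (d:ℝ))))) := by
  refine le_trans (scl_le n hn i).2 ?_
  obtain ⟨hp0, hp1⟩ := pr_lt hd
  have hq : (0:ℝ) < 2 ^ ((1:ℝ) / d) := by positivity
  have hneg : -(1 / (5 * (d:ℝ))) ≤ 0 := by
    have : 0 ≤ 1 / (5 * (d:ℝ)) := by positivity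
    linarith
  obtain ⟨x, hx⟩ : ∃ x, x = n ^ (-(1 / (5 * (d:ℝ)))) := ⟨_, rfl⟩
  have hx0 : 0 ≤ x := by rw [hx]; positivity
  have hx1 : x ≤ 1 := by rw [hx]; exact Real.rpow_le_one_of_one_le_of_nonpos hn hneg
  rw [← hx]
  obtain ⟨y, hy⟩ : ∃ y, y = 2 / (1 - pr d) := ⟨_, rfl⟩
  have hy0 : 0 ≤ y := by rw [hy]; exact div_nonneg (by norm_num) (by linarith)
  have hs : ∑ l ∈ Finset.range (i+1), pr d ^ l ≤ 1 / (1 - pr d) := by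
    rw [one_div, ← tsum_geometric_of_lt_one hp0.le hp1]
    exact Summable.sum_le_tsum _ (fun _ _ => by positivity) (summable_geometric_of_lt_one hp0.le hp1)
  apply mul_le_mul_of_nonneg_left _ (by positivity)
  have h1 : 2 * x * ∑ l ∈ Finset.range (i+1), pr d ^ l ≤ x * y := by
    rw [hy]
    calc _ ≤ 2 * x * (1 / (1 - pr d)) := mul_le_mul_of_nonneg_left hs (by linarith)
      _ = _ := by ring
  refine le_trans (Real.exp_le_exp.mpr h1) ?_
  have h2 : Real.exp (x * y) ≤ 1 + x * y * Real.exp (x * y) := by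
    have a := Real.add_one_le_exp (-(x * y))
    have b := mul_le_mul_of_nonneg_right a (Real.exp_pos (x * y)).le
    rw [← Real.exp_add, neg_add_cancel, Real.exp_zero] at b
    linarith
  have h3 : Real.exp (x * y) ≤ Real.exp y := Real.exp_le_exp.mpr (mul_le_of_le_one_left hy0 hx1)
  have h4 := mul_le_mul_of_nonneg_left h3 (mul_nonneg hx0 hy0)
  have h5 : C10 d * x = x * y * Real.exp y := by unfold C10; rw [← hy]; ring
  linarith

/-- the bad event restricted to the good configurations -/
def BadQ (d : ℕ) (n : ℝ) (A : Finset (V d)) : Set (ℕ → ℝ) := {s | A ⊆ ball d n ∧ s ∈ Bad d n A}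

lemma measurable_BadQ {d : ℕ} (n : ℝ) (A : Finset (V d)) : MeasurableSet (BadQ d n A) := by
  by_cases h : A ⊆ ball d n
  · have : BadQ d n A = Bad d n A := by ext s; simp [BadQ, h]
    rw [this]; exact measurable_Bad n A
  · have : BadQ d n A = ∅ := by ext s; simp [BadQ, h]
    rw [this]; exact MeasurableSet.empty

lemma det_scales {d : ℕ} (hd : 2 ≤ d) (n : ℝ) (hn : 1 ≤ n) (S : Finset (V d)) (hSne : S.Nonempty) (hS : S ⊆ ball d n) (s : ℕ → ℝ)
    (hch : ∀ k, newPt (agg S s k) (s k) ∉ agg S s k)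
    (hgood : ∀ i : ℕ, s ∉ Rst S ((2 ^ i - 1) * S.card) (BadQ d (scl d n i))) (a : ℝ) (ha : 1 ≤ a) :
    agg S s ⌊(a - 1) * S.card⌋₊ ⊆ ball d (n * a ^ ((1:ℝ) / d) * (1 + C10 d * n ^ (-(1 / (5 * (d:ℝ)))))) := by
  have hm0 : (0:ℝ) < S.card := by exact_mod_cast hSne.card_pos
  have hd0 : (0:ℝ) < d := by exact_mod_cast (by omega : 0 < d)
  have hKi : ∀ i : ℕ, S.card + (2 ^ i - 1) * S.card = 2 ^ i * S.card := by
    intro i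
    have : 1 ≤ 2 ^ i := Nat.one_le_two_pow
    obtain ⟨j, hj⟩ := Nat.exists_eq_add_of_le this
    rw [hj, Nat.add_sub_cancel_left]; ring
  have hstep : ∀ i : ℕ, agg S s ((2 ^ i - 1) * S.card) ⊆ ball d (scl d n i) → ∀ k ≤ 2 ^ i * S.card,
      agg S s ((2 ^ i - 1) * S.card + k) ⊆ ball d (scl d n i * ((((2 ^ i * S.card : ℕ) : ℝ) + k) / (2 ^ i * S.card : ℕ)) ^ ((1:ℝ) / d) * (1 + 2 * (scl d n i) ^ (-(1 / (5 * (d:ℝ)))))) := by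
    intro i hi k hk
    have hc : (agg S s ((2 ^ i - 1) * S.card)).card = 2 ^ i * S.card := by rw [card_agg S s hch, hKi]
    by_contra hcon
    apply hgood i
    refine ⟨hi, k, by rw [hc]; exact hk, ?_⟩
    rw [← shift_agg, hc]
    exact hcon
  have hall : ∀ i : ℕ, agg S s ((2 ^ i - 1) * S.card) ⊆ ball d (scl d n i) := by
    intro i
    induction i with
    | zero =>
      rw [pow_zero, Nat.sub_self, zero_mul]
      exact hS
    | succ i ih =>
      have h := hstep i ih (2 ^ i * S.card) le_rfl
      have e1 : (2 ^ i - 1) * S.card + 2 ^ i * S.card = (2 ^ (i+1) - 1) * S.card := by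
        have h1 := hKi i
        have h2 := hKi (i+1)
        rw [pow_succ] at h2 ⊢
        have h3 : 2 ^ i * 2 * S.card = 2 * (2 ^ i * S.card) := by ring
        omega
      have e2 : (((2 ^ i * S.card : ℕ) : ℝ) + ((2 ^ i * S.card : ℕ) : ℝ)) / ((2 ^ i * S.card : ℕ) : ℝ) = 2 := by
        have : ((2 ^ i * S.card : ℕ) : ℝ) ≠ 0 := by push_cast; positivity
        field_simp
        norm_num
      rw [e1, e2] at h
      exact h
  obtain ⟨i, hi1, hi2⟩ := exists_nat_pow_near ha (show (1:ℝ) < 2 by norm_num)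
  have hle : (2 ^ i - 1) * S.card ≤ ⌊(a - 1) * S.card⌋₊ := by
    apply Nat.le_floor
    have : (((2 ^ i - 1) * S.card : ℕ) : ℝ) = ((2:ℝ) ^ i - 1) * S.card := by
      rw [Nat.cast_mul, Nat.cast_sub Nat.one_le_two_pow]; push_cast; ring
    rw [this]
    exact mul_le_mul_of_nonneg_right (by linarith) hm0.le
  obtain ⟨k, hk⟩ := Nat.exists_eq_add_of_le hle
  have hfl : ((⌊(a - 1) * S.card⌋₊ : ℕ) : ℝ) ≤ (a - 1) * S.card :=
    Nat.floor_le (mul_nonneg (by linarith) hm0.le)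
  rw [hk] at hfl ⊢
  have hcast : (((2 ^ i - 1) * S.card : ℕ) : ℝ) = ((2:ℝ) ^ i - 1) * S.card := by
    rw [Nat.cast_mul, Nat.cast_sub Nat.one_le_two_pow]; push_cast; ring
  rw [Nat.cast_add, hcast] at hfl
  have hk1 : (2:ℝ) ^ i * S.card + k ≤ a * S.card := by linarith
  have hk2 : k ≤ 2 ^ i * S.card := by
    have h : (k:ℝ) ≤ 2 ^ i * S.card := by
      have := mul_le_mul_of_nonneg_right hi2.le hm0.le
      rw [pow_succ] at this
      linarith
    exact_mod_cast h
  refine (hstep i (hall i) k hk2).trans (ball_mono ?_)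
  have hr0 : 0 < scl d n i := lt_of_lt_of_le (by positivity) (scl_ge n hn i)
  have hb : ((((2 ^ i * S.card : ℕ) : ℝ) + k) / (2 ^ i * S.card : ℕ)) ^ ((1:ℝ) / d) ≤ (a / 2 ^ i) ^ ((1:ℝ) / d) := by
    apply Real.rpow_le_rpow (by positivity) _ (by positivity)
    push_cast
    rw [div_le_div_iff₀ (by positivity) (by positivity)]
    calc ((2:ℝ) ^ i * S.card + k) * 2 ^ i ≤ a * S.card * 2 ^ i := mul_le_mul_of_nonneg_right hk1 (by positivity)
      _ = _ := by ring
  have hf := scl_fin hd n hn i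
  have he : (a / 2 ^ i) ^ ((1:ℝ) / d) * (2 ^ ((1:ℝ) / d)) ^ i = a ^ ((1:ℝ) / d) := by
    rw [← Real.rpow_natCast (2 ^ ((1:ℝ) / d)), ← Real.rpow_mul (by norm_num), mul_comm ((1:ℝ) / d), Real.rpow_mul (by norm_num), Real.rpow_natCast,
      ← Real.mul_rpow (by positivity) (by positivity), div_mul_cancel₀ _ (by positivity)]
  have hb0 : 0 ≤ (a / 2 ^ i) ^ ((1:ℝ) / d) := by positivity
  have hY : 0 ≤ (1 + 2 * (scl d n i) ^ (-(1 / (5 * (d:ℝ))))) := by positivity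
  calc _ ≤ scl d n i * (a / 2 ^ i) ^ ((1:ℝ) / d) * (1 + 2 * (scl d n i) ^ (-(1 / (5 * (d:ℝ))))) :=
        mul_le_mul_of_nonneg_right (mul_le_mul_of_nonneg_left hb hr0.le) hY
    _ = (a / 2 ^ i) ^ ((1:ℝ) / d) * (scl d n i * (1 + 2 * (scl d n i) ^ (-(1 / (5 * (d:ℝ)))))) := by ring
    _ ≤ (a / 2 ^ i) ^ ((1:ℝ) / d) * (n * (2 ^ ((1:ℝ) / d)) ^ i * (1 + C10 d * n ^ (-(1 / (5 * (d:ℝ)))))) := mul_le_mul_of_nonneg_left hf hb0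
    _ = n * ((a / 2 ^ i) ^ ((1:ℝ) / d) * (2 ^ ((1:ℝ) / d)) ^ i) * (1 + C10 d * n ^ (-(1 / (5 * (d:ℝ))))) := by ring
    _ = _ := by rw [he]

lemma prob_scales {d : ℕ} (hd : 2 ≤ d) (K : ℕ) (hK : 1 ≤ K) : ∃ C : ℝ, 0 < C ∧ ∀ n : ℝ, 1 ≤ n → ∀ S : Finset (V d), S.Nonempty → S ⊆ ball d n →
    P {s | ¬ ∀ a : ℝ, 1 ≤ a → agg S s ⌊(a - 1) * S.card⌋₊ ⊆ ball d (n * a ^ ((1:ℝ) / d) * (1 + C10 d * n ^ (-(1 / (5 * (d:ℝ))))))}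
      ≤ ENNReal.ofReal (C / n ^ K) := by
  obtain ⟨C, hC, H⟩ := one_scale hd K
  have hd0 : (0:ℝ) < d := by exact_mod_cast (by omega : 0 < d)
  obtain ⟨q, hq⟩ : ∃ q : ℝ, q = 2 ^ ((1:ℝ) / d) := ⟨_, rfl⟩
  have hq1 : 1 < q := by rw [hq]; exact Real.one_lt_rpow (by norm_num) (by positivity)
  have hqK : 1 < q ^ K := one_lt_pow₀ hq1 (by omega)
  obtain ⟨ρ, hρ⟩ : ∃ ρ : ℝ, ρ = (q ^ K)⁻¹ := ⟨_, rfl⟩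
  have hρ0 : 0 ≤ ρ := by rw [hρ]; positivity
  have hρ1 : ρ < 1 := by rw [hρ]; exact inv_lt_one_of_one_lt₀ hqK
  refine ⟨C * (1 - ρ)⁻¹, mul_pos hC (inv_pos.mpr (by linarith)), ?_⟩
  intro n hn S hSne hS
  have hn0 : 0 < n := by linarith
  have hP : ∀ i : ℕ, P (Rst S ((2 ^ i - 1) * S.card) (BadQ d (scl d n i))) ≤ ENNReal.ofReal (C / n ^ K * ρ ^ i) := by
    intro i
    have hge := scl_ge (d := d) n hn i
    rw [← hq] at hge
    have hq0 : (0:ℝ) < n * q ^ i := by positivity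
    have hr1 : 1 ≤ scl d n i := le_trans (one_le_mul_of_one_le_of_one_le hn (one_le_pow₀ hq1.le)) hge
    apply Rst_le _ (fun A => measurable_BadQ _ A) _ _ _ S hSne
    intro A hA
    by_cases hAb : A ⊆ ball d (scl d n i)
    · refine le_trans (measure_mono fun s hs => hs.2) (le_trans (H _ hr1 A hA hAb) (ENNReal.ofReal_le_ofReal ?_))
      calc C / scl d n i ^ K ≤ C / (n * q ^ i) ^ K := by
            apply div_le_div_of_nonneg_left hC.le (by positivity)
            exact pow_le_pow_left₀ hq0.le hge _
        _ = C / n ^ K * ρ ^ i := by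
            rw [hρ, mul_pow, inv_pow, ← pow_mul, ← pow_mul, mul_comm i K]
            field_simp
    · have : BadQ d (scl d n i) A = ∅ := by ext s; simp [BadQ, hAb]
      rw [this, measure_empty]
      exact zero_le
  have hsum : P (⋃ i : ℕ, Rst S ((2 ^ i - 1) * S.card) (BadQ d (scl d n i))) ≤ ENNReal.ofReal (C * (1 - ρ)⁻¹ / n ^ K) := by
    refine le_trans (measure_iUnion_le _) (le_trans (ENNReal.tsum_le_tsum hP) ?_)
    rw [← ENNReal.ofReal_tsum_of_nonneg (fun i => by positivity) ((summable_geometric_of_lt_one hρ0 hρ1).mul_left _),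
      tsum_mul_left, tsum_geometric_of_lt_one hρ0 hρ1]
    apply le_of_eq
    congr 1
    ring
  refine le_trans ?_ hsum
  apply measure_mono_ae
  filter_upwards [newPt_chain_ae (by omega) S hSne] with s hs hbad
  by_contra hcon
  apply hbad
  intro a ha
  refine det_scales hd n hn S hSne hS s hs (fun i hi => hcon ?_) a ha
  exact Set.mem_iUnion.mpr ⟨i, hi⟩

lemma main_thm (d : ℕ) (hd : 2 ≤ d) : ∃ C₁₀ : ℝ, 0 < C₁₀ ∧ ∀ k : ℝ, 0 < k → ∃ Ck : ℝ, 0 < Ck ∧ ∀ n : ℕ, 1 ≤ n → ∀ S : Finset (V d), S.Nonempty → S ⊆ ball d n →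
    μ0 {ω | ¬ ∀ a : ℝ, 1 ≤ a → uAggFrom S ω ⌊(a - 1) * S.card⌋₊ ⊆ ball d ((n:ℝ) * a ^ ((1:ℝ) / d) * (1 + C₁₀ * (n:ℝ) ^ (-(1 / (5 * (d:ℝ))))))}
      ≤ ENNReal.ofReal (Ck * (S.card : ℝ) ^ (-k)) := by
  obtain ⟨hp0, hp1⟩ := pr_lt hd
  refine ⟨C10 d, mul_pos (div_pos (by norm_num) (by linarith)) (Real.exp_pos _), ?_⟩
  intro k hk
  obtain ⟨j, hj⟩ : ∃ j, j = ⌈k⌉₊ := ⟨_, rfl⟩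
  have hj1 : 1 ≤ j := by rw [hj]; exact Nat.ceil_pos.mpr hk
  have hkj : k ≤ j := by rw [hj]; exact Nat.le_ceil k
  obtain ⟨C, hC, H⟩ := prob_scales hd (d * j) (Nat.one_le_iff_ne_zero.mpr (Nat.mul_ne_zero (by omega) (by omega)))
  refine ⟨C * 5 ^ (d * j), by positivity, ?_⟩
  intro n hn S hSne hS
  have hn1 : (1:ℝ) ≤ n := by exact_mod_cast hn
  have hm1 : (1:ℝ) ≤ S.card := by exact_mod_cast hSne.card_pos
  have h := H n hn1 S hSne hS
  have hpre : {ω | ¬ ∀ a : ℝ, 1 ≤ a → uAggFrom S ω ⌊(a - 1) * S.card⌋₊ ⊆ ball d ((n:ℝ) * a ^ ((1:ℝ) / d) * (1 + C10 d * (n:ℝ) ^ (-(1 / (5 * (d:ℝ))))))}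
      = (fun ω i => uSlice ω i) ⁻¹' {s | ¬ ∀ a : ℝ, 1 ≤ a → agg S s ⌊(a - 1) * S.card⌋₊ ⊆ ball d ((n:ℝ) * a ^ ((1:ℝ) / d) * (1 + C10 d * (n:ℝ) ^ (-(1 / (5 * (d:ℝ))))))} := by
    ext ω
    simp only [Set.mem_preimage, Set.mem_ofPred_eq, uAgg_eq]
  rw [hpre]
  refine le_trans (Measure.le_map_apply measurable_slices.aemeasurable _) ?_
  rw [map_slices]
  refine le_trans h (ENNReal.ofReal_le_ofReal ?_)
  have h5 := card_le5 (n:ℝ) hn1 S hS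
  have a1 : (S.card : ℝ) ^ k ≤ (5 * n) ^ (d * j) := by
    calc (S.card : ℝ) ^ k ≤ (S.card : ℝ) ^ (j:ℝ) := Real.rpow_le_rpow_of_exponent_le hm1 hkj
      _ = (S.card : ℝ) ^ j := Real.rpow_natCast _ _
      _ ≤ ((5 * n) ^ d) ^ j := pow_le_pow_left₀ (by linarith) h5 _
      _ = _ := by rw [pow_mul]
  rw [mul_pow] at a1
  rw [Real.rpow_neg (by linarith), ← div_eq_mul_inv, div_le_div_iff₀ (by positivity) (by positivity)]
  calc C * (S.card : ℝ) ^ k ≤ C * (5 ^ (d * j) * (n:ℝ) ^ (d * j)) := mul_le_mul_of_nonneg_left a1 hC.le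
    _ = _ := by ring

end

end UI

theorem statement14 (d : ℕ) (hd : 2 ≤ d) :
    ∃ C₁₀ : ℝ, 0 < C₁₀ ∧ ∀ k : ℝ, 0 < k → ∃ Ck : ℝ, 0 < Ck ∧
      ∀ n : ℕ, 1 ≤ n → ∀ S : Finset (V d), S.Nonempty → S ⊆ ball d n →
        μ0 {ω | ¬ ∀ a : ℝ, 1 ≤ a →
            uAggFrom S ω ⌊(a - 1) * S.card⌋₊ ⊆
              ball d ((n : ℝ) * a ^ ((1 : ℝ)/d) *
                (1 + C₁₀ * (n : ℝ) ^ (-(1 / (5 * (d : ℝ))))))} ≤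
          ENNReal.ofReal (Ck * (S.card : ℝ) ^ (-k)) := by
  exact UI.main_thm d hd
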